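/- Let A be the Plücker algebra of a Grassmannian G(r,n) which is not G(2,4), let d = r(n-r)+1, and let m be the irrelevant maximal ideal of A. Then H^i_m(Der_k(A)) = 0 for all 0 ≤ i ≤ d-1, where Der_k(A) is the A-module of k-linear derivations of A. -/

import Mathlib

/-!
STATEMENT 3: Let `A` be the Plücker algebra of a Grassmannian `G(r,n)` which is
not `G(2,4)`, let `d = r(n-r)+1`, and let `m` be the irrelevant maximal ideal of
`A`.  Then `H^i_m(Der_k(A)) = 0` for all `0 ≤ i ≤ d-1`, where `Der_k(A)` is the
`A`-module of `k`-linear derivations of `A`.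
-/

noncomputable section
set_option synthInstance.maxHeartbeats 1000000
set_option maxHeartbeats 2000000

namespace Plucker

variable (k : Type) [Field k] (r n : ℕ)

/-- The polynomial ring `S = k[x_{ij} : 1 ≤ i ≤ n, 1 ≤ j ≤ r]`, the coordinate
ring of the space of `n × r` matrices. -/
abbrev S := MvPolynomial (Fin n × Fin r) k

/-- The maximal (`r × r`) minor of the generic `n × r` matrix `(x_{ij})`
corresponding to a choice `f : Fin r → Fin n` of `r` rows. -/
def minor (f : Fin r → Fin n) : S k r n :=
  (Matrix.of fun i j : Fin r => MvPolynomial.X (f i, j)).det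

/-- The Plücker algebra of the Grassmannian `G(r,n)`: the subalgebra of `S`
generated by the maximal minors of the generic `n × r` matrix; equivalently the
ring of invariants `S^{SL_r}`, i.e. the homogeneous coordinate ring of `G(r,n)`
in the Plücker embedding. -/
def algebra : Subalgebra k (S k r n) :=
  Algebra.adjoin k (Set.range (minor k r n))

instance : CommRing (algebra k r n) := inferInstance
instance : Algebra k (algebra k r n) := inferInstance

/-- The irrelevant maximal ideal of the Plücker algebra: the ideal generated by
the Plücker coordinates (the maximal minors). -/
def irrelevant : Ideal (algebra k r n) :=
  Ideal.span { a : algebra k r n | ∃ f : Fin r → Fin n, (a : S k r n) = minor k r n f }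

end Plucker

open CategoryTheory
namespace ExtVan
variable {R : Type} [CommRing R]

/-- Every degree `i` cocycle of `Hom(P, N)` is a coboundary. -/
def Van (P : ChainComplex (ModuleCat.{0} R) ℕ) (i : ℕ) (N : ModuleCat.{0} R) : Prop :=
  ∀ φ : P.X i ⟶ N, P.d (i + 1) i ≫ φ = 0 → ∃ ψ : P.X (i - 1) ⟶ N, φ = P.d i (i - 1) ≫ ψ

theorem Van.of_injective {P : ChainComplex (ModuleCat.{0} R) ℕ} {M N : ModuleCat.{0} R}
    (f : M ⟶ N) [Mono f] (h : Van P 0 N) : Van P 0 M := by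
  intro φ hφ
  obtain ⟨ψ, hψ⟩ := h (φ ≫ f) (by rw [← Category.assoc, hφ, Limits.zero_comp])
  have h0 : P.d 0 (0 - 1) = 0 := P.shape _ _ (by simp)
  rw [h0, Limits.zero_comp] at hψ
  refine ⟨0, ?_⟩
  rw [Limits.comp_zero, ← cancel_mono f, hψ, Limits.zero_comp]

theorem Van.succ {P : ChainComplex (ModuleCat.{0} R) ℕ} [∀ i, Projective (P.X i)]
    {M N Q : ModuleCat.{0} R} (f : M ⟶ N) (g : N ⟶ Q) [Mono f] [Epi g]
    (hfg : Function.Exact f g) {i : ℕ} (hQ : Van P i Q) (hN : Van P (i + 1) N) :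
    Van P (i + 1) M := by
  have hw : f ≫ g = 0 := by ext x; exact hfg.apply_apply_eq_zero x
  have hS : (ShortComplex.mk f g hw).Exact := by
    rw [ShortComplex.moduleCat_exact_iff]
    intro x hx; exact (hfg x).1 hx
  intro φ hφ
  obtain ⟨ψ, hψ⟩ := hN (φ ≫ f) (by rw [← Category.assoc, hφ, Limits.zero_comp])
  obtain ⟨ψ, rfl⟩ : ∃ ψ' : P.X i ⟶ N, ψ' = ψ := ⟨ψ, rfl⟩
  replace hψ : φ ≫ f = P.d (i + 1) i ≫ ψ := hψ
  obtain ⟨χ, hχ⟩ := hQ (ψ ≫ g) (by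
    rw [← Category.assoc, ← hψ, Category.assoc, hw, Limits.comp_zero])
  have hz : (ψ - P.d i (i - 1) ≫ Projective.factorThru χ g) ≫ g = 0 := by
    rw [Preadditive.sub_comp, Category.assoc, Projective.factorThru_comp, hχ, sub_self]
  have : Mono (ShortComplex.mk f g hw).f := ‹_›
  have hl : hS.lift _ hz ≫ f = _ := hS.lift_f _ hz
  refine ⟨hS.lift _ hz, ?_⟩
  change φ = P.d (i + 1) i ≫ _
  rw [← cancel_mono f, Category.assoc, hl, hψ, Preadditive.comp_sub]
  simp

theorem Van.of_homotopy {P : ChainComplex (ModuleCat.{0} R) ℕ} {N : ModuleCat.{0} R} (J : Ideal R)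
    (hP : ∀ a ∈ J, Nonempty (Homotopy (a • 𝟙 P) 0))
    (hN : (1 : Module.End R N) ∈ J • (⊤ : Submodule R (Module.End R N))) (i : ℕ) : Van P i N := by
  intro φ hφ
  suffices H : ∀ q ∈ J • (⊤ : Submodule R (Module.End R N)),
      ∃ ψ : P.X (i - 1) ⟶ N, φ ≫ ModuleCat.ofHom q = P.d i (i - 1) ≫ ψ by
    obtain ⟨ψ, hψ⟩ := H 1 hN
    exact ⟨ψ, by rw [← hψ]; ext; rfl⟩
  intro q hq
  refine Submodule.smul_induction_on hq ?_ ?_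
  · intro a ha q _
    obtain ⟨h⟩ := hP a ha
    have hc := h.comm i
    have hφq : P.d (i + 1) i ≫ φ ≫ ModuleCat.ofHom q = 0 := by rw [← Category.assoc, hφ, Limits.zero_comp]
    refine ⟨h.hom (i - 1) i ≫ φ ≫ ModuleCat.ofHom q, ?_⟩
    have e : φ ≫ ModuleCat.ofHom (a • q) = (a • 𝟙 P : P ⟶ P).f i ≫ φ ≫ ModuleCat.ofHom q := by
      ext x; simp
    rw [e, hc, prevD_eq (f := h.hom) (j := i) (j' := i + 1) (by simp)]
    rcases i with _ | i
    · have h0 : P.d 0 (0 - 1) = 0 := P.shape _ _ (by simp)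
      rw [h0, Limits.zero_comp]
      simp [hφq]
    · rw [dNext_eq (f := h.hom) (i := i + 1) (i' := i) (by simp)]
      simp [hφq]
  · rintro q q' ⟨ψ, h⟩ ⟨ψ', h'⟩
    refine ⟨ψ + ψ', ?_⟩
    rw [Preadditive.comp_add, ← h, ← h', ← Preadditive.comp_add]
    rfl

theorem one_mem_pow_smul_top {N : ModuleCat.{0} R} {J : Ideal R}
    (hN : (1 : Module.End R N) ∈ J • (⊤ : Submodule R (Module.End R N))) (t : ℕ) :
    (1 : Module.End R N) ∈ J ^ t • (⊤ : Submodule R (Module.End R N)) := by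
  have htop : J • (⊤ : Submodule R (Module.End R N)) = ⊤ := by
    rw [eq_top_iff]
    intro q _
    have : ∀ p ∈ J • (⊤ : Submodule R (Module.End R N)), q * p ∈ J • (⊤ : Submodule R (Module.End R N)) := by
      intro p hp
      refine Submodule.smul_induction_on hp (fun a ha p _ => ?_) (fun x y hx hy => ?_)
      · rw [mul_smul_comm]; exact Submodule.smul_mem_smul ha trivial
      · rw [mul_add]; exact add_mem hx hy
    simpa using this 1 hN
  have : J ^ t • (⊤ : Submodule R (Module.End R N)) = ⊤ := by
    induction t with
    | zero => simp
    | succ t ih => rw [pow_succ, Submodule.mul_smul, htop, ih]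
  rw [this]; trivial

theorem homotopy_of_mem {I : Ideal R} (P : ProjectiveResolution (ModuleCat.of R (R ⧸ I))) (a : R)
    (ha : a ∈ I) : Nonempty (Homotopy (a • 𝟙 P.complex) 0) := by
  refine ⟨ProjectiveResolution.liftHomotopyZero _ ?_⟩
  apply HomologicalComplex.to_single_hom_ext
  ext x
  have key : ∀ y : R ⧸ I, a • y = 0 := by
    intro y
    obtain ⟨y, rfl⟩ := Ideal.Quotient.mk_surjective y
    rw [← Ideal.Quotient.mk_eq_mk, ← Submodule.Quotient.mk_smul]
    exact (Submodule.Quotient.mk_eq_zero _).2 (I.mul_mem_right _ ha)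
  rw [HomologicalComplex.comp_f]
  simp only [HomologicalComplex.smul_f_apply, HomologicalComplex.id_f]
  rw [Linear.smul_comp, Category.id_comp]
  exact key _

theorem isZero_ext {X N : ModuleCat.{0} R} (P : ProjectiveResolution X) (i : ℕ)
    (h : Van P.complex i N) : 
    Limits.IsZero (((Ext R (ModuleCat.{0} R) i).obj (Opposite.op X)).obj N) := by
  refine Limits.IsZero.of_iso ?_ (P.isoExt i N)
  rw [← HomologicalComplex.exactAt_iff_isZero_homology]
  rw [HomologicalComplex.exactAt_iff' _ (i - 1) i (i + 1) (by cases i <;> simp) (by simp),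
    ShortComplex.moduleCat_exact_iff]
  intro φ hφ
  obtain ⟨ψ, hψ⟩ := h φ hφ
  exact ⟨ψ, hψ.symm⟩

theorem subsingleton_localCohomology (J : Ideal R) (i : ℕ) (N : ModuleCat.{0} R)
    (h : ∀ (t : ℕ) (P : ProjectiveResolution (ModuleCat.of R (R ⧸ J ^ t))), Van P.complex i N) :
    Subsingleton ((localCohomology J i).obj N) := by
  have key : Limits.IsZero ((localCohomology J i).obj N) := by
    have hd : ∀ t, Limits.IsZero
        (((localCohomology.diagram (localCohomology.idealPowersDiagram J) i).obj t).obj N) := by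
      intro t
      exact isZero_ext (ProjectiveResolution.of _) i (h _ _)
    have := localCohomology.hasColimitDiagram (localCohomology.idealPowersDiagram J) i
    refine Limits.IsZero.of_iso ?_ (Limits.colimitObjIsoColimitCompEvaluation
      (localCohomology.diagram (localCohomology.idealPowersDiagram J) i) N)
    rw [Limits.IsZero.iff_id_eq_zero]
    apply Limits.colimit.hom_ext
    intro t
    exact (hd t).eq_of_src _ _
  exact ModuleCat.subsingleton_of_isZero key

variable {H : Type} [AddCommGroup H] [Module R H]

/-- The identity of `N` is a `J`-linear combination of operators preserving `N`. -/
def Contracts (J : Ideal R) (N : Submodule R H) : Prop :=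
  ∃ (F : Type) (_ : Fintype F) (a : F → R) (q : F → H →ₗ[R] H), (∀ f, a f ∈ J) ∧
    (∀ f, ∀ x ∈ N, q f x ∈ N) ∧ ∀ x ∈ N, ∑ f, a f • q f x = x

theorem Contracts.one_mem {J : Ideal R} {N : Submodule R H} (h : Contracts J N) :
    (1 : Module.End R N) ∈ J • (⊤ : Submodule R (Module.End R N)) := by
  obtain ⟨F, _, a, q, ha, hq, hs⟩ := h
  have : (1 : Module.End R N) = ∑ f, a f • (q f).restrict (hq f) := by
    ext x
    simpa using (hs x x.2).symm
  rw [this]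
  exact sum_mem fun f _ => Submodule.smul_mem_smul (ha f) trivial

theorem van_ker {P : ChainComplex (ModuleCat.{0} R) ℕ} [∀ i, Projective (P.X i)]
    (D : H →ₗ[R] H) (N : ℕ → Submodule R H) (L : ℕ)
    (hN : ∀ i j, Van P i (ModuleCat.of R (N j)))
    (hD : ∀ j, ∀ x ∈ N j, D x ∈ N (j + 1))
    (hDD : ∀ x, D (D x) = 0)
    (hex : ∀ j, j + 1 < L → ∀ x ∈ N (j + 1), D x = 0 → ∃ y ∈ N j, D y = x) :
    ∀ i j, i + j ≤ L → Van P i (ModuleCat.of R (N j ⊓ LinearMap.ker D : Submodule R H)) := by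
  have mono : ∀ {M M' : Submodule R H} (h : M ≤ M'),
      Mono (ModuleCat.ofHom (Submodule.inclusion h)) := fun h =>
    (ModuleCat.mono_iff_injective _).2 (Submodule.inclusion_injective h)
  intro i
  induction i with
  | zero =>
    intro j _
    have := mono (inf_le_left : N j ⊓ LinearMap.ker D ≤ N j)
    exact Van.of_injective (ModuleCat.ofHom (Submodule.inclusion inf_le_left)) (hN 0 j)
  | succ i ih =>
    intro j hij
    have := mono (inf_le_left : N j ⊓ LinearMap.ker D ≤ N j)
    let g : N j →ₗ[R] (N j).map D := D.submoduleMap (N j)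
    have hg : Function.Surjective g := D.submoduleMap_surjective (N j)
    have : Epi (ModuleCat.ofHom g) := (ModuleCat.epi_iff_surjective _).2 hg
    have hle : (N j).map D ≤ N (j + 1) := by
      rintro _ ⟨x, hx, rfl⟩; exact hD j x hx
    refine Van.succ (ModuleCat.ofHom (Submodule.inclusion inf_le_left)) (ModuleCat.ofHom g)
      ?_ ?_ (hN (i + 1) j)
    · intro x
      constructor
      · intro hx
        exact ⟨⟨x, x.2, congrArg Subtype.val hx⟩, rfl⟩
      · rintro ⟨y, rfl⟩
        exact Subtype.ext y.2.2
    · rcases i with _ | i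
      · have := mono hle
        exact Van.of_injective (ModuleCat.ofHom (Submodule.inclusion hle)) (hN 0 (j + 1))
      · have e : (N j).map D = N (j + 1) ⊓ LinearMap.ker D := by
          apply le_antisymm
          · rintro _ ⟨x, hx, rfl⟩; exact ⟨hD j x hx, hDD x⟩
          · rintro x ⟨hx, hx'⟩
            obtain ⟨y, hy, rfl⟩ := hex j (by omega) x hx hx'
            exact ⟨y, hy, rfl⟩
        rw [e]
        exact ih (j + 1) (by omega)

theorem Van.of_equiv {P : ChainComplex (ModuleCat.{0} R) ℕ} {M N : ModuleCat.{0} R} (e : M ≅ N)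
    {i : ℕ} (h : Van P i N) : Van P i M := by
  intro φ hφ
  obtain ⟨ψ, hψ⟩ := h (φ ≫ e.hom) (by rw [← Category.assoc, hφ, Limits.zero_comp])
  refine ⟨ψ ≫ e.inv, ?_⟩
  rw [← Category.assoc, ← hψ, Category.assoc, e.hom_inv_id, Category.comp_id]

/-- Local cohomology of a module resolved by `J`-contractible modules vanishes in low degrees. -/
theorem subsingleton_of_complex (J : Ideal R) (D : H →ₗ[R] H) (N : ℕ → Submodule R H) (L : ℕ)
    (hN : ∀ j, Contracts J (N j))
    (hD : ∀ j, ∀ x ∈ N j, D x ∈ N (j + 1)) (hDD : ∀ x, D (D x) = 0)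
    (hex : ∀ j, j + 1 < L → ∀ x ∈ N (j + 1), D x = 0 → ∃ y ∈ N j, D y = x)
    {M : Type} [AddCommGroup M] [Module R M]
    (e : M ≃ₗ[R] (N 0 ⊓ LinearMap.ker D : Submodule R H)) (i : ℕ) (hi : i ≤ L) :
    Subsingleton ((localCohomology J i).obj (ModuleCat.of R M)) := by
  refine subsingleton_localCohomology J i _ fun t P => ?_
  have := P.projective
  refine Van.of_equiv (LinearEquiv.toModuleIso e) ?_
  refine van_ker D N L (fun i j => ?_) hD hDD hex i 0 (by omega)
  exact Van.of_homotopy (J ^ t) (fun a ha => homotopy_of_mem P a ha)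
    (one_mem_pow_smul_top (hN j).one_mem t) i

end ExtVan

set_option linter.unusedSectionVars false
set_option linter.unusedSimpArgs false

namespace Fock

section operators

theorem lie_mul_right {L : Type*} [Ring L] (x y z : L) : ⁅x, y * z⁆ = ⁅x, y⁆ * z + y * ⁅x, z⁆ := by
  simp only [Ring.lie_def]; noncomm_ring

section bracket
variable {L : Type*} [Ring L] (x y z : L)
theorem add_br : ⁅x + y, z⁆ = ⁅x, z⁆ + ⁅y, z⁆ := by simp only [Ring.lie_def]; noncomm_ring
theorem sub_br : ⁅x - y, z⁆ = ⁅x, z⁆ - ⁅y, z⁆ := by simp only [Ring.lie_def]; noncomm_ring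
theorem br_add : ⁅x, y + z⁆ = ⁅x, y⁆ + ⁅x, z⁆ := by simp only [Ring.lie_def]; noncomm_ring
theorem br_sub : ⁅x, y - z⁆ = ⁅x, y⁆ - ⁅x, z⁆ := by simp only [Ring.lie_def]; noncomm_ring
theorem br_skew : ⁅x, y⁆ = -⁅y, x⁆ := by simp only [Ring.lie_def]; noncomm_ring
theorem br_sum {T : Type*} (s : Finset T) (f : T → L) : ⁅x, ∑ t ∈ s, f t⁆ = ∑ t ∈ s, ⁅x, f t⁆ := by
  simp only [Ring.lie_def, Finset.mul_sum, Finset.sum_mul, Finset.sum_sub_distrib]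
theorem sum_br {T : Type*} (s : Finset T) (f : T → L) : ⁅∑ t ∈ s, f t, x⁆ = ∑ t ∈ s, ⁅f t, x⁆ := by
  simp only [Ring.lie_def, Finset.mul_sum, Finset.sum_mul, Finset.sum_sub_distrib]
end bracket

variable {ι κ : Type} [Fintype ι] [Fintype κ] [DecidableEq ι] [DecidableEq κ]

/-- A representation of `gl(ι ⊕ κ)` commuting with creation and annihilation operators indexed by
`ι × κ` and with matrix units indexed by `Option (ι × κ)`. -/
structure Sys (ι κ : Type) [DecidableEq ι] [DecidableEq κ] (L : Type*) [Ring L] where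
  E : ι ⊕ κ → ι ⊕ κ → L
  c : ι × κ → L
  a : ι × κ → L
  U : Option (ι × κ) → Option (ι × κ) → L
  EE : ∀ p q s t, ⁅E p q, E s t⁆ = (if q = s then E p t else 0) - (if t = p then E s q else 0)
  cc : ∀ x y, c x * c y = - (c y * c x)
  aa : ∀ x y, a x * a y = - (a y * a x)
  ac : ∀ x y, a x * c y = (if x = y then 1 else 0) - c y * a x
  Ec : ∀ p q x, ⁅E p q, c x⁆ = 0
  Ea : ∀ p q x, ⁅E p q, a x⁆ = 0
  EU : ∀ p q x y, ⁅E p q, U x y⁆ = 0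
  Uc : ∀ x y z, ⁅U x y, c z⁆ = 0
  Ua : ∀ x y z, ⁅U x y, a z⁆ = 0
  UU : ∀ x y z w, U x y * U z w = if y = z then U x w else 0

namespace Sys
variable {L : Type*} [Ring L] (S : Sys ι κ L)

/-- Raising operator `X`. -/
def X (x : ι × κ) : L := S.E (.inl x.1) (.inr x.2)
/-- Lowering operator `Y`. -/
def Y (x : ι × κ) : L := S.E (.inr x.2) (.inl x.1)
def d : L := ∑ x, S.c x * S.X x
def del : L := ∑ x, S.a x * S.Y x
def C (x : ι × κ) : L := S.U none (some x)
def tau : L := ∑ x, S.c x * S.C x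
def num : L := ∑ x, S.c x * S.a x
def Utot : L := ∑ x : ι × κ, S.U (some x) (some x)
/-- Second quantised matrix unit. -/
def Om (x y : ι × κ) : L := S.c x * S.a y + S.U (some x) (some y)
def F (i j : ι) : L := S.E (.inl i) (.inl j) - ∑ a, S.Om (j, a) (i, a)
def G (b a : κ) : L := S.E (.inr b) (.inr a) + ∑ l, S.Om (l, b) (l, a)
def KF : L := ∑ i, ∑ j, ∑ a, ∑ b, S.c (i, a) * S.a (j, a) * S.U (some (j, b)) (some (i, b))
def KG : L := ∑ i, ∑ l, ∑ a, ∑ b, S.c (i, a) * S.a (i, b) * S.U (some (l, b)) (some (l, a))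
def box : L := S.d * S.del + S.del * S.d

theorem Om_c (x y z : ι × κ) : ⁅S.Om x y, S.c z⁆ = if y = z then S.c x else 0 := by
  have h : ⁅S.c x * S.a y, S.c z⁆ = S.c x * (S.a y * S.c z + S.c z * S.a y)
      - (S.c x * S.c z + S.c z * S.c x) * S.a y := by
    simp only [Ring.lie_def]; noncomm_ring
  rw [Om, add_br, S.Uc, h, S.ac, S.cc x z]
  split_ifs <;> simp

theorem Om_a (x y z : ι × κ) : ⁅S.Om x y, S.a z⁆ = - if x = z then S.a y else 0 := by
  have h : ⁅S.c x * S.a y, S.a z⁆ = S.c x * (S.a y * S.a z + S.a z * S.a y)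
      - (S.a z * S.c x + S.c x * S.a z) * S.a y := by
    simp only [Ring.lie_def]; noncomm_ring
  rw [Om, add_br, S.Ua, h, S.ac, S.aa y z]
  simp only [eq_comm (a := z)]
  split_ifs <;> simp

theorem U_ca (p q : Option (ι × κ)) (x y : ι × κ) : ⁅S.U p q, S.c x * S.a y⁆ = 0 := by
  rw [lie_mul_right, S.Uc, S.Ua]; simp

theorem Om_C (x y z : ι × κ) : ⁅S.Om x y, S.C z⁆ = - if z = x then S.C y else 0 := by
  rw [Om, add_br, br_skew _ (S.C z), C, S.U_ca]
  simp [Ring.lie_def, S.UU, C]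

theorem E_Om (p q x y) : ⁅S.E p q, S.Om x y⁆ = 0 := by
  rw [Om, br_add, lie_mul_right, S.Ec, S.Ea, S.EU]; simp

theorem Om_E (p q x y) : ⁅S.Om x y, S.E p q⁆ = 0 := by rw [br_skew, E_Om, neg_zero]

theorem E_C (p q x) : ⁅S.E p q, S.C x⁆ = 0 := S.EU _ _ _ _

theorem F_c (i j l a) : ⁅S.F i j, S.c (l, a)⁆ = - if i = l then S.c (j, a) else 0 := by
  simp only [F, sub_br, S.Ec, sum_br, S.Om_c, Prod.mk.injEq]
  simp [ite_and]

theorem F_a (i j l a) : ⁅S.F i j, S.a (l, a)⁆ = if j = l then S.a (i, a) else 0 := by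
  simp only [F, sub_br, S.Ea, sum_br, S.Om_a, Prod.mk.injEq]
  simp [ite_and]

theorem F_C (i j l a) : ⁅S.F i j, S.C (l, a)⁆ = if l = j then S.C (i, a) else 0 := by
  simp only [F, sub_br, S.E_C, sum_br, S.Om_C, Prod.mk.injEq]
  simp [ite_and]

theorem G_c (b a l e) : ⁅S.G b a, S.c (l, e)⁆ = if a = e then S.c (l, b) else 0 := by
  simp only [G, add_br, S.Ec, sum_br, S.Om_c, Prod.mk.injEq]
  simp [ite_and]

theorem G_a (b a l e) : ⁅S.G b a, S.a (l, e)⁆ = - if b = e then S.a (l, a) else 0 := by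
  simp only [G, add_br, S.Ea, sum_br, S.Om_a, Prod.mk.injEq]
  simp [ite_and]

theorem G_C (b a l e) : ⁅S.G b a, S.C (l, e)⁆ = - if e = b then S.C (l, a) else 0 := by
  simp only [G, add_br, S.E_C, sum_br, S.Om_C, Prod.mk.injEq]
  simp [ite_and]

theorem F_X (i j l a) : ⁅S.F i j, S.X (l, a)⁆ = if j = l then S.X (i, a) else 0 := by
  simp only [F, sub_br, sum_br, X, S.EE, S.Om_E]
  simp

theorem F_Y (i j l a) : ⁅S.F i j, S.Y (l, a)⁆ = - if l = i then S.Y (j, a) else 0 := by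
  simp only [F, sub_br, sum_br, Y, S.EE, S.Om_E]
  simp

theorem G_X (b a l e) : ⁅S.G b a, S.X (l, e)⁆ = - if e = b then S.X (l, a) else 0 := by
  simp only [G, add_br, sum_br, X, S.EE, S.Om_E]
  simp

theorem G_Y (b a l e) : ⁅S.G b a, S.Y (l, e)⁆ = if a = e then S.Y (l, b) else 0 := by
  simp only [G, add_br, sum_br, Y, S.EE, S.Om_E]
  simp

theorem F_d (i j) : ⁅S.F i j, S.d⁆ = 0 := by
  simp only [d, br_sum, lie_mul_right, Fintype.sum_prod_type, F_c, F_X]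
  simp [Finset.sum_add_distrib, ite_mul]
  
theorem F_del (i j) : ⁅S.F i j, S.del⁆ = 0 := by
  simp only [del, br_sum, lie_mul_right, Fintype.sum_prod_type, F_a, F_Y]
  simp [Finset.sum_add_distrib, ite_mul]

theorem F_tau (i j) : ⁅S.F i j, S.tau⁆ = 0 := by
  simp only [tau, br_sum, lie_mul_right, Fintype.sum_prod_type, F_c, F_C]
  simp [Finset.sum_add_distrib, ite_mul]

theorem G_d (i j) : ⁅S.G i j, S.d⁆ = 0 := by
  simp only [d, br_sum, lie_mul_right, Fintype.sum_prod_type, G_c, G_X]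
  simp [Finset.sum_add_distrib, ite_mul]

theorem G_del (i j) : ⁅S.G i j, S.del⁆ = 0 := by
  simp only [del, br_sum, lie_mul_right, Fintype.sum_prod_type, G_a, G_Y]
  simp [Finset.sum_add_distrib, ite_mul]

theorem G_tau (i j) : ⁅S.G i j, S.tau⁆ = 0 := by
  simp only [tau, br_sum, lie_mul_right, Fintype.sum_prod_type, G_c, G_C]
  simp [Finset.sum_add_distrib, ite_mul]

theorem Om_num (x y) : ⁅S.Om x y, S.num⁆ = 0 := by
  simp only [num, br_sum, lie_mul_right, Om_c, Om_a]
  simp [Finset.sum_add_distrib]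

theorem Om_Utot (x y) : ⁅S.Om x y, S.Utot⁆ = 0 := by
  simp only [Utot, br_sum, Om, add_br, br_skew (S.c _ * S.a _) (S.U _ _), U_ca]
  simp [Ring.lie_def, S.UU]

/-- The central element of the twisted `gl(ι)`. -/
def tr : L := ∑ i, S.F i i

theorem tr_eq : S.tr = ∑ i, S.E (.inl i) (.inl i) - S.num - S.Utot := by
  simp only [tr, F, Om, num, Utot, Fintype.sum_prod_type, Finset.sum_sub_distrib,
    Finset.sum_add_distrib]
  abel

theorem F_tr (i j) : ⁅S.F i j, S.tr⁆ = 0 := by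
  have h2 : ∀ p q, ⁅S.E p q, S.num⁆ = 0 := fun p q => by
    simp only [num, br_sum, lie_mul_right, S.Ec, S.Ea]; simp
  have h3 : ∀ p q, ⁅S.E p q, S.Utot⁆ = 0 := fun p q => by
    simp only [Utot, br_sum, S.EU]; simp
  have h4 : ⁅S.E (.inl i) (.inl j), ∑ i, S.E (.inl i) (.inl i)⁆ = 0 := by
    simp [br_sum, S.EE]
  have h5 : ∀ x y, ⁅S.Om x y, ∑ i, S.E (.inl i) (.inl i)⁆ = 0 := fun x y => by
    simp [br_sum, Om_E]
  rw [tr_eq, F, sub_br, sum_br]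
  simp only [br_sub, br_add, h2, h3, h4, h5, Om_num, Om_Utot]
  simp

theorem G_tr (i j) : ⁅S.G i j, S.tr⁆ = 0 := by
  have h2 : ∀ p q, ⁅S.E p q, S.num⁆ = 0 := fun p q => by
    simp only [num, br_sum, lie_mul_right, S.Ec, S.Ea]; simp
  have h3 : ∀ p q, ⁅S.E p q, S.Utot⁆ = 0 := fun p q => by
    simp only [Utot, br_sum, S.EU]; simp
  have h4 : ⁅S.E (.inr i) (.inr j), ∑ i, S.E (.inl i) (.inl i)⁆ = 0 := by
    simp [br_sum, S.EE]
  have h5 : ∀ x y, ⁅S.Om x y, ∑ i, S.E (.inl i) (.inl i)⁆ = 0 := fun x y => by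
    simp [br_sum, Om_E]
  rw [tr_eq, G, add_br, sum_br]
  simp only [br_sub, br_add, h2, h3, h4, h5, Om_num, Om_Utot]
  simp

theorem sum_ca_KF : ∑ i, ∑ j, ∑ a, S.c (i, a) * S.a (j, a) * S.E (.inl i) (.inl j) =
    ∑ i, ∑ j, ∑ a, S.c (i, a) * S.a (j, a) * S.F i j + S.KF
    + ∑ i, ∑ j, ∑ a, ∑ b, S.c (i, a) * S.a (j, a) * (S.c (j, b) * S.a (i, b)) := by
  simp only [F, KF, Om, mul_sub, Finset.mul_sum, mul_add, Finset.sum_sub_distrib,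
    Finset.sum_add_distrib]
  abel

theorem sum_ca_KG : ∑ i, ∑ a, ∑ b, S.c (i, a) * S.a (i, b) * S.E (.inr b) (.inr a) =
    ∑ i, ∑ a, ∑ b, S.c (i, a) * S.a (i, b) * S.G b a - S.KG
    - ∑ i, ∑ l, ∑ a, ∑ b, S.c (i, a) * S.a (i, b) * (S.c (l, b) * S.a (l, a)) := by
  have e : ∀ f : ι → ι → κ → κ → L,
      ∑ i, ∑ l, ∑ a, ∑ b, f i l a b = ∑ i, ∑ a, ∑ b, ∑ l, f i l a b := fun f => by
    refine Finset.sum_congr rfl fun i _ => ?_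
    rw [Finset.sum_comm]
    refine Finset.sum_congr rfl fun a _ => Finset.sum_comm
  simp only [G, KG, Om, e, mul_add, Finset.mul_sum, Finset.sum_add_distrib]
  abel

theorem quartic : ∑ i, ∑ j, ∑ a, ∑ b, S.c (i, a) * S.a (j, a) * (S.c (j, b) * S.a (i, b))
    + ∑ i, ∑ l, ∑ a, ∑ b, S.c (i, a) * S.a (i, b) * (S.c (l, b) * S.a (l, a))
    = (Fintype.card ι + Fintype.card κ) * S.num := by
  have q : ∀ x y z w, S.c x * S.a y * (S.c z * S.a w) =
      (if y = z then S.c x * S.a w else 0) - S.c x * S.c z * (S.a y * S.a w) := by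
    intro x y z w
    have : S.c x * S.a y * (S.c z * S.a w) = S.c x * (S.a y * S.c z) * S.a w := by noncomm_ring
    rw [this, S.ac]
    split_ifs <;> noncomm_ring
  simp only [q, Finset.sum_sub_distrib, Prod.mk.injEq]
  have z : ∑ i, ∑ j, ∑ a, ∑ b, S.c (i, a) * S.c (j, b) * (S.a (j, a) * S.a (i, b)) =
      - ∑ i, ∑ l, ∑ a, ∑ b, S.c (i, a) * S.c (l, b) * (S.a (i, b) * S.a (l, a)) := by
    simp only [← Finset.sum_neg_distrib]
    refine Finset.sum_congr rfl fun i _ => Finset.sum_congr rfl fun j _ => 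
      Finset.sum_congr rfl fun a _ => Finset.sum_congr rfl fun b _ => ?_
    rw [S.aa]; noncomm_ring
  rw [z]
  simp only [true_and, and_true]
  have e1 : ∑ i : ι, ∑ j : ι, ∑ a : κ, ∑ b : κ, (if a = b then S.c (i, a) * S.a (i, b) else 0) =
      Fintype.card ι * S.num := by
    simp [num, Fintype.sum_prod_type, Finset.mul_sum]
  have e2 : ∑ i : ι, ∑ l : ι, ∑ a : κ, ∑ b : κ, (if i = l then S.c (i, a) * S.a (l, a) else 0) =
      Fintype.card κ * S.num := by
    simp [num, Fintype.sum_prod_type, Finset.mul_sum]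
  rw [e1, e2]
  noncomm_ring

theorem br_XY (i a j b) : ⁅S.X (i, a), S.Y (j, b)⁆ =
    (if a = b then S.E (.inl i) (.inl j) else 0) - (if j = i then S.E (.inr b) (.inr a) else 0) := by
  simp [X, Y, S.EE]

theorem box_eq₀ : S.box = ∑ x, S.Y x * S.X x + ∑ x, ∑ y, S.c x * S.a y * ⁅S.X x, S.Y y⁆ := by
  have hXa : ∀ x y, S.X x * S.a y = S.a y * S.X x := fun x y => sub_eq_zero.1 (S.Ea _ _ y)
  have hYc : ∀ x y, S.Y x * S.c y = S.c y * S.Y x := fun x y => sub_eq_zero.1 (S.Ec _ _ y)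
  have h : ∀ x y, S.c x * S.X x * (S.a y * S.Y y) + S.a y * S.Y y * (S.c x * S.X x) =
      (if y = x then S.Y y * S.X x else 0) + S.c x * S.a y * ⁅S.X x, S.Y y⁆ := by
    intro x y
    have e1 : S.c x * S.X x * (S.a y * S.Y y) = S.c x * (S.X x * S.a y) * S.Y y := by noncomm_ring
    have e2 : S.a y * S.Y y * (S.c x * S.X x) = S.a y * (S.Y y * S.c x) * S.X x := by noncomm_ring
    have e3 : S.a y * (S.c x * S.Y y) * S.X x = (S.a y * S.c x) * (S.Y y * S.X x) := by noncomm_ring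
    rw [e1, e2, hXa, hYc, e3, S.ac, Ring.lie_def]
    split_ifs <;> noncomm_ring
  rw [box, d, del, Finset.sum_mul_sum, Finset.sum_mul_sum, Finset.sum_comm (s := Finset.univ) (t := Finset.univ) (f := fun i j => S.a i * S.Y i * (S.c j * S.X j)), ← Finset.sum_add_distrib]
  simp_rw [← Finset.sum_add_distrib, h, Finset.sum_add_distrib]
  simp

theorem box_eq₁ : S.box = ∑ x, S.Y x * S.X x
    + (∑ i, ∑ j, ∑ a, S.c (i, a) * S.a (j, a) * S.F i j -
      ∑ i, ∑ a, ∑ b, S.c (i, a) * S.a (i, b) * S.G b a)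
    + (Fintype.card ι + Fintype.card κ) * S.num + (S.KF + S.KG) := by
  have e : ∑ x, ∑ y, S.c x * S.a y * ⁅S.X x, S.Y y⁆ =
      ∑ i, ∑ j, ∑ a, S.c (i, a) * S.a (j, a) * S.E (.inl i) (.inl j) -
      ∑ i, ∑ a, ∑ b, S.c (i, a) * S.a (i, b) * S.E (.inr b) (.inr a) := by
    simp only [Fintype.sum_prod_type, br_XY, mul_sub, Finset.sum_sub_distrib, mul_ite, mul_zero]
    simp only [Finset.sum_ite_eq, Finset.mem_univ, if_true]
    congr 1
    · refine Finset.sum_congr rfl fun i _ => Finset.sum_comm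
    · refine Finset.sum_congr rfl fun i _ => Finset.sum_congr rfl fun a _ => ?_
      rw [Finset.sum_comm]; simp
  rw [box_eq₀, e, sum_ca_KF, sum_ca_KG, ← quartic]
  abel

theorem box_eq₂ : S.box = ∑ x, S.X x * S.Y x - Fintype.card κ * S.tr
    + Fintype.card ι * ∑ a, S.G a a
    + (∑ i, ∑ j, ∑ a, S.c (i, a) * S.a (j, a) * S.F i j -
      ∑ i, ∑ a, ∑ b, S.c (i, a) * S.a (i, b) * S.G b a)
    - (Fintype.card ι + Fintype.card κ) * S.Utot + (S.KF + S.KG) := by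
  have e : ∑ x, S.Y x * S.X x = ∑ x, S.X x * S.Y x - Fintype.card κ * S.tr
      + Fintype.card ι * ∑ a, S.G a a - (Fintype.card ι + Fintype.card κ) * (S.num + S.Utot) := by
    have h : ∀ x, S.Y x * S.X x = S.X x * S.Y x - ⁅S.X x, S.Y x⁆ := fun x => by
      rw [Ring.lie_def]; abel
    have hG : ∑ a, S.G a a = ∑ a, S.E (.inr a) (.inr a) + S.num + S.Utot := by
      simp only [G, Om, num, Utot, Fintype.sum_prod_type, Finset.sum_add_distrib,
        Finset.sum_comm (s := (Finset.univ : Finset κ)) (t := (Finset.univ : Finset ι))]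
      abel
    rw [hG, tr_eq]
    simp only [h, Finset.sum_sub_distrib]
    have : ∑ x : ι × κ, ⁅S.X x, S.Y x⁆ = Fintype.card κ * ∑ i, S.E (.inl i) (.inl i)
        - Fintype.card ι * ∑ a, S.E (.inr a) (.inr a) := by
      simp [Fintype.sum_prod_type, br_XY, Finset.mul_sum]
    rw [this]
    noncomm_ring
  rw [box_eq₁, e]
  noncomm_ring

/-- The total differential. -/
def D : L := S.d + S.tau

theorem cX (x y) : S.X x * S.c y = S.c y * S.X x := sub_eq_zero.1 (S.Ec _ _ y)
theorem CX (x y) : S.X x * S.C y = S.C y * S.X x := sub_eq_zero.1 (S.E_C _ _ y)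
theorem cC (x y) : S.C x * S.c y = S.c y * S.C x := sub_eq_zero.1 (S.Uc _ _ y)
theorem XX (x y) : S.X x * S.X y = S.X y * S.X x := by
  refine sub_eq_zero.1 ?_
  rw [← Ring.lie_def]; simp [X, S.EE]
theorem CC (x y) : S.C x * S.C y = 0 := by simp [C, S.UU]

theorem sum_c_sq (h2 : ∀ z : L, z + z = 0 → z = 0) (Z : ι × κ → L)
    (hc : ∀ x y, Z x * S.c y = S.c y * Z x) (hZ : ∀ x y, Z x * Z y = Z y * Z x) :
    (∑ x, S.c x * Z x) * ∑ x, S.c x * Z x = 0 := by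
  apply h2
  rw [Finset.sum_mul_sum]
  nth_rw 2 [Finset.sum_comm]
  rw [← Finset.sum_add_distrib]
  refine Finset.sum_eq_zero fun x _ => ?_
  rw [← Finset.sum_add_distrib]
  refine Finset.sum_eq_zero fun y _ => ?_
  have e1 : ∀ x y, S.c x * Z x * (S.c y * Z y) = S.c x * (Z x * S.c y) * Z y :=
    fun x y => by noncomm_ring
  have e2 : ∀ x y, S.c x * (S.c y * Z x) * Z y = S.c x * S.c y * (Z x * Z y) :=
    fun x y => by noncomm_ring
  rw [e1, e1, hc, hc, e2, e2, S.cc x y, hZ x y]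
  noncomm_ring

theorem d_d (h2 : ∀ z : L, z + z = 0 → z = 0) : S.d * S.d = 0 :=
  S.sum_c_sq h2 _ S.cX S.XX

theorem tau_tau (h2 : ∀ z : L, z + z = 0 → z = 0) : S.tau * S.tau = 0 :=
  S.sum_c_sq h2 _ S.cC fun x y => by rw [CC, CC]

theorem D_D (h2 : ∀ z : L, z + z = 0 → z = 0) : S.D * S.D = 0 := by
  have e : S.D = ∑ x, S.c x * (S.X x + S.C x) := by
    simp only [D, d, tau, mul_add, Finset.sum_add_distrib]
  rw [e]
  refine S.sum_c_sq h2 _ (fun x y => ?_) fun x y => ?_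
  · rw [add_mul, cX, cC, mul_add]
  · simp only [add_mul, mul_add, CC, S.XX x y, CX]
    abel

theorem d_tau (h2 : ∀ z : L, z + z = 0 → z = 0) : S.d * S.tau + S.tau * S.d = 0 := by
  have h := S.D_D h2
  rw [D, add_mul, mul_add, mul_add, S.d_d h2, S.tau_tau h2] at h
  simpa using h

theorem del_tau : S.del * S.tau + S.tau * S.del = ∑ x, S.C x * S.Y x := by
  have hYc : ∀ x y, S.Y x * S.c y = S.c y * S.Y x := fun x y => sub_eq_zero.1 (S.Ec _ _ y)
  have hYC : ∀ x y, S.Y x * S.C y = S.C y * S.Y x := fun x y => sub_eq_zero.1 (S.E_C _ _ y)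
  have hCa : ∀ x y, S.C x * S.a y = S.a y * S.C x := fun x y => sub_eq_zero.1 (S.Ua _ _ y)
  have h : ∀ x y, S.a x * S.Y x * (S.c y * S.C y) + S.c y * S.C y * (S.a x * S.Y x) =
      if x = y then S.C y * S.Y x else 0 := by
    intro x y
    have e1 : S.a x * S.Y x * (S.c y * S.C y) = S.a x * (S.Y x * S.c y) * S.C y := by noncomm_ring
    have e2 : S.c y * S.C y * (S.a x * S.Y x) = S.c y * (S.C y * S.a x) * S.Y x := by noncomm_ring
    have e3 : S.a x * (S.c y * S.Y x) * S.C y = (S.a x * S.c y) * (S.Y x * S.C y) := by noncomm_ring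
    rw [e1, e2, hYc, hCa, e3, hYC, S.ac]
    split_ifs <;> noncomm_ring
  rw [del, tau, Finset.sum_mul_sum, Finset.sum_mul_sum, Finset.sum_comm (s := Finset.univ) (t := Finset.univ) (f := fun i j => S.c i * S.C i * (S.a j * S.Y j)), ← Finset.sum_add_distrib]
  simp_rw [← Finset.sum_add_distrib, h]
  simp

end Sys

end operators

section signs
variable {α : Type} [Fintype α] [DecidableEq α]

/-- Relative sign of two labels. -/
noncomputable def rs (a b : α) : ℤ := if Fintype.equivFin α a < Fintype.equivFin α b then -1 else 1

/-- The sign of the position of `a` in `S`. -/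
noncomputable def sgn (a : α) (S : Finset α) : ℤ := ∏ b ∈ S, rs b a

theorem rs_self (a : α) : rs a a = 1 := by simp [rs]

theorem rs_ne {a b : α} (h : a ≠ b) : rs a b = - rs b a := by
  have : Fintype.equivFin α a ≠ Fintype.equivFin α b := by simpa using h
  rcases lt_or_gt_of_ne this with h | h <;> simp [rs, h, h.not_gt, not_lt.2 h.le]

theorem rs_sq (a b : α) : rs a b * rs a b = 1 := by unfold rs; split_ifs <;> norm_num

theorem sgn_sq (a : α) (S : Finset α) : sgn a S * sgn a S = 1 := by
  simp [sgn, ← Finset.prod_mul_distrib, rs_sq]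

theorem sgn_insert {a : α} (b : α) {S : Finset α} (h : a ∉ S) :
    sgn b (insert a S) = rs a b * sgn b S := by simp [sgn, h]

theorem sgn_erase {a : α} (b : α) {S : Finset α} (h : a ∈ S) :
    sgn b (S.erase a) = rs a b * sgn b S := by
  rw [sgn, sgn, ← Finset.mul_prod_erase S _ h, ← mul_assoc, rs_sq, one_mul]

end signs

section ops
variable {α : Type} [Fintype α] [DecidableEq α]
variable (k : Type) [CommRing k] {V : Type} [AddCommGroup V] [Module k V]

/-- Creation operator. -/
noncomputable def cr (a : α) : Module.End k (Finset α → V) where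
  toFun h S := if a ∈ S then sgn a S • h (S.erase a) else 0
  map_add' h g := by ext S; by_cases ha : a ∈ S <;> simp [ha]
  map_smul' r h := by
    ext S
    by_cases ha : a ∈ S <;> simp only [ha, if_true, if_false, Pi.smul_apply, RingHom.id_apply, smul_zero]
    rw [smul_comm]

/-- Annihilation operator. -/
noncomputable def an (a : α) : Module.End k (Finset α → V) where
  toFun h S := if a ∈ S then 0 else sgn a S • h (insert a S)
  map_add' h g := by ext S; by_cases ha : a ∈ S <;> simp [ha]
  map_smul' r h := by
    ext S
    by_cases ha : a ∈ S <;> simp only [ha, if_true, if_false, Pi.smul_apply, RingHom.id_apply, smul_zero]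
    rw [smul_comm]

theorem cr_apply (a : α) (h : Finset α → V) (S) :
    cr k a h S = if a ∈ S then sgn a S • h (S.erase a) else 0 := rfl
theorem an_apply (a : α) (h : Finset α → V) (S) :
    an k a h S = if a ∈ S then 0 else sgn a S • h (insert a S) := rfl

theorem cr_cr (a b : α) : (cr k a * cr k b : Module.End k (Finset α → V)) = - (cr k b * cr k a) := by
  refine LinearMap.ext fun h => funext fun S => ?_
  simp only [Module.End.mul_apply, LinearMap.neg_apply, Pi.neg_apply, cr_apply, Finset.mem_erase]
  rcases eq_or_ne a b with rfl | hab
  · simp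
  by_cases ha : a ∈ S <;> by_cases hb : b ∈ S <;> simp [ha, hb, hab, hab.symm]
  rw [sgn_erase _ ha, sgn_erase _ hb, rs_ne hab, Finset.erase_right_comm, smul_smul, smul_smul, ← neg_smul]
  congr 1; ring

theorem an_an (a b : α) : (an k a * an k b : Module.End k (Finset α → V)) = - (an k b * an k a) := by
  refine LinearMap.ext fun h => funext fun S => ?_
  simp only [Module.End.mul_apply, LinearMap.neg_apply, Pi.neg_apply, an_apply, Finset.mem_insert]
  rcases eq_or_ne a b with rfl | hab
  · simp
  by_cases ha : a ∈ S <;> by_cases hb : b ∈ S <;> simp [ha, hb, hab, hab.symm]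
  rw [sgn_insert _ ha, sgn_insert _ hb, rs_ne hab, Finset.insert_comm, smul_smul, smul_smul, ← neg_smul]
  congr 1; ring

theorem an_cr (a b : α) : (an k a * cr k b : Module.End k (Finset α → V)) =
    (if a = b then 1 else 0) - cr k b * an k a := by
  refine LinearMap.ext fun h => funext fun S => ?_
  simp only [Module.End.mul_apply, LinearMap.sub_apply, Pi.sub_apply, an_apply, cr_apply,
    Finset.mem_insert, Finset.mem_erase]
  rcases eq_or_ne a b with rfl | hab
  · by_cases ha : a ∈ S <;> simp [ha, sgn_insert, sgn_erase, rs_self, smul_smul, sgn_sq]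
  by_cases ha : a ∈ S <;> by_cases hb : b ∈ S <;> simp [ha, hb, hab, hab.symm]
  rw [sgn_insert _ ha, sgn_erase _ hb, rs_ne hab, Finset.erase_insert_of_ne hab, smul_smul,
    smul_smul, ← neg_smul]
  congr 1; ring

end ops

/-- A positive definite symmetric rational-valued form. -/
class PosForm (V : Type) [AddCommGroup V] where
  form : V →+ V →+ ℚ
  symm : ∀ x y, form x y = form y x
  nonneg : ∀ x, 0 ≤ form x x
  eq_zero : ∀ x, form x x = 0 → x = 0

instance {T : Type} [Fintype T] {V : Type} [AddCommGroup V] [PosForm V] : PosForm (T → V) where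
  form := AddMonoidHom.mk' (fun f => AddMonoidHom.mk' (fun g => ∑ t, PosForm.form (f t) (g t))
    (fun g g' => by simp [Finset.sum_add_distrib])) (fun f f' => by
      ext g; simp [Finset.sum_add_distrib])
  symm f g := Finset.sum_congr rfl fun t _ => PosForm.symm _ _
  nonneg f := Finset.sum_nonneg fun t _ => PosForm.nonneg _
  eq_zero f h := by
    ext t
    exact PosForm.eq_zero _ ((Finset.sum_eq_zero_iff_of_nonneg
      (fun t _ => PosForm.nonneg (f t))).1 h t (Finset.mem_univ t))

/-- The pairing of a `PosForm`. -/
local notation "⟪" x "," y "⟫" => PosForm.form x y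

section form
variable {V : Type} [AddCommGroup V] [PosForm V]

theorem form_pi {T : Type} [Fintype T] (f g : T → V) : ⟪f, g⟫ = ∑ t, ⟪f t, g t⟫ := rfl

theorem form_sum_left {T : Type} (s : Finset T) (f : T → V) (y : V) :
    ⟪∑ t ∈ s, f t, y⟫ = ∑ t ∈ s, ⟪f t, y⟫ := by
  rw [map_sum, AddMonoidHom.finsetSum_apply]

theorem form_sum_right {T : Type} (s : Finset T) (f : T → V) (y : V) :
    ⟪y, ∑ t ∈ s, f t⟫ = ∑ t ∈ s, ⟪y, f t⟫ := map_sum _ _ _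

theorem form_add_left (x y z : V) : ⟪x + y, z⟫ = ⟪x, z⟫ + ⟪y, z⟫ := by simp
theorem form_add_right (x y z : V) : ⟪x, y + z⟫ = ⟪x, y⟫ + ⟪x, z⟫ := by simp
theorem form_sub_left (x y z : V) : ⟪x - y, z⟫ = ⟪x, z⟫ - ⟪y, z⟫ := by simp
theorem form_sub_right (x y z : V) : ⟪x, y - z⟫ = ⟪x, y⟫ - ⟪x, z⟫ := by simp
theorem form_zsmul_left (n : ℤ) (x y : V) : ⟪n • x, y⟫ = n * ⟪x, y⟫ := by simp
theorem form_zsmul_right (n : ℤ) (x y : V) : ⟪x, n • y⟫ = n * ⟪x, y⟫ := by simp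

theorem cr_adj {α : Type} [Fintype α] [DecidableEq α] (k : Type) [CommRing k] [Module k V]
    (a : α) (f g : Finset α → V) : ⟪cr k a f, g⟫ = ⟪f, an k a g⟫ := by
  simp only [form_pi, cr_apply, an_apply]
  have e1 : ∀ S : Finset α, ⟪if a ∈ S then sgn a S • f (S.erase a) else 0, g S⟫ =
      if a ∈ S then sgn a S * ⟪f (S.erase a), g S⟫ else 0 := fun S => by split_ifs <;> simp
  have e2 : ∀ S : Finset α, ⟪f S, if a ∈ S then 0 else sgn a S • g (insert a S)⟫ =
      if a ∉ S then sgn a S * ⟪f S, g (insert a S)⟫ else 0 := fun S => by split_ifs <;> simp_all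
  simp only [e1, e2]
  rw [← Finset.sum_filter, ← Finset.sum_filter]
  refine Finset.sum_nbij' (fun S => S.erase a) (fun S => insert a S) ?_ ?_ ?_ ?_ ?_
  · simp
  · simp
  · intro S hS; exact Finset.insert_erase (by simpa using hS)
  · intro S hS; exact Finset.erase_insert (by simpa using hS)
  · intro S hS
    have hS : a ∈ S := by simpa using hS
    rw [sgn_erase _ hS, rs_self, one_mul, Finset.insert_erase hS]

end form

section sys
variable {ι κ : Type} [Fintype ι] [Fintype κ] [DecidableEq ι] [DecidableEq κ]
variable (k : Type) [CommRing k] (V : Type) [AddCommGroup V] [Module k V]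

/-- Cochains with an auxiliary index. -/
abbrev H (ι κ V : Type) := Option (ι × κ) → Finset (ι × κ) → V

/-- Apply an operator on Fock space in each auxiliary component. -/
def lift1 : Module.End k (Finset (ι × κ) → V) →+* Module.End k (H ι κ V) where
  toFun f := LinearMap.compLeft f _
  map_one' := rfl
  map_mul' _ _ := rfl
  map_zero' := rfl
  map_add' _ _ := rfl

/-- Apply an operator on coefficients. -/
def lift2 : Module.End k V →+* Module.End k (H ι κ V) where
  toFun f := LinearMap.compLeft (LinearMap.compLeft f _) _
  map_one' := rfl
  map_mul' _ _ := rfl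
  map_zero' := rfl
  map_add' _ _ := rfl

variable {k V}
theorem lift1_apply (f : Module.End k (Finset (ι × κ) → V)) (h : H ι κ V) (p) :
  lift1 k V f h p = f (h p) := rfl
theorem lift2_apply (f : Module.End k V) (h : H ι κ V) (p S) :
  lift2 k V f h p S = f (h p S) := rfl

variable (k V) in
/-- Matrix units in the auxiliary index. -/
def unit (p q : Option (ι × κ)) : Module.End k (H ι κ V) where
  toFun h r := if r = p then h q else 0
  map_add' h g := by funext r; by_cases hr : r = p <;> simp [hr]
  map_smul' c h := by funext r; by_cases hr : r = p <;> simp [hr]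

theorem unit_apply (p q r : Option (ι × κ)) (h : H ι κ V) :
    unit k V p q h r = if r = p then h q else 0 := rfl

/-- The concrete realisation of `Sys`. -/
noncomputable def sys (e : ι ⊕ κ → ι ⊕ κ → Module.End k V)
    (he : ∀ p q s t, ⁅e p q, e s t⁆ = (if q = s then e p t else 0) - (if t = p then e s q else 0)) :
    Sys ι κ (Module.End k (H ι κ V)) where
  E p q := lift2 k V (e p q)
  c x := lift1 k V (cr k x)
  a x := lift1 k V (an k x)
  U := unit k V
  EE p q s t := by
    simp only [Ring.lie_def, ← map_mul, ← map_sub] at he ⊢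
    rw [he]; split_ifs <;> simp
  cc x y := by rw [← map_mul, cr_cr, map_neg, map_mul]
  aa x y := by rw [← map_mul, an_an, map_neg, map_mul]
  ac x y := by rw [← map_mul, an_cr, map_sub, map_mul]; split_ifs <;> simp
  Ec p q x := by
    rw [Ring.lie_def, sub_eq_zero]; refine LinearMap.ext fun h => ?_; funext p S
    simp only [Module.End.mul_apply, lift2_apply, lift1_apply, cr_apply]
    split_ifs <;> simp [lift2_apply]
  Ea p q x := by
    rw [Ring.lie_def, sub_eq_zero]; refine LinearMap.ext fun h => ?_; funext p S
    simp only [Module.End.mul_apply, lift2_apply, lift1_apply, an_apply]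
    split_ifs <;> simp [lift2_apply]
  EU p q x y := by
    rw [Ring.lie_def, sub_eq_zero]; refine LinearMap.ext fun h => ?_; funext p S
    simp only [Module.End.mul_apply, lift2_apply, unit_apply]
    split_ifs <;> simp [lift2_apply]
  Uc x y z := by
    rw [Ring.lie_def, sub_eq_zero]; refine LinearMap.ext fun h => ?_; funext p
    simp only [Module.End.mul_apply, lift1_apply, unit_apply]
    split_ifs <;> simp [lift1_apply]
  Ua x y z := by
    rw [Ring.lie_def, sub_eq_zero]; refine LinearMap.ext fun h => ?_; funext p
    simp only [Module.End.mul_apply, lift1_apply, unit_apply]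
    split_ifs <;> simp [lift1_apply]
  UU x y z w := by
    refine LinearMap.ext fun h => ?_; funext p
    by_cases hp : p = x <;> by_cases hy : y = z <;> simp [unit_apply, hp, hy]

end sys

section
variable {ι κ : Type} [Fintype ι] [Fintype κ] [DecidableEq ι] [DecidableEq κ]
variable {k : Type} [Field k] {W : Type} [AddCommGroup W] [Module k W] [PosForm W]

/-- Compatibility of the operators with a positive form. -/
structure Adj (S : Sys ι κ (Module.End k W)) : Prop where
  E : ∀ p q x y, ⟪S.E p q x, y⟫ = ⟪x, S.E q p y⟫
  c : ∀ t x y, ⟪S.c t x, y⟫ = ⟪x, S.a t y⟫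
  U : ∀ p q x y, ⟪S.U p q x, y⟫ = ⟪x, S.U q p y⟫
  one : S.U none none + S.Utot = 1

/-- Vectors on which the twisted `gl(ι) × gl(κ)` acts by the scalars `e`, `s`, in degree `j`. -/
structure Sys.IsInv (S : Sys ι κ (Module.End k W)) (e s j : ℤ) (h : W) : Prop where
  F : ∀ i l, S.F i l h = if i = l then e • h else 0
  G : ∀ b a, S.G b a h = if b = a then s • h else 0
  num : S.num h = j • h

namespace Adj
variable {S : Sys ι κ (Module.End k W)} (A : Adj S) {e s j : ℤ} {h : W}

include A in
theorem a (t x y) : ⟪S.a t x, y⟫ = ⟪x, S.c t y⟫ := by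
  rw [PosForm.symm, ← A.c, PosForm.symm]

include A in
theorem X (t x y) : ⟪S.X t x, y⟫ = ⟪x, S.Y t y⟫ := A.E _ _ _ _

include A in
theorem Y (t x y) : ⟪S.Y t x, y⟫ = ⟪x, S.X t y⟫ := A.E _ _ _ _

include A in
theorem d (x y) : ⟪S.d x, y⟫ = ⟪x, S.del y⟫ := by
  simp only [Sys.d, Sys.del, LinearMap.sum_apply, Module.End.mul_apply, form_sum_left,
    form_sum_right, A.c, A.X]
  refine Finset.sum_congr rfl fun t _ => ?_
  have := LinearMap.congr_fun (sub_eq_zero.1 (S.Ea (.inr t.2) (.inl t.1) t)) y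
  simp only [Module.End.mul_apply] at this
  exact congrArg _ this

include A in
theorem del (x y) : ⟪S.del x, y⟫ = ⟪x, S.d y⟫ := by
  rw [PosForm.symm, ← A.d, PosForm.symm]

include A in
theorem box (x y) : ⟪S.box x, y⟫ = ⟪x, S.box y⟫ := by
  simp only [Sys.box, LinearMap.add_apply, Module.End.mul_apply, form_add_left, form_add_right,
    A.d, A.del]

include A in
theorem harmonic (h0 : S.box h = 0) : S.d h = 0 ∧ S.del h = 0 := by
  have h1 : ⟪S.d h, S.d h⟫ + ⟪S.del h, S.del h⟫ = 0 := by
    rw [A.d, A.del, ← form_add_right, add_comm]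
    have : S.d (S.del h) + S.del (S.d h) = 0 := h0
    rw [this, map_zero]
  have p1 := PosForm.nonneg (S.d h)
  have p2 := PosForm.nonneg (S.del h)
  exact ⟨PosForm.eq_zero _ (by linarith), PosForm.eq_zero _ (by linarith)⟩

end Adj

omit [PosForm W] in
theorem Sys.IsInv.ca {S : Sys ι κ (Module.End k W)} {e s j : ℤ} {h : W} (I : S.IsInv e s j h) :
    (∑ i, ∑ j, ∑ a, S.c (i, a) * S.a (j, a) * S.F i j -
      ∑ i, ∑ a, ∑ b, S.c (i, a) * S.a (i, b) * S.G b a) h = (e - s) • j • h := by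
  have h1 : ∀ i l a, S.c (i, a) (S.a (l, a) (if i = l then e • h else 0)) =
      if i = l then e • S.c (i, a) (S.a (l, a) h) else 0 := fun i l a => by
    split_ifs <;> simp
  have h2 : ∀ i a b, S.c (i, a) (S.a (i, b) (if b = a then s • h else 0)) =
      if b = a then s • S.c (i, a) (S.a (i, b) h) else 0 := fun i l a => by
    split_ifs <;> simp
  have hn : ∑ i, ∑ a, S.c (i, a) (S.a (i, a) h) = j • h := by
    rw [← I.num, Sys.num]; simp [Fintype.sum_prod_type]
  simp only [LinearMap.sub_apply, LinearMap.sum_apply, Module.End.mul_apply, I.F, I.G, h1, h2]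
  rw [sub_smul, ← hn, Finset.smul_sum, Finset.smul_sum]
  congr 1
  · refine Finset.sum_congr rfl fun i _ => ?_
    rw [Finset.sum_comm, Finset.smul_sum]
    refine Finset.sum_congr rfl fun a _ => ?_
    simp
  · refine Finset.sum_congr rfl fun i _ => ?_
    rw [Finset.smul_sum]
    refine Finset.sum_congr rfl fun a _ => ?_
    simp

namespace Adj
variable {S : Sys ι κ (Module.End k W)} (A : Adj S) {e s j : ℤ} {h : W}

include A in
theorem eq₁ (I : S.IsInv e s j h) (h0 : S.box h = 0) :
    ∑ x, ⟪S.X x h, S.X x h⟫ + (e - s + Fintype.card ι + Fintype.card κ) * j * ⟪h, h⟫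
      + ⟪(S.KF + S.KG) h, h⟫ = 0 := by
  have h1 := congrArg (fun z => ⟪z h, h⟫) S.box_eq₁
  simp only [LinearMap.add_apply, I.ca, h0, form_add_left, LinearMap.sum_apply, form_sum_left,
    Module.End.mul_apply, A.Y, I.num, form_zsmul_left, map_zero, AddMonoidHom.zero_apply,
    Module.End.natCast_apply, ← natCast_zsmul] at h1
  rw [LinearMap.add_apply, form_add_left]
  push_cast at h1 ⊢
  linarith

include A in
theorem eq₂ (I : S.IsInv e s j h) (h0 : S.box h = 0) :
    ∑ x, ⟪S.Y x h, S.Y x h⟫ -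
      (e - s) * (Fintype.card ι * Fintype.card κ - j) * ⟪h, h⟫
      - (Fintype.card ι + Fintype.card κ) * ⟪S.Utot h, h⟫
      + ⟪(S.KF + S.KG) h, h⟫ = 0 := by
  have h1 := congrArg (fun z => ⟪z h, h⟫) S.box_eq₂
  have ht : S.tr h = (Fintype.card ι : ℤ) • e • h := by
    simp [Sys.tr, I.F]
  have hg : ∑ a, S.G a a h = (Fintype.card κ : ℤ) • s • h := by
    simp [I.G]
  simp only [LinearMap.add_apply, LinearMap.sub_apply (σ₁₂ := RingHom.id k) (_ - _ + _ + _) _] at h1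
  simp only [I.ca] at h1
  simp only [LinearMap.sub_apply, LinearMap.add_apply, h0, form_add_left, form_sub_left,
    LinearMap.sum_apply, form_sum_left,
    Module.End.mul_apply, A.X, form_zsmul_left, map_zero, AddMonoidHom.zero_apply,
    Module.End.natCast_apply, ← natCast_zsmul, ht, hg, Module.End.mul_apply] at h1
  rw [LinearMap.add_apply, form_add_left]
  push_cast at h1 ⊢
  linarith

end Adj
end

section
variable {W : Type} [AddCommGroup W] [PosForm W]

theorem perm_pos {T : Type} [Fintype T] (φ ψ : Equiv.Perm T) (hφ : ∀ t, φ (φ t) = t)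
    (hψ : ∀ t, ψ (ψ t) = t) (hc : ∀ t, φ (ψ t) = ψ (φ t)) (z : T → W) :
    0 ≤ ∑ t, ⟪z t, z t⟫ + ∑ t, ⟪z t, z (φ t)⟫ + ∑ t, ⟪z t, z (ψ t)⟫
      + ∑ t, ⟪z t, z (φ (ψ t))⟫ := by
  set w : T → W := fun t => z t + z (φ t) + z (ψ t) + z (φ (ψ t)) with hw
  have w1 : ∀ t, w (φ t) = w t := fun t => by simp only [hw, ← hc, hφ]; abel
  have w2 : ∀ t, w (ψ t) = w t := fun t => by simp only [hw, hψ, hc]; abel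
  have e1 := Equiv.sum_comp φ fun t => ⟪z t, w t⟫
  have e2 := Equiv.sum_comp ψ fun t => ⟪z t, w t⟫
  have e3 := Equiv.sum_comp (ψ.trans φ) fun t => ⟪z t, w t⟫
  simp only [Equiv.trans_apply, w1, w2] at e1 e2 e3
  have h0 : 0 ≤ ∑ t, ⟪w t, w t⟫ := Finset.sum_nonneg fun t _ => PosForm.nonneg _
  have h1 : ∑ t, ⟪w t, w t⟫ = 4 * ∑ t, ⟪z t, w t⟫ := by
    have : ∀ t, ⟪w t, w t⟫ = ⟪z t, w t⟫ + ⟪z (φ t), w t⟫ + ⟪z (ψ t), w t⟫ +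
      ⟪z (φ (ψ t)), w t⟫ := fun t => by
        conv_lhs => enter [1]; rw [hw]
        simp only [form_add_left]
    simp only [this, Finset.sum_add_distrib, e1, e2, e3]
    ring
  rw [h1] at h0
  simp only [hw, form_add_right, Finset.sum_add_distrib] at h0
  linarith

theorem cauchy {T : Type} [Fintype T] (v : T → W) :
    ⟪∑ t, v t, ∑ t, v t⟫ ≤ Fintype.card T * ∑ t, ⟪v t, v t⟫ := by
  have h0 : 0 ≤ ∑ s, ∑ t, ⟪v s - v t, v s - v t⟫ :=
    Finset.sum_nonneg fun t _ => Finset.sum_nonneg fun t _ => PosForm.nonneg _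
  simp only [form_sub_left, form_sub_right, Finset.sum_sub_distrib, Finset.sum_const,
    Finset.card_univ, nsmul_eq_mul] at h0
  rw [Finset.sum_comm (f := fun x y => ⟪v y, v x⟫)] at h0
  simp only [← form_sum_right, ← form_sum_left, ← Finset.mul_sum] at h0
  linarith

variable {ι κ : Type} [Fintype ι] [Fintype κ] [DecidableEq ι] [DecidableEq κ]

theorem partial_trace_pos (f : ι → κ → ι → κ → W) :
    0 ≤ Fintype.card ι * Fintype.card κ * ∑ i, ∑ a, ∑ l, ∑ b, ⟪f i a l b, f i a l b⟫
      - Fintype.card κ * ∑ a, ∑ b, ⟪∑ i, f i a i b, ∑ i, f i a i b⟫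
      - Fintype.card ι * ∑ i, ∑ l, ⟪∑ a, f i a l a, ∑ a, f i a l a⟫
      + ⟪∑ i, ∑ a, f i a i a, ∑ i, ∑ a, f i a i a⟫ := by
  set u : κ → κ → W := fun a b => ∑ i, f i a i b with hu
  set w : ι → ι → W := fun i l => ∑ a, f i a l a with hw
  set t : W := ∑ i, ∑ a, f i a i a with ht
  set r : ℤ := ((Fintype.card ι : ℕ) : ℤ) with hr
  set m : ℤ := ((Fintype.card κ : ℕ) : ℤ) with hm
  have tu : t = ∑ a, u a a := Finset.sum_comm
  have tw : t = ∑ i, w i i := ht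
  set Z : ι → κ → ι → κ → W := fun i a l b => (r * m) • f i a l b - (if i = l then m • u a b else 0)
    - (if a = b then r • w i l else 0) + (if i = l then if a = b then t else 0 else 0) with hZ
  clear_value Z u w t r m
  have z1 : ∀ a b, ∑ i, Z i a i b = 0 := fun a b => by
    simp only [hZ, Finset.sum_add_distrib, Finset.sum_sub_distrib, ← Finset.smul_sum, if_true,
      Finset.sum_const, Finset.card_univ, ← natCast_zsmul, ← hr]
    have : ∑ i, (if a = b then r • w i i else 0) = if a = b then r • t else 0 := by
      split_ifs
      · rw [← Finset.smul_sum, ← tw]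
      · simp
    rw [this]
    split_ifs <;> simp [hu, mul_smul, smul_comm r m]
  have z2 : ∀ i l, ∑ a, Z i a l a = 0 := fun i l => by
    simp only [hZ, Finset.sum_add_distrib, Finset.sum_sub_distrib, ← Finset.smul_sum, if_true,
      Finset.sum_const, Finset.card_univ, ← natCast_zsmul, ← hm]
    have : ∑ a, (if i = l then m • u a a else 0) = if i = l then m • t else 0 := by
      split_ifs
      · rw [← Finset.smul_sum, ← tu]
      · simp
    rw [this]
    split_ifs <;> simp [hw, mul_smul, smul_comm r m]
  have h0 : 0 ≤ ∑ i, ∑ a, ∑ l, ∑ b, ⟪Z i a l b, Z i a l b⟫ :=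
    Finset.sum_nonneg fun _ _ => Finset.sum_nonneg fun _ _ => Finset.sum_nonneg fun _ _ =>
      Finset.sum_nonneg fun _ _ => PosForm.nonneg _
  have e0 : ∀ i a l b, ⟪Z i a l b, Z i a l b⟫ = r * m * ⟪Z i a l b, f i a l b⟫ -
      (if i = l then m * ⟪Z i a l b, u a b⟫ else 0) - (if a = b then r * ⟪Z i a l b, w i l⟫ else 0)
      + (if i = l then if a = b then ⟪Z i a l b, t⟫ else 0 else 0) := fun i a l b => by
    conv_lhs => enter [2]; rw [hZ]
    simp only [form_add_right, form_sub_right, form_zsmul_right]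
    refine congrArg₂ (· + ·) (congrArg₂ (· - ·) (congrArg₂ (· - ·) ?_ ?_) ?_) ?_
    · push_cast; ring
    all_goals split_ifs <;> simp
  have e1 : ∑ i, ∑ a, ∑ l, ∑ b, (if i = l then m * ⟪Z i a l b, u a b⟫ else 0) = 0 := by
    have : ∀ i a, ∑ l, ∑ b, (if i = l then m * ⟪Z i a l b, u a b⟫ else 0) =
        ∑ b, m * ⟪Z i a i b, u a b⟫ := fun i a => by
      rw [Finset.sum_comm]; simp
    simp only [this]
    rw [Finset.sum_comm]
    refine Finset.sum_eq_zero fun a _ => ?_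
    rw [Finset.sum_comm]
    refine Finset.sum_eq_zero fun b _ => ?_
    rw [← Finset.mul_sum, ← form_sum_left, z1]; simp
  have e2 : ∑ i, ∑ a, ∑ l, ∑ b, (if a = b then r * ⟪Z i a l b, w i l⟫ else 0) = 0 := by
    simp only [Finset.sum_ite_eq, Finset.mem_univ, if_true]
    refine Finset.sum_eq_zero fun i _ => ?_
    rw [Finset.sum_comm]
    refine Finset.sum_eq_zero fun l _ => ?_
    rw [← Finset.mul_sum, ← form_sum_left, z2]; simp
  have e3 : ∑ i, ∑ a, ∑ l, ∑ b, (if i = l then if a = b then ⟪Z i a l b, t⟫ else 0 else 0) = 0 := by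
    have : ∀ i a, ∑ l, ∑ b, (if i = l then if a = b then ⟪Z i a l b, t⟫ else 0 else 0) =
        ⟪Z i a i a, t⟫ := fun i a => by
      rw [Finset.sum_comm]; simp
    simp only [this]
    refine Finset.sum_eq_zero fun i _ => ?_
    rw [← form_sum_left, z2]; simp
  have hr0 : 0 ≤ r := hr ▸ Nat.cast_nonneg _
  have hm1 : 0 ≤ m := hm ▸ Nat.cast_nonneg _
  have hm0 : r * m = 0 ∨ 0 < r * m := by
    rcases (by positivity : 0 ≤ r * m).eq_or_lt with h | h
    · exact Or.inl h.symm
    · exact Or.inr h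
  have e4 : ∑ i, ∑ a, ∑ l, ∑ b, ⟪Z i a l b, f i a l b⟫ =
      r * m * ∑ i, ∑ a, ∑ l, ∑ b, ⟪f i a l b, f i a l b⟫ - m * ∑ a, ∑ b, ⟪u a b, u a b⟫
      - r * ∑ i, ∑ l, ⟪w i l, w i l⟫ + ⟪t, t⟫ := by
    have q1 : ∀ i a l b, ⟪Z i a l b, f i a l b⟫ = r * m * ⟪f i a l b, f i a l b⟫ -
      (if i = l then m * ⟪u a b, f i a l b⟫ else 0) - (if a = b then r * ⟪w i l, f i a l b⟫ else 0)
      + (if i = l then if a = b then ⟪t, f i a l b⟫ else 0 else 0) := fun i a l b => by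
      simp only [hZ, form_add_left, form_sub_left, form_zsmul_left]
      refine congrArg₂ (· + ·) (congrArg₂ (· - ·) (congrArg₂ (· - ·) ?_ ?_) ?_) ?_
      · push_cast; ring
      all_goals split_ifs <;> simp
    simp only [q1, Finset.sum_add_distrib, Finset.sum_sub_distrib, ← Finset.mul_sum]
    refine congrArg₂ (· + ·) (congrArg₂ (· - ·) (congrArg₂ (· - ·) rfl ?_) ?_) ?_
    · have : ∀ i a, ∑ l, ∑ b, (if i = l then m * ⟪u a b, f i a l b⟫ else 0) =
          ∑ b, m * ⟪u a b, f i a i b⟫ := fun i a => by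
        rw [Finset.sum_comm]; simp
      simp only [this]
      rw [Finset.sum_comm, Finset.mul_sum]
      refine Finset.sum_congr rfl fun a _ => ?_
      rw [Finset.sum_comm, Finset.mul_sum]
      refine Finset.sum_congr rfl fun b _ => ?_
      rw [← Finset.mul_sum, ← form_sum_right, hu]
    · simp only [Finset.sum_ite_eq, Finset.mem_univ, if_true]
      rw [Finset.mul_sum]
      refine Finset.sum_congr rfl fun i _ => ?_
      rw [Finset.sum_comm, Finset.mul_sum]
      refine Finset.sum_congr rfl fun l _ => ?_
      rw [← Finset.mul_sum, ← form_sum_right, hw]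
    · have : ∀ i a, ∑ l, ∑ b, (if i = l then if a = b then ⟪t, f i a l b⟫ else 0 else 0) =
          ⟪t, f i a i a⟫ := fun i a => by
        rw [Finset.sum_comm]; simp
      simp only [this, ← form_sum_right]
      rw [ht]
  simp only [e0, Finset.sum_add_distrib, Finset.sum_sub_distrib, e1, e2, e3, ← Finset.mul_sum,
    sub_zero, add_zero] at h0
  rw [e4] at h0
  rcases hm0 with h | h
  · rcases mul_eq_zero.1 h with h | h
    · have : IsEmpty ι := Fintype.card_eq_zero_iff.1 (by rw [hr] at h; exact_mod_cast h)
      simp [tw]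
    · have : IsEmpty κ := Fintype.card_eq_zero_iff.1 (by rw [hm] at h; exact_mod_cast h)
      simp [tu]
  · have h' : (0 : ℚ) < r * m := by exact_mod_cast h
    have := nonneg_of_mul_nonneg_right h0 h'
    simp only [hr, hm, hu, hw, ht, Int.cast_natCast] at this ⊢
    exact this

end

section
variable {ι κ : Type} [Fintype ι] [Fintype κ] [DecidableEq ι] [DecidableEq κ]
variable {k : Type} [Field k] {W : Type} [AddCommGroup W] [Module k W] [PosForm W]

namespace Adj
variable {S : Sys ι κ (Module.End k W)} (A : Adj S) {e s j : ℤ} {h : W}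

include A in
theorem a_a (x y w w') : ⟪S.a y w, S.a x w'⟫ =
    (if x = y then ⟪w, w'⟫ else 0) - ⟪S.c x w, S.c y w'⟫ := by
  have h := LinearMap.congr_fun (S.ac y x) w
  simp only [Module.End.mul_apply, LinearMap.sub_apply] at h
  have h2 : ⟪S.c x w, S.c y w'⟫ = ⟪S.a y (S.c x w), w'⟫ := by rw [A.a]
  rw [← A.c, h2, h]
  by_cases hxy : x = y
  · simp [hxy]
  · simp [hxy, Ne.symm hxy]

include A in
theorem caU (σ ρ x y : ι × κ) (h h' : W) :
    ⟪(S.c σ * S.a ρ * S.U (some x) (some y)) h, h'⟫ =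
      ⟪S.a ρ (S.C y h), S.a σ (S.C x h')⟫ := by
  have e1 : S.U (some x) (some y) = S.U (some x) none * S.C y := by simp [Sys.C, S.UU]
  have e2 : S.c σ * S.a ρ * S.U (some x) (some y) =
      S.U (some x) none * (S.c σ * (S.a ρ * S.C y)) := by
    have hc := sub_eq_zero.1 (S.Uc (some x) none σ)
    have ha := sub_eq_zero.1 (S.Ua (some x) none ρ)
    rw [e1, ← mul_assoc, mul_assoc (S.c σ), ← ha, ← mul_assoc (S.c σ), ← hc]
    simp only [mul_assoc]
  rw [e2, Module.End.mul_apply, A.U, Module.End.mul_apply, A.c]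
  rfl

include A in
theorem sum_C (hU : S.Utot h = h) : ∑ x, ⟪S.C x h, S.C x h⟫ = ⟪h, h⟫ := by
  conv_rhs => enter [1]; rw [← hU]
  rw [Sys.Utot, LinearMap.sum_apply, form_sum_left]
  refine Finset.sum_congr rfl fun x _ => ?_
  rw [Sys.C, A.U, ← Module.End.mul_apply, S.UU, if_pos rfl, A.U, PosForm.symm, A.U]

include A in
theorem sum_aC (hU : S.Utot h = h) (hn : S.num h = j • h) :
    ∑ x, ∑ y, ⟪S.a x (S.C y h), S.a x (S.C y h)⟫ = j * ⟪h, h⟫ := by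
  rw [Finset.sum_comm, ← A.sum_C hU, Finset.mul_sum]
  refine Finset.sum_congr rfl fun y _ => ?_
  have hc : S.num * S.C y = S.C y * S.num := by
    have : ⁅S.C y, S.num⁆ = 0 := by
      rw [Sys.num, br_sum]; exact Finset.sum_eq_zero fun x _ => S.U_ca _ _ _ _
    exact (sub_eq_zero.1 this).symm
  have h1 : S.num (S.C y h) = j • S.C y h := by
    rw [← Module.End.mul_apply, hc, Module.End.mul_apply, hn, map_zsmul]
  rw [← form_zsmul_left, ← h1, Sys.num, LinearMap.sum_apply, form_sum_left]
  refine Finset.sum_congr rfl fun x _ => ?_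
  rw [Module.End.mul_apply, A.c]

include A in
theorem sum_cC (hU : S.Utot h = h) (hn : S.num h = j • h) :
    ∑ i, ∑ a, ∑ l, ∑ b, ⟪S.c (i, a) (S.C (l, b) h), S.c (i, a) (S.C (l, b) h)⟫ =
      (Fintype.card ι * Fintype.card κ - j) * ⟪h, h⟫ := by
  have h1 := A.sum_aC hU hn
  simp only [A.a_a, if_true, Finset.sum_sub_distrib, A.sum_C hU] at h1
  simp only [Finset.sum_const, Finset.card_univ, Fintype.card_prod, nsmul_eq_mul,
    Fintype.sum_prod_type] at h1
  push_cast at h1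
  linarith

include A in
theorem sum_aC_swap (hU : S.Utot h = h) :
    ∑ x, ∑ y, ⟪S.a x (S.C y h), S.a y (S.C x h)⟫ = ⟪h, h⟫ - ⟪S.tau h, S.tau h⟫ := by
  simp only [A.a_a, Finset.sum_sub_distrib]
  congr 1
  · rw [← A.sum_C hU]
    simp
  · simp only [Sys.tau, LinearMap.sum_apply, form_sum_left, form_sum_right, Module.End.mul_apply]

include A in
theorem K_eq : ⟪(S.KF + S.KG) h, h⟫ =
    ∑ x : ι × κ, ∑ y : ι × κ, ⟪S.a x (S.C y h), S.a (y.1, x.2) (S.C (x.1, y.2) h)⟫ +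
    ∑ x : ι × κ, ∑ y : ι × κ, ⟪S.a x (S.C y h), S.a (x.1, y.2) (S.C (y.1, x.2) h)⟫ := by
  rw [LinearMap.add_apply, form_add_left]
  simp only [Sys.KF, Sys.KG, LinearMap.sum_apply, form_sum_left, A.caU, Fintype.sum_prod_type]
  congr 1
  · rw [Finset.sum_comm]
    refine Finset.sum_congr rfl fun i _ => ?_
    rw [Finset.sum_comm]
  · refine Finset.sum_congr rfl fun i _ => ?_
    rw [Finset.sum_comm_cycle]

include A in
theorem K_eq' (hU : S.Utot h = h) : ⟪(S.KF + S.KG) h, h⟫ =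
    (Fintype.card ι + Fintype.card κ) * ⟪h, h⟫ -
      ∑ a, ∑ b, ⟪∑ i, S.c (i, a) (S.C (i, b) h), ∑ i, S.c (i, a) (S.C (i, b) h)⟫ -
      ∑ i, ∑ l, ⟪∑ a, S.c (i, a) (S.C (l, a) h), ∑ a, S.c (i, a) (S.C (l, a) h)⟫ := by
  rw [LinearMap.add_apply, form_add_left]
  simp only [Sys.KF, Sys.KG, LinearMap.sum_apply, form_sum_left, A.caU, form_sum_right]
  simp only [A.a_a, Finset.sum_sub_distrib, Prod.mk.injEq, and_true, true_and]
  have e1 : ∑ i, ∑ l, ∑ a : κ, ∑ b, (if i = l then ⟪S.C (i, b) h, S.C (l, b) h⟫ else 0) =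
      Fintype.card κ * ⟪h, h⟫ := by
    rw [← A.sum_C hU, Fintype.sum_prod_type, Finset.mul_sum]
    refine Finset.sum_congr rfl fun i _ => ?_
    simp only [Finset.sum_const, Finset.card_univ, nsmul_eq_mul, ← Finset.mul_sum]
    rw [Finset.sum_comm]
    simp
  have e2 : ∑ i : ι, ∑ l, ∑ a, ∑ b, (if a = b then ⟪S.C (l, a) h, S.C (l, b) h⟫ else 0) =
      Fintype.card ι * ⟪h, h⟫ := by
    rw [← A.sum_C hU, Fintype.sum_prod_type]
    simp
  have e3 : ∑ i, ∑ l, ∑ a, ∑ b, ⟪S.c (i, a) (S.C (i, b) h), S.c (l, a) (S.C (l, b) h)⟫ =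
      ∑ a, ∑ b, ∑ i, ∑ l, ⟪S.c (l, a) (S.C (l, b) h), S.c (i, a) (S.C (i, b) h)⟫ := by
    rw [Finset.sum_comm_cycle]
    refine Finset.sum_congr rfl fun a _ => ?_
    rw [Finset.sum_comm]
    rw [Finset.sum_comm_cycle]
  rw [e1, e2, e3]
  have e4 : ∑ i, ∑ l, ∑ a, ∑ b, ⟪S.c (i, a) (S.C (l, a) h), S.c (i, b) (S.C (l, b) h)⟫ =
      ∑ i, ∑ l, ∑ a, ∑ b, ⟪S.c (i, b) (S.C (l, b) h), S.c (i, a) (S.C (l, a) h)⟫ := by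
    refine Finset.sum_congr rfl fun i _ => Finset.sum_congr rfl fun l _ => ?_
    rw [Finset.sum_comm]
  rw [e4]
  ring

include A in
theorem bound₁ (hU : S.Utot h = h) (hn : S.num h = j • h) :
    0 ≤ j * ⟪h, h⟫ + ⟪(S.KF + S.KG) h, h⟫ + (⟪h, h⟫ - ⟪S.tau h, S.tau h⟫) := by
  let φ : Equiv.Perm ((ι × κ) × (ι × κ)) :=
    ⟨fun t => ((t.2.1, t.1.2), (t.1.1, t.2.2)), fun t => ((t.2.1, t.1.2), (t.1.1, t.2.2)),
      fun t => rfl, fun t => rfl⟩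
  let ψ : Equiv.Perm ((ι × κ) × (ι × κ)) :=
    ⟨fun t => ((t.1.1, t.2.2), (t.2.1, t.1.2)), fun t => ((t.1.1, t.2.2), (t.2.1, t.1.2)),
      fun t => rfl, fun t => rfl⟩
  have := perm_pos φ ψ (fun t => rfl) (fun t => rfl) (fun t => rfl)
    (fun t => S.a t.1 (S.C t.2 h))
  rw [A.K_eq, ← A.sum_aC_swap hU, ← A.sum_aC hU hn]
  have e : ∀ g : (ι × κ) × (ι × κ) → ℚ, ∑ t, g t = ∑ x, ∑ y, g (x, y) := Fintype.sum_prod_type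
  simp only [e, φ, ψ, Equiv.coe_fn_mk] at this
  linarith

include A in
theorem bound₀ (hU : S.Utot h = h) (hn : S.num h = j • h) :
    ⟪S.tau h, S.tau h⟫ ≤ (j + 1) * ⟪h, h⟫ := by
  have := perm_pos (T := (ι × κ) × (ι × κ)) (Equiv.prodComm _ _) (Equiv.prodComm _ _)
    (fun t => rfl) (fun t => rfl) (fun t => rfl) (fun t => S.a t.1 (S.C t.2 h))
  have h1 := A.sum_aC_swap hU
  have h2 := A.sum_aC hU hn
  have e : ∀ g : (ι × κ) × (ι × κ) → ℚ, ∑ t, g t = ∑ x, ∑ y, g (x, y) := Fintype.sum_prod_type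
  simp only [e, Equiv.prodComm_apply, Prod.swap, h1, h2] at this
  linarith

include A in
theorem bound₂ (hU : S.Utot h = h) (hn : S.num h = j • h) (hr : 2 ≤ Fintype.card ι)
    (hm : 2 ≤ Fintype.card κ) :
    (Fintype.card ι * Fintype.card κ) * ((Fintype.card ι + Fintype.card κ) * ⟪h, h⟫) -
      (Fintype.card ι + Fintype.card κ - 2) * (Fintype.card ι * Fintype.card κ) *
        ((Fintype.card ι * Fintype.card κ - j) * ⟪h, h⟫) - 2 * ⟪S.tau h, S.tau h⟫ ≤
      (Fintype.card ι * Fintype.card κ) * ⟪(S.KF + S.KG) h, h⟫ := by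
  rw [A.K_eq' hU]
  have h0 := partial_trace_pos fun i a l b => S.c (i, a) (S.C (l, b) h)
  rw [A.sum_cC hU hn] at h0
  have ht : ∑ i, ∑ a, S.c (i, a) (S.C (i, a) h) = S.tau h := by
    simp [Sys.tau, Fintype.sum_prod_type]
  have c1 := cauchy fun a => ∑ i, S.c (i, a) (S.C (i, a) h)
  have c2 := cauchy fun i => ∑ a, S.c (i, a) (S.C (i, a) h)
  have d1 : ∑ a, ⟪∑ i, S.c (i, a) (S.C (i, a) h), ∑ i, S.c (i, a) (S.C (i, a) h)⟫ ≤
      ∑ a, ∑ b, ⟪∑ i, S.c (i, a) (S.C (i, b) h), ∑ i, S.c (i, a) (S.C (i, b) h)⟫ :=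
    Finset.sum_le_sum fun a _ => Finset.single_le_sum
      (f := fun b => ⟪∑ i, S.c (i, a) (S.C (i, b) h), ∑ i, S.c (i, a) (S.C (i, b) h)⟫)
      (fun b _ => PosForm.nonneg _) (Finset.mem_univ a)
  have d2 : ∑ i, ⟪∑ a, S.c (i, a) (S.C (i, a) h), ∑ a, S.c (i, a) (S.C (i, a) h)⟫ ≤
      ∑ i, ∑ l, ⟪∑ a, S.c (i, a) (S.C (l, a) h), ∑ a, S.c (i, a) (S.C (l, a) h)⟫ :=
    Finset.sum_le_sum fun i _ => Finset.single_le_sum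
      (f := fun l => ⟪∑ a, S.c (i, a) (S.C (l, a) h), ∑ a, S.c (i, a) (S.C (l, a) h)⟫)
      (fun b _ => PosForm.nonneg _) (Finset.mem_univ i)
  rw [Finset.sum_comm, ht] at c1
  rw [ht] at c2 h0
  generalize ∑ a, ∑ b, ⟪∑ i, S.c (i, a) (S.C (i, b) h), ∑ i, S.c (i, a) (S.C (i, b) h)⟫ = nu at *
  generalize ∑ i, ∑ l, ⟪∑ a, S.c (i, a) (S.C (l, a) h), ∑ a, S.c (i, a) (S.C (l, a) h)⟫ = nw at *
  generalize ⟪S.tau h, S.tau h⟫ = T at *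
  generalize ⟪h, h⟫ = q at *
  have hr' : (2 : ℚ) ≤ Fintype.card ι := by exact_mod_cast hr
  have hm' : (2 : ℚ) ≤ Fintype.card κ := by exact_mod_cast hm
  generalize (Fintype.card ι : ℚ) = r at *
  generalize (Fintype.card κ : ℚ) = m at *
  have U1 : 0 ≤ m * nu - T := by nlinarith
  have V1 : 0 ≤ r * nw - T := by nlinarith
  nlinarith [mul_nonneg (sub_nonneg.2 hr') V1, mul_nonneg (sub_nonneg.2 hm') U1,
    mul_nonneg (by linarith : 0 ≤ r + m - 2) h0]

end Adj
end

theorem numeric_dichotomy_of_two_le {r m : ℤ} (hr : 2 ≤ r) (hm : 2 ≤ m) (h22 : ¬(r = 2 ∧ m = 2))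
    {j t : ℤ} (hj : 1 ≤ j) (hj' : j + 1 ≤ r * m) {P₁ P₂ T K : ℚ} (hP₁ : 0 ≤ P₁) (hP₂ : 0 ≤ P₂)
    (hT : 0 ≤ T) (e₁ : P₁ + t * j + K = 0) (e₂ : P₂ - (t - r - m) * (r * m - j) - (r + m) + K = 0)
    (b₁ : 0 ≤ j + K + (1 - T)) (b₀ : T ≤ j + 1)
    (b₂ : (r * m) * (r + m : ℚ) - (r + m - 2) * (r * m) * (r * m - j) - 2 * T ≤ r * m * K) :
    T = r * m ∧ P₂ = 0 := by
  have hD : 6 ≤ r * m := by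
    rcases eq_or_lt_of_le hr with h | h
    · have : 3 ≤ m := by omega
      nlinarith
    · nlinarith
  have hn : r + m ≤ r * m := by nlinarith
  have hn5 : 5 ≤ r + m := by omega
  obtain ⟨D, hDd⟩ : ∃ D, D = r * m := ⟨_, rfl⟩
  obtain ⟨n, hnd⟩ : ∃ n, n = r + m := ⟨_, rfl⟩
  have hDq : (D : ℚ) = r * m := by rw [hDd]; push_cast; ring
  have hnq : (n : ℚ) = r + m := by rw [hnd]; push_cast; ring
  rw [← hDq] at e₂ b₂ ⊢
  rw [← hnq] at e₂ b₂
  rw [show (t - r - m : ℚ) = t - n by rw [hnq]; ring] at e₂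
  rw [← hDd] at hD hn hj'
  rw [← hnd] at hn hn5
  have hjq : (1 : ℚ) ≤ j := by exact_mod_cast hj
  have hj'q : (1 : ℚ) ≤ D - j := by
    have : (j : ℚ) + 1 ≤ D := by exact_mod_cast hj'
    linarith
  have hDq6 : (6 : ℚ) ≤ D := by exact_mod_cast hD
  have hnq5 : (5 : ℚ) ≤ n := by exact_mod_cast hn5
  have hnD : (n : ℚ) ≤ D := by exact_mod_cast hn
  have f₁ : t * j ≤ j + 1 - T := by linarith
  have f₂ : (2 - t) * (D * (D - j)) ≤ 2 * T := by
    have : K ≤ (t - n) * (D - j) + n := by linarith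
    nlinarith [mul_le_mul_of_nonneg_left this (by linarith : (0 : ℚ) ≤ D)]
  have hDj : (D : ℚ) ≤ D * (D - j) := by nlinarith
  rcases lt_trichotomy t 0 with h | rfl | h
  · exfalso
    have : (t : ℚ) ≤ -1 := by exact_mod_cast (by omega : t ≤ -1)
    nlinarith
  · have hj2 : (D : ℚ) - j < 2 := by
      by_contra hc
      push Not at hc
      have : 2 * (D : ℚ) ≤ D * (D - j) := by nlinarith
      push_cast at f₂
      linarith
    have hj3 : D - j = 1 := by
      have h1 : ((D - j : ℤ) : ℚ) < 2 := by push_cast; exact hj2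
      have h2 : D - j < 2 := by exact_mod_cast h1
      omega
    have hj4 : (D : ℚ) - j = 1 := by exact_mod_cast hj3
    rw [hj4] at f₂ e₂ b₂
    push_cast at f₂ e₂
    have hTD : T = D := by linarith
    refine ⟨hTD, ?_⟩
    have : 0 ≤ D * K := by rw [hTD] at b₂; linarith
    have hK : 0 ≤ K := nonneg_of_mul_nonneg_right this (by linarith)
    linarith
  · exfalso
    obtain rfl | rfl | h3 : t = 1 ∨ t = 2 ∨ 3 ≤ t := by omega
    · push_cast at f₁ f₂
      linarith
    · push_cast at f₁ e₂ e₁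
      have hj1 : (j : ℚ) ≤ 1 := by linarith
      have hj1' : j = 1 := le_antisymm (by exact_mod_cast hj1) hj
      subst hj1'
      push_cast at *
      nlinarith
    · have : (3 : ℚ) ≤ t := by exact_mod_cast h3
      nlinarith

theorem numeric_dichotomy_of_one {D n : ℤ} (hn : n = D + 1) {j t : ℤ} (hj : 1 ≤ j)
    (hj' : j + 1 ≤ D) {P₁ P₂ T K : ℚ} (hP₁ : 0 ≤ P₁) (hP₂ : 0 ≤ P₂)
    (e₂ : P₂ - (t - n) * (D - j) - n + K = 0) (b₀ : T ≤ j + 1) (hK : K = j + 1 - T)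
    (e₁ : P₁ + t * j + K = 0) :
    T = D ∧ P₂ = 0 := by
  subst hn hK
  push_cast at *
  have hjq : (1 : ℚ) ≤ j := by exact_mod_cast hj
  have hj'q : (1 : ℚ) ≤ D - j := by
    have : (j : ℚ) + 1 ≤ D := by exact_mod_cast hj'
    linarith
  have ht : t ≤ 0 := by
    by_contra h
    have : (1 : ℚ) ≤ t := by exact_mod_cast (by omega : 1 ≤ t)
    nlinarith
  have hT : T = P₂ + (D - t) * (D - j) := by linarith
  have ht' : (t : ℚ) ≤ 0 := by exact_mod_cast ht
  have h1 : (D - t : ℚ) ≤ (D - t) * (D - j) := by nlinarith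
  have h2 : P₂ = 0 := by linarith
  have h3 : (t : ℚ) = 0 := by linarith
  exact ⟨by linarith, h2⟩

section
variable {ι κ : Type} [Fintype ι] [Fintype κ] [DecidableEq ι] [DecidableEq κ]
variable {k : Type} [Field k] {W : Type} [AddCommGroup W] [Module k W] [PosForm W]

namespace Adj
variable {S : Sys ι κ (Module.End k W)} (A : Adj S) {e s j : ℤ} {h : W}

include A in
theorem K_of_subsingleton (hs : Subsingleton ι ∨ Subsingleton κ) (hU : S.Utot h = h)
    (hn : S.num h = j • h) :
    ⟪(S.KF + S.KG) h, h⟫ = (j + 1) * ⟪h, h⟫ - ⟪S.tau h, S.tau h⟫ := by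
  rw [A.K_eq]
  have h1 := A.sum_aC_swap hU
  have h2 := A.sum_aC hU hn
  rcases hs with hs | hs
  · have e1 : ∀ x y : ι × κ, (y.1, x.2) = x := fun x y => Prod.ext (Subsingleton.elim _ _) rfl
    simp only [e1]
    rw [h1, h2]; ring
  · have e1 : ∀ x y : ι × κ, (y.1, x.2) = y := fun x y => Prod.ext rfl (Subsingleton.elim _ _)
    simp only [e1]
    rw [h1, h2]; ring

include A in
theorem dichotomy [Nonempty ι] [Nonempty κ] (h22 : ¬(Fintype.card ι = 2 ∧ Fintype.card κ = 2))
    (I : S.IsInv e s j h) (hU : S.Utot h = h) (h0 : S.box h = 0) (hj : 1 ≤ j)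
    (hj' : j + 1 ≤ Fintype.card ι * Fintype.card κ) :
    h = 0 ∨ (⟪S.tau h, S.tau h⟫ = Fintype.card ι * Fintype.card κ * ⟪h, h⟫ ∧
      ∀ x, S.Y x h = 0) := by
  by_cases hh : h = 0
  · exact Or.inl hh
  right
  have hq : 0 < ⟪h, h⟫ :=
    (PosForm.nonneg h).lt_of_ne fun hc => hh (PosForm.eq_zero _ hc.symm)
  have b₁ := A.bound₁ hU I.num
  have b₀ := A.bound₀ hU I.num
  have e₁ := A.eq₁ I h0
  have e₂ := A.eq₂ I h0
  rw [hU] at e₂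
  have p1 : 0 ≤ ∑ x, ⟪S.X x h, S.X x h⟫ := Finset.sum_nonneg fun _ _ => PosForm.nonneg _
  have p2 : 0 ≤ ∑ x, ⟪S.Y x h, S.Y x h⟫ := Finset.sum_nonneg fun _ _ => PosForm.nonneg _
  have pT : 0 ≤ ⟪S.tau h, S.tau h⟫ := PosForm.nonneg _
  suffices hm : ⟪S.tau h, S.tau h⟫ = Fintype.card ι * Fintype.card κ * ⟪h, h⟫ ∧
      ∑ x, ⟪S.Y x h, S.Y x h⟫ = 0 by
    refine ⟨hm.1, fun x => PosForm.eq_zero _ ?_⟩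
    exact (Finset.sum_eq_zero_iff_of_nonneg fun x _ => PosForm.nonneg _).1 hm.2 x
      (Finset.mem_univ x)
  have hι : 1 ≤ Fintype.card ι := Fintype.card_pos
  have hκ : 1 ≤ Fintype.card κ := Fintype.card_pos
  have hK1 := A.K_of_subsingleton (h := h) (j := j)
  have b₂ := A.bound₂ (h := h) (j := j) hU I.num
  rw [← Fintype.card_le_one_iff_subsingleton, ← Fintype.card_le_one_iff_subsingleton] at hK1
  generalize ∑ x, ⟪S.X x h, S.X x h⟫ = P₁ at *
  generalize ∑ x, ⟪S.Y x h, S.Y x h⟫ = P₂ at *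
  generalize ⟪S.tau h, S.tau h⟫ = T at *
  generalize ⟪(S.KF + S.KG) h, h⟫ = K at *
  generalize ⟪h, h⟫ = q at *
  obtain ⟨P₁, rfl⟩ : ∃ P, P₁ = P * q := ⟨P₁ / q, by field_simp⟩
  obtain ⟨P₂, rfl⟩ : ∃ P, P₂ = P * q := ⟨P₂ / q, by field_simp⟩
  obtain ⟨T, rfl⟩ : ∃ P, T = P * q := ⟨T / q, by field_simp⟩
  obtain ⟨K, rfl⟩ : ∃ P, K = P * q := ⟨K / q, by field_simp⟩
  have p1 : 0 ≤ P₁ := nonneg_of_mul_nonneg_left p1 hq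
  have p2 : 0 ≤ P₂ := nonneg_of_mul_nonneg_left p2 hq
  have pT : 0 ≤ T := nonneg_of_mul_nonneg_left pT hq
  have hq' := hq.ne'
  suffices hm : T = Fintype.card ι * Fintype.card κ ∧ P₂ = 0 by
    rw [hm.1, hm.2]; simp
  have e₁ : P₁ + (e - s + Fintype.card ι + Fintype.card κ) * j + K = 0 :=
    mul_right_cancel₀ hq' (by linarith)
  have e₂ : P₂ - (e - s) * (Fintype.card ι * Fintype.card κ - j) -
      (Fintype.card ι + Fintype.card κ) + K = 0 := mul_right_cancel₀ hq' (by linarith)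
  have b₁ : 0 ≤ j + K + (1 - T) := le_of_mul_le_mul_right (by linarith) hq
  have b₀ : T ≤ j + 1 := le_of_mul_le_mul_right b₀ hq
  by_cases hc : Fintype.card ι ≤ 1 ∨ Fintype.card κ ≤ 1
  · have hK : K = j + 1 - T := mul_right_cancel₀ hq' (by rw [hK1 hc hU I.num]; ring)
    obtain ⟨hP, hT⟩ := numeric_dichotomy_of_one
      (D := Fintype.card ι * Fintype.card κ) (n := Fintype.card ι + Fintype.card κ)
      (t := e - s + Fintype.card ι + Fintype.card κ) (T := T) (K := K) (P₁ := P₁) (P₂ := P₂)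
      (by rcases hc with hc | hc
          · have : Fintype.card ι = 1 := by omega
            rw [this]; push_cast; ring
          · have : Fintype.card κ = 1 := by omega
            rw [this]; push_cast; ring) hj hj' p1 p2
      (by push_cast; linarith) b₀ hK (by push_cast; linarith)
    refine ⟨?_, hT⟩
    rw [hP]; push_cast; ring
  · push Not at hc
    have b₂ := b₂ hc.1 hc.2
    obtain ⟨hP, hT⟩ := numeric_dichotomy_of_two_le (r := Fintype.card ι) (m := Fintype.card κ)
      (by exact_mod_cast hc.1) (by exact_mod_cast hc.2) (by exact_mod_cast h22)
      (t := e - s + Fintype.card ι + Fintype.card κ) (T := T) (K := K) (P₁ := P₁) (P₂ := P₂)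
      hj hj' p1 p2 pT (by push_cast; linarith) (by push_cast; linarith) b₁ b₀
      (by push_cast; exact le_of_mul_le_mul_right (by linarith) hq)
    refine ⟨?_, hT⟩
    rw [hP]; push_cast; ring

include A in
theorem eq_zero_of_Utot [Nonempty ι] [Nonempty κ]
    (I : S.IsInv e s j h) (hU : S.Utot h = 0) (h0 : S.box h = 0) (hj : 1 ≤ j)
    (hj' : j + 1 ≤ Fintype.card ι * Fintype.card κ) : h = 0 := by
  by_contra hh
  have hq : 0 < ⟪h, h⟫ :=
    (PosForm.nonneg h).lt_of_ne fun hc => hh (PosForm.eq_zero _ hc.symm)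
  have e₁ := A.eq₁ I h0
  have e₂ := A.eq₂ I h0
  have hC : ∀ x, S.C x h = 0 := fun x => by
    have : S.C x = S.C x * S.Utot := by
      simp [Sys.C, Sys.Utot, Finset.mul_sum, S.UU]
    rw [this, Module.End.mul_apply, hU, map_zero]
  have hK : ⟪(S.KF + S.KG) h, h⟫ = 0 := by
    rw [A.K_eq]; simp [hC]
  rw [hU, hK] at e₂
  rw [hK] at e₁
  have p1 : 0 ≤ ∑ x, ⟪S.X x h, S.X x h⟫ := Finset.sum_nonneg fun _ _ => PosForm.nonneg _
  have p2 : 0 ≤ ∑ x, ⟪S.Y x h, S.Y x h⟫ := Finset.sum_nonneg fun _ _ => PosForm.nonneg _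
  simp only [map_zero, AddMonoidHom.zero_apply] at e₂
  have hι : (1 : ℚ) ≤ Fintype.card ι := by exact_mod_cast (Fintype.card_pos : 0 < Fintype.card ι)
  have hκ : (0 : ℚ) ≤ Fintype.card κ := Nat.cast_nonneg _
  have hjq : (1 : ℚ) ≤ j := by exact_mod_cast hj
  have hj'q : (1 : ℚ) ≤ Fintype.card ι * Fintype.card κ - j := by
    have : (j : ℚ) + 1 ≤ Fintype.card ι * Fintype.card κ := by exact_mod_cast hj'
    linarith
  have f1 : (e - s + Fintype.card ι + Fintype.card κ : ℚ) ≤ 0 := by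
    by_contra hc
    push Not at hc
    have := mul_pos (mul_pos hc (by linarith : (0 : ℚ) < j)) hq
    linarith
  have f2 : (0 : ℚ) ≤ e - s := by
    by_contra hc
    push Not at hc
    have := mul_pos (mul_pos (neg_pos.2 hc)
      (by linarith : (0 : ℚ) < Fintype.card ι * Fintype.card κ - j)) hq
    linarith
  linarith

end Adj
end

section linalg
variable {k : Type} [Field k] {W : Type} [AddCommGroup W] [Module k W]

theorem fitting [PosForm W] {N : Submodule k W} [FiniteDimensional k N] (T : Module.End k W)
    (hN : ∀ x ∈ N, T x ∈ N) (hT : ∀ x y, ⟪T x, y⟫ = ⟪x, T y⟫) {x : W} (hx : x ∈ N) :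
    ∃ h ∈ N, ∃ y ∈ N, T h = 0 ∧ x = h + T y := by
  set T' := T.restrict hN
  have hd : Disjoint (LinearMap.range T') (LinearMap.ker T') := by
    rw [Submodule.disjoint_def]
    rintro _ ⟨y, rfl⟩ hy
    have h1 : T (T y) = 0 := congrArg Subtype.val hy
    refine Subtype.ext (PosForm.eq_zero _ ?_)
    change ⟪T y, T y⟫ = 0
    rw [hT, h1, map_zero]
  have ht := Submodule.eq_top_of_disjoint _ _
    (LinearMap.finrank_range_add_finrank_ker T').ge hd
  obtain ⟨_, ⟨y, rfl⟩, h, hh, e⟩ := Submodule.mem_sup.1 (ht ▸ Submodule.mem_top : (⟨x, hx⟩ : N) ∈ _)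
  refine ⟨h, h.2, y, y.2, congrArg Subtype.val hh, ?_⟩
  rw [add_comm]
  exact (congrArg Subtype.val e).symm

theorem mem_of_eigenvectors [CharZero k] (T : Module.End k W) (N U : Submodule k W)
    (hN : ∀ x ∈ N, T x ∈ N) (hU : ∀ c : ℤ, ∀ x ∈ N, T x = c • x → x ∈ U) {x : W} (hx : x ∈ N)
    (hs : x ∈ Submodule.span k {y | ∃ c : ℤ, T y = c • y}) : x ∈ U := by
  let p : Finset ℤ → Polynomial k := fun s => ∏ c ∈ s, (Polynomial.X - Polynomial.C (c : k))
  have hp : ∀ s t, s ⊆ t → ∀ y, Polynomial.aeval T (p s) y = 0 → Polynomial.aeval T (p t) y = 0 := by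
    intro s t hst y hy
    change Polynomial.aeval T (∏ c ∈ t, (Polynomial.X - Polynomial.C (c : k))) y = 0
    change Polynomial.aeval T (∏ c ∈ s, (Polynomial.X - Polynomial.C (c : k))) y = 0 at hy
    rw [← Finset.prod_sdiff hst, map_mul, Module.End.mul_apply, hy, map_zero]
  have key : ∀ s : Finset ℤ, ∀ x ∈ N, Polynomial.aeval T (p s) x = 0 → x ∈ U := by
    intro s
    induction s using Finset.induction_on with
    | empty => intro x _ h; simp [p] at h; simp [h]
    | insert c s hc ih =>
      intro x hx h
      set z := Polynomial.aeval T (p s) x with hz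
      have hzN : z ∈ N := by
        have : ∀ q : Polynomial k, Polynomial.aeval T q x ∈ N := fun q => by
          induction q using Polynomial.induction_on' with
          | add a b ha hb => simpa using N.add_mem ha hb
          | monomial n a =>
            rw [Polynomial.aeval_monomial, Module.End.mul_apply]
            refine N.smul_mem _ ?_
            induction n with
            | zero => simpa
            | succ n ih => rw [pow_succ', Module.End.mul_apply]; exact hN _ ih
        exact this _
      have hT : T z = c • z := by
        simp only [p, Finset.prod_insert hc, map_mul, Module.End.mul_apply] at h
        change Polynomial.aeval T (Polynomial.X - Polynomial.C (c : k)) z = 0 at h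
        simp only [map_sub, Polynomial.aeval_X, Polynomial.aeval_C, LinearMap.sub_apply,
          Module.algebraMap_end_apply] at h
        rw [sub_eq_zero.1 h, Int.cast_smul_eq_zsmul]
      have hzU := hU c z hzN hT
      have hev : ∀ q : Polynomial k, Polynomial.aeval T q z = q.eval (c : k) • z := fun q => by
        refine Module.End.aeval_apply_of_mem_apply_eq_smul ?_
        rw [hT, Int.cast_smul_eq_zsmul]
      have h0 : (p s).eval (c : k) ≠ 0 := by
        simp only [p, Polynomial.eval_prod, Polynomial.eval_sub, Polynomial.eval_X,
          Polynomial.eval_C]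
        refine Finset.prod_ne_zero_iff.2 fun c' hc' => sub_ne_zero.2 ?_
        exact fun e => hc ((Int.cast_injective e) ▸ hc')
      have hm := ih (x - ((p s).eval (c : k))⁻¹ • z) (N.sub_mem hx (N.smul_mem _ hzN)) (by
        rw [map_sub, map_smul, hev, smul_smul, inv_mul_cancel₀ h0, one_smul, ← hz, sub_self])
      simpa using U.add_mem hm (U.smul_mem ((p s).eval (c : k))⁻¹ hzU)
  obtain ⟨s, hs⟩ : ∃ s, Polynomial.aeval T (p s) x = 0 := by
    clear hx
    induction hs using Submodule.span_induction with
    | mem y hy =>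
      obtain ⟨c, hc⟩ := hy
      exact ⟨{c}, by simp [p, hc]⟩
    | zero => exact ⟨∅, by simp⟩
    | add y z _ _ hy hz =>
      obtain ⟨s, hs⟩ := hy
      obtain ⟨t, ht⟩ := hz
      refine ⟨s ∪ t, ?_⟩
      rw [map_add, hp s _ Finset.subset_union_left y hs, hp t _ Finset.subset_union_right z ht,
        add_zero]
    | smul r y _ hy =>
      obtain ⟨s, hs⟩ := hy
      exact ⟨s, by rw [map_smul, hs, smul_zero]⟩
  exact key s x hx hs

end linalg

namespace Sys
section ring
variable {ι κ : Type} [Fintype ι] [Fintype κ] [DecidableEq ι] [DecidableEq κ]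
variable {L : Type} [Ring L] (S : Sys ι κ L)

theorem num_c (z) : ⁅S.num, S.c z⁆ = S.c z := by
  have h : ∀ x y, ⁅S.c x * S.a y, S.c z⁆ = if y = z then S.c x else 0 := fun x y => by
    rw [← S.Om_c, Om, add_br, S.Uc, add_zero]
  simp [num, sum_br, h]

theorem num_a (z) : ⁅S.num, S.a z⁆ = -S.a z := by
  have h : ∀ x y, ⁅S.c x * S.a y, S.a z⁆ = - if x = z then S.a y else 0 := fun x y => by
    rw [← S.Om_a, Om, add_br, S.Ua, add_zero]
  simp [num, sum_br, h]

theorem num_E (p q) : ⁅S.num, S.E p q⁆ = 0 := by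
  rw [br_skew]
  simp only [num, br_sum, lie_mul_right, S.Ec, S.Ea]; simp

theorem num_U (p q) : ⁅S.num, S.U p q⁆ = 0 := by
  rw [br_skew]
  simp only [num, br_sum, lie_mul_right, S.Uc, S.Ua]; simp

theorem num_num : ⁅S.num, S.num⁆ = 0 := by simp [Ring.lie_def]

theorem num_d : ⁅S.num, S.d⁆ = S.d := by
  simp [d, br_sum, lie_mul_right, num_c, X, num_E]

theorem num_del : ⁅S.num, S.del⁆ = -S.del := by
  simp [del, br_sum, lie_mul_right, num_a, Y, num_E]

theorem num_tau : ⁅S.num, S.tau⁆ = S.tau := by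
  simp [tau, br_sum, lie_mul_right, num_c, C, num_U]

theorem num_Utot : ⁅S.num, S.Utot⁆ = 0 := by
  simp [Utot, br_sum, num_U]

theorem num_tr : ⁅S.num, S.tr⁆ = 0 := by
  rw [tr_eq, br_sub, br_sub, br_sum, num_num, num_Utot]; simp [num_E]

theorem F_Utot (i l) : ⁅S.F i l, S.Utot⁆ = 0 := by
  simp only [F, sub_br, sum_br, S.Om_Utot]
  simp [Utot, br_sum, S.EU]

theorem G_Utot (b a) : ⁅S.G b a, S.Utot⁆ = 0 := by
  simp only [G, add_br, sum_br, S.Om_Utot]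
  simp [Utot, br_sum, S.EU]

theorem box_comm {z : L} (h1 : ⁅z, S.d⁆ = 0) (h2 : ⁅z, S.del⁆ = 0) : ⁅z, S.box⁆ = 0 := by
  rw [box, br_add, lie_mul_right, lie_mul_right, h1, h2]; simp

theorem F_box (i l) : ⁅S.F i l, S.box⁆ = 0 := S.box_comm (S.F_d _ _) (S.F_del _ _)
theorem G_box (i l) : ⁅S.G i l, S.box⁆ = 0 := S.box_comm (S.G_d _ _) (S.G_del _ _)
theorem num_box : ⁅S.num, S.box⁆ = 0 := by
  rw [box, br_add, lie_mul_right, lie_mul_right, num_d, num_del]; noncomm_ring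

theorem Utot_d : ⁅S.Utot, S.d⁆ = 0 := by
  simp [d, X, Utot, br_sum, sum_br, lie_mul_right, S.Uc, br_skew (S.U _ _) (S.E _ _), S.EU]
theorem Utot_del : ⁅S.Utot, S.del⁆ = 0 := by
  simp [del, Y, Utot, br_sum, sum_br, lie_mul_right, S.Ua, br_skew (S.U _ _) (S.E _ _), S.EU]
theorem Utot_box : ⁅S.Utot, S.box⁆ = 0 := S.box_comm S.Utot_d S.Utot_del

theorem Utot_tau : S.Utot * S.tau = 0 := by
  have h : ∀ x y, S.U (some x) (some x) * (S.c y * S.C y) = 0 := fun x y => by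
    rw [← mul_assoc, sub_eq_zero.1 (S.Uc (some x) (some x) y), mul_assoc, C, S.UU]; simp
  simp [Utot, tau, Finset.sum_mul, Finset.mul_sum, h]

theorem tau_Utot : S.tau * S.Utot = S.tau := by
  have h : ∀ x y, S.c x * S.C x * S.U (some y) (some y) = if x = y then S.c x * S.C x else 0 :=
    fun x y => by
      rw [mul_assoc, C, S.UU]; by_cases e : x = y <;> simp [e]
  simp [Utot, tau, Finset.sum_mul, Finset.mul_sum, h]

end ring

section
variable {ι κ : Type} [Fintype ι] [Fintype κ] [DecidableEq ι] [DecidableEq κ]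
variable {k : Type} [Field k] {W : Type} [AddCommGroup W] [Module k W]
variable (S : Sys ι κ (Module.End k W)) (i₀ : ι)

/-- Vectors on which all `F i i` agree, the off-diagonal `F i l` vanish, the `G b a` act by the
scalar `s`, in degree `j`. -/
def Q (s j : ℤ) : Submodule k W where
  carrier := {h | (∀ i l, S.F i l h = if i = l then S.F i₀ i₀ h else 0) ∧
    (∀ b a, S.G b a h = if b = a then s • h else 0) ∧ S.num h = j • h}
  zero_mem' := by simp
  add_mem' := by
    rintro x y ⟨h1, h2, h3⟩ ⟨g1, g2, g3⟩
    refine ⟨fun i l => ?_, fun b a => ?_, ?_⟩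
    · simp only [map_add]; rw [h1, g1]; split_ifs <;> simp
    · rw [map_add, h2, g2]; split_ifs <;> simp
    · rw [map_add, h3, g3, smul_add]
  smul_mem' := by
    rintro c x ⟨h1, h2, h3⟩
    refine ⟨fun i l => ?_, fun b a => ?_, ?_⟩
    · simp only [map_smul]; rw [h1]; split_ifs <;> simp
    · rw [map_smul, h2]; split_ifs
      · rw [smul_comm]
      · rw [smul_zero]
    · rw [map_smul, h3, smul_comm]

variable {S i₀} {s j : ℤ} {h : W}

omit [Fintype ι] [Fintype κ] [DecidableEq ι] [DecidableEq κ] in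
theorem comm_apply {x z : Module.End k W} (e : ⁅x, z⁆ = 0) (h : W) : x (z h) = z (x h) :=
  LinearMap.congr_fun (sub_eq_zero.1 e) h

theorem mem_Q_of_comm {z : Module.End k W} (ε : ℤ) (hF : ∀ i l, ⁅S.F i l, z⁆ = 0)
    (hG : ∀ i l, ⁅S.G i l, z⁆ = 0) (hn : ⁅S.num, z⁆ = ε • z) (hh : h ∈ S.Q i₀ s j) :
    z h ∈ S.Q i₀ s (j + ε) := by
  obtain ⟨h1, h2, h3⟩ := hh
  refine ⟨fun i l => ?_, fun b a => ?_, ?_⟩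
  · rw [comm_apply (hF _ _), comm_apply (hF _ _), h1]; split_ifs <;> simp
  · rw [comm_apply (hG _ _), h2]; split_ifs <;> simp
  · have := LinearMap.congr_fun hn h
    simp only [Ring.lie_def, LinearMap.sub_apply, Module.End.mul_apply, LinearMap.smul_apply,
      sub_eq_iff_eq_add] at this
    rw [this, h3, map_zsmul, add_smul, add_comm]

theorem d_mem (hh : h ∈ S.Q i₀ s j) : S.d h ∈ S.Q i₀ s (j + 1) :=
  mem_Q_of_comm 1 S.F_d S.G_d (by rw [num_d, one_smul]) hh
theorem tau_mem (hh : h ∈ S.Q i₀ s j) : S.tau h ∈ S.Q i₀ s (j + 1) :=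
  mem_Q_of_comm 1 S.F_tau S.G_tau (by rw [num_tau, one_smul]) hh
theorem del_mem (hh : h ∈ S.Q i₀ s j) : S.del h ∈ S.Q i₀ s (j - 1) :=
  mem_Q_of_comm (-1) S.F_del S.G_del (by rw [num_del, neg_smul, one_smul]) hh
theorem Utot_mem (hh : h ∈ S.Q i₀ s j) : S.Utot h ∈ S.Q i₀ s j := by
  simpa using mem_Q_of_comm 0 S.F_Utot S.G_Utot (by rw [num_Utot, zero_smul]) hh
theorem box_mem (hh : h ∈ S.Q i₀ s j) : S.box h ∈ S.Q i₀ s j := by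
  simpa using mem_Q_of_comm 0 S.F_box S.G_box (by rw [num_box, zero_smul]) hh

theorem F_mem [CharZero k] (hh : h ∈ S.Q i₀ s j) : S.F i₀ i₀ h ∈ S.Q i₀ s j := by
  have h1 : S.tr h ∈ S.Q i₀ s j := by
    simpa using mem_Q_of_comm 0 S.F_tr S.G_tr (by rw [num_tr, zero_smul]) hh
  have h2 : S.tr h = (Fintype.card ι : k) • S.F i₀ i₀ h := by
    have : ∀ i, S.F i i h = S.F i₀ i₀ h := fun i => by rw [hh.1 i i, if_pos rfl]
    simp [tr, LinearMap.sum_apply, this, Nat.cast_smul_eq_nsmul]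
  have h3 : (Fintype.card ι : k) ≠ 0 := by
    have : Nonempty ι := ⟨i₀⟩
    exact Nat.cast_ne_zero.2 Fintype.card_ne_zero
  have := (S.Q i₀ s j).smul_mem (Fintype.card ι : k)⁻¹ h1
  rwa [h2, smul_smul, inv_mul_cancel₀ h3, one_smul] at this

theorem isInv_of_mem_Q (hh : h ∈ S.Q i₀ s j) {e : ℤ} (he : S.F i₀ i₀ h = e • h) :
    S.IsInv e s j h := ⟨fun i l => by rw [hh.1, he], hh.2.1, hh.2.2⟩

end
end Sys

namespace Adj
variable {ι κ : Type} [Fintype ι] [Fintype κ] [DecidableEq ι] [DecidableEq κ]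
variable {k : Type} [Field k] {W : Type} [AddCommGroup W] [Module k W] [PosForm W]
variable {S : Sys ι κ (Module.End k W)} (A : Adj S)

include A in
theorem hodge {N : Submodule k W} [FiniteDimensional k N] (hN : ∀ x ∈ N, S.box x ∈ N)
    (h2 : S.d * S.d = 0) {x : W} (hx : x ∈ N) (hd : S.d x = 0) :
    ∃ h ∈ N, ∃ y ∈ N, S.box h = 0 ∧ x = h + S.d (S.del y) := by
  obtain ⟨h, hh, y, hy, h0, e⟩ := fitting S.box hN A.box hx
  refine ⟨h, hh, y, hy, h0, ?_⟩
  have hz : S.d (S.d (S.del y)) = 0 := LinearMap.congr_fun h2 _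
  have e' : x = h + (S.d (S.del y) + S.del (S.d y)) := e
  have h3 : S.d (S.del (S.d y)) = 0 := by
    rw [e', map_add, map_add, hz, (A.harmonic h0).1, zero_add, zero_add] at hd
    exact hd
  have h4 : S.del (S.d y) = 0 := PosForm.eq_zero _ (by rw [A.del, h3, map_zero])
  rw [e', h4, add_zero]

include A in
theorem exact [CharZero k] [Nonempty κ] (i₀ : ι)
    (h22 : ¬(Fintype.card ι = 2 ∧ Fintype.card κ = 2))
    (hfd : ∀ x : W, ∃ M : Submodule k W, FiniteDimensional k M ∧ x ∈ M ∧ ∀ y ∈ M, S.box y ∈ M)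
    (hspan : ∀ x : W, x ∈ Submodule.span k {y | ∃ c : ℤ, S.F i₀ i₀ y = c • y})
    {s j : ℤ} (hj : 1 ≤ j) (hj' : j + 1 ≤ Fintype.card ι * Fintype.card κ) {x : W}
    (hx : x ∈ S.Q i₀ s j) (hD : S.D x = 0) : ∃ y ∈ S.Q i₀ s (j - 1), S.D y = x := by
  have : Nonempty ι := ⟨i₀⟩
  have h2 : ∀ z : Module.End k W, z + z = 0 → z = 0 := fun z hz => by
    have : (2 : k) • z = 0 := by rw [two_smul, hz]
    exact (smul_eq_zero.1 this).resolve_left two_ne_zero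
  have hUU : S.Utot * S.Utot = S.Utot := by
    simp [Sys.Utot, Finset.mul_sum, Finset.sum_mul, S.UU]
  have hUU' : ∀ z, S.Utot (S.Utot z) = S.Utot z := fun z => LinearMap.congr_fun hUU z
  have hUt : ∀ z, S.Utot (S.tau z) = 0 := fun z => LinearMap.congr_fun S.Utot_tau z
  have htU : ∀ z, S.tau (S.Utot z) = S.tau z := fun z => LinearMap.congr_fun S.tau_Utot z
  have hUd : ∀ z, S.Utot (S.d z) = S.d (S.Utot z) := Sys.comm_apply S.Utot_d
  have hUdel : ∀ z, S.Utot (S.del z) = S.del (S.Utot z) := Sys.comm_apply S.Utot_del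
  have hUbox : ∀ z, S.Utot (S.box z) = S.box (S.Utot z) := Sys.comm_apply S.Utot_box
  have hdt : ∀ z, S.d (S.tau z) = -S.tau (S.d z) := fun z =>
    eq_neg_of_add_eq_zero_left (LinearMap.congr_fun (S.d_tau h2) z)
  have hFc : ∀ {z : Module.End k W}, ⁅S.F i₀ i₀, z⁆ = 0 → ∀ y, z (S.F i₀ i₀ y) = S.F i₀ i₀ (z y) :=
    fun e y => (Sys.comm_apply e y).symm
  have hD' : S.d x + S.tau x = 0 := hD
  set β := S.Utot x with hβ
  have hβQ : β ∈ S.Q i₀ s j := Sys.Utot_mem hx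
  have hβU : S.Utot β = β := hUU' x
  have hdβ : S.d β = 0 := by
    rw [hβ, ← hUd]
    have := congrArg S.Utot hD'
    rwa [map_add, hUt, add_zero, map_zero] at this
  set γ := x - β with hγ
  have hγQ : γ ∈ S.Q i₀ s j := Submodule.sub_mem _ hx hβQ
  have hγU : S.Utot γ = 0 := by rw [hγ, map_sub, hβU, sub_self]
  have hdγ : S.d γ = -S.tau β := by
    rw [hγ, map_sub, hdβ, hβ, htU, sub_zero]; exact eq_neg_of_add_eq_zero_left hD'
  clear_value β γ
  -- the component with nonzero auxiliary index
  obtain ⟨M, hMf, hM, hMb⟩ := hfd β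
  let N1 : Submodule k W := M ⊓ (S.Q i₀ s j ⊓ LinearMap.ker (S.Utot - 1))
  have : FiniteDimensional k N1 := Submodule.finiteDimensional_of_le (inf_le_left : N1 ≤ M)
  have hk : ∀ z, z ∈ LinearMap.ker (S.Utot - 1) ↔ S.Utot z = z := fun z => by
    rw [LinearMap.mem_ker, LinearMap.sub_apply, Module.End.one_apply, sub_eq_zero]
  obtain ⟨h, ⟨-, hhQ, hhU⟩, y, ⟨-, hyQ, hyU⟩, h0, e⟩ := A.hodge (N := N1) (x := β)
    (fun z ⟨z1, z2, z3⟩ => ⟨hMb z z1, Sys.box_mem z2, (hk _).2 (by rw [hUbox, (hk z).1 z3])⟩)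
    (S.d_d h2) ⟨hM, hβQ, (hk _).2 hβU⟩ hdβ
  replace hhU := (hk _).1 hhU
  replace hyU := (hk _).1 hyU
  let β' := S.del y
  have hβ' : S.Utot β' = β' := by rw [hUdel, hyU]
  have hτβ' : S.tau β' ∈ S.Q i₀ s j := by simpa using Sys.tau_mem (Sys.del_mem hyQ)
  let γ' := γ - S.tau β'
  have hγ'd : S.d γ' = -S.tau h := by
    rw [map_sub, hdγ, hdt, e, map_add]; abel
  have hh0 : h = 0 := by
    let P : Submodule k W := (S.Q i₀ s j ⊓ LinearMap.ker (S.Utot - 1)) ⊓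
      (LinearMap.ker S.box ⊓ (LinearMap.range S.d).comap S.tau)
    have hhP : h ∈ P := ⟨⟨hhQ, (hk _).2 hhU⟩, h0, -γ', by rw [map_neg, hγ'd, neg_neg]⟩
    have hst : ∀ z ∈ P, S.F i₀ i₀ z ∈ P := by
      rintro z ⟨⟨z1, z2⟩, z3, ⟨w, z4⟩⟩
      refine ⟨⟨Sys.F_mem z1, (hk _).2 ?_⟩, ?_, ⟨S.F i₀ i₀ w, ?_⟩⟩
      · rw [hFc (S.F_Utot _ _), (hk z).1 z2]
      · exact (hFc (S.F_box _ _) z).trans (by rw [LinearMap.mem_ker.1 z3, map_zero])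
      · rw [hFc (S.F_d _ _), hFc (S.F_tau _ _), z4]
    refine (Submodule.mem_bot k).1 (mem_of_eigenvectors (S.F i₀ i₀) P ⊥ hst ?_ hhP (hspan h))
    rintro c z ⟨⟨z1, z2⟩, z3, ⟨w, z4⟩⟩ hc
    rw [Submodule.mem_bot]
    rcases A.dichotomy h22 (Sys.isInv_of_mem_Q z1 hc) ((hk z).1 z2) z3 hj hj' with r | ⟨r1, r2⟩
    · exact r
    have hdel : S.del (S.tau z) = 0 := by
      have := LinearMap.congr_fun S.del_tau z
      simpa [LinearMap.sum_apply, r2, (A.harmonic z3).2] using this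
    have : ⟪S.tau z, S.tau z⟫ = 0 := by
      nth_rw 2 [← z4]
      rw [← A.del, hdel, map_zero, AddMonoidHom.zero_apply]
    rw [this] at r1
    refine PosForm.eq_zero _ ?_
    have hc0 : (Fintype.card ι * Fintype.card κ : ℚ) ≠ 0 := by
      exact mul_ne_zero (Nat.cast_ne_zero.2 Fintype.card_ne_zero)
        (Nat.cast_ne_zero.2 Fintype.card_ne_zero)
    exact (mul_eq_zero.1 r1.symm).resolve_left hc0
  rw [hh0, map_zero, neg_zero] at hγ'd
  rw [hh0, zero_add] at e
  -- the component with zero auxiliary index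
  obtain ⟨M, hMf, hM, hMb⟩ := hfd γ'
  let N0 : Submodule k W := M ⊓ (S.Q i₀ s j ⊓ LinearMap.ker S.Utot)
  have : FiniteDimensional k N0 := Submodule.finiteDimensional_of_le (inf_le_left : N0 ≤ M)
  obtain ⟨g, ⟨-, hgQ, hgU⟩, y₂, ⟨-, hyQ₂, hyU₂⟩, g0, e₂⟩ := A.hodge (N := N0) (x := γ')
    (fun z ⟨z1, z2, z3⟩ => ⟨hMb z z1, Sys.box_mem z2, (hUbox z).trans (by rw [LinearMap.mem_ker.1 z3, map_zero])⟩)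
    (S.d_d h2) ⟨hM, Submodule.sub_mem _ hγQ hτβ', by
      change S.Utot (γ - S.tau β') = 0
      rw [map_sub, hγU, hUt, sub_zero]⟩ hγ'd
  replace hgU := LinearMap.mem_ker.1 hgU
  replace hyU₂ := LinearMap.mem_ker.1 hyU₂
  have hg0 : g = 0 := by
    let P : Submodule k W := (S.Q i₀ s j ⊓ LinearMap.ker S.Utot) ⊓ LinearMap.ker S.box
    have hgP : g ∈ P := ⟨⟨hgQ, hgU⟩, g0⟩
    have hst : ∀ z ∈ P, S.F i₀ i₀ z ∈ P := by
      rintro z ⟨⟨z1, z2⟩, z3⟩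
      refine ⟨⟨Sys.F_mem z1, (hFc (S.F_Utot _ _) z).trans ?_⟩, (hFc (S.F_box _ _) z).trans ?_⟩
      · rw [LinearMap.mem_ker.1 z2, map_zero]
      · rw [LinearMap.mem_ker.1 z3, map_zero]
    refine (Submodule.mem_bot k).1 (mem_of_eigenvectors (S.F i₀ i₀) P ⊥ hst ?_ hgP (hspan g))
    rintro c z ⟨⟨z1, z2⟩, z3⟩ hc
    exact (Submodule.mem_bot k).2 (A.eq_zero_of_Utot (Sys.isInv_of_mem_Q z1 hc) z2 z3 hj hj')
  rw [hg0, zero_add] at e₂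
  have hτ0 : S.tau (S.del y₂) = 0 := by rw [← htU, hUdel, hyU₂, map_zero, map_zero]
  refine ⟨β' + S.del y₂, Submodule.add_mem _ (Sys.del_mem hyQ) (Sys.del_mem hyQ₂), ?_⟩
  change S.d (S.del y + S.del y₂) + S.tau (S.del y + S.del y₂) = x
  rw [map_add, map_add, hτ0, ← e, ← e₂]
  change β + (γ - S.tau (S.del y)) + (S.tau (S.del y) + 0) = x
  rw [hγ]; abel

end Adj

open MvPolynomial

section polyform
variable {σ : Type} {k : Type} [Field k] [CharZero k]

instance : PosForm k :=
  letI b := Module.Basis.ofVectorSpace ℚ k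
  { form := AddMonoidHom.mk' (fun x => AddMonoidHom.mk'
      (fun y => ∑ᶠ t, b.repr x t * b.repr y t) fun y y' => by
        simp only [map_add, Finsupp.add_apply, mul_add]
        refine finsum_add_distrib ?_ ?_ <;>
        exact (b.repr x).hasFiniteSupport.subset fun t ht => by
          rw [Function.mem_support] at *; exact left_ne_zero_of_mul ht) fun x x' => by
        ext y
        simp only [map_add, Finsupp.add_apply, add_mul, AddMonoidHom.mk'_apply,
          AddMonoidHom.add_apply]
        refine finsum_add_distrib ?_ ?_ <;>
        exact (b.repr y).hasFiniteSupport.subset fun t ht => by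
          rw [Function.mem_support] at *; exact right_ne_zero_of_mul ht
    symm := fun x y => finsum_congr fun t => mul_comm _ _
    nonneg := fun x => finsum_nonneg fun t => mul_self_nonneg _
    eq_zero := fun x hx => by
      change ∑ᶠ t, b.repr x t * b.repr x t = 0 at hx
      have hs : (Function.support fun t => b.repr x t * b.repr x t) ⊆ (b.repr x).support :=
        fun t ht => by
          rw [Function.mem_support] at ht
          exact Finsupp.mem_support_iff.2 (left_ne_zero_of_mul ht)
      rw [finsum_eq_sum_of_support_subset _ hs,
        Finset.sum_eq_zero_iff_of_nonneg fun _ _ => mul_self_nonneg _] at hx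
      refine b.repr.map_eq_zero_iff.1 (Finsupp.ext fun t => ?_)
      by_contra h
      exact h (mul_self_eq_zero.1 (hx t (Finsupp.mem_support_iff.2 h))) }

/-- The factorial of a multi-index. -/
def weight (m : σ →₀ ℕ) : ℚ := m.prod fun _ n => (n.factorial : ℚ)

omit [CharZero k] in
theorem weight_pos (m : σ →₀ ℕ) : 0 < weight m :=
  Finset.prod_pos fun _ _ => Nat.cast_pos.2 (Nat.factorial_pos _)

theorem weight_add_single (m : σ →₀ ℕ) (i : σ) :
    weight (m + Finsupp.single i 1) = (m i + 1) * weight m := by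
  classical
  have h : ∀ m : σ →₀ ℕ, weight m = (m i).factorial * (m.erase i).prod fun _ n => (n.factorial : ℚ) :=
    fun m => by
      rw [weight, ← Finsupp.mul_prod_erase' m i _ fun _ => by simp]
  rw [h, h m, Finsupp.erase_add, Finsupp.erase_single, add_zero, Finsupp.add_apply,
    Finsupp.single_eq_same, Nat.factorial_succ]
  push_cast; ring

theorem form_support_finite (f g : MvPolynomial σ k) :
    (Function.support fun m => weight m * ⟪f.coeff m, g.coeff m⟫).Finite :=
  f.support.finite_toSet.subset fun m hm => by
    rw [Function.mem_support] at hm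
    refine Finset.mem_coe.2 (MvPolynomial.mem_support_iff.2 fun h => hm ?_)
    rw [h, map_zero]; simp

/-- The apolar pairing on polynomials. -/
instance : PosForm (MvPolynomial σ k) where
  form := AddMonoidHom.mk' (fun f => AddMonoidHom.mk'
    (fun g => ∑ᶠ m, weight m * ⟪f.coeff m, g.coeff m⟫) fun g g' => by
      simp only [coeff_add, map_add, mul_add]
      exact finsum_add_distrib (form_support_finite _ _) (form_support_finite _ _)) fun f f' => by
      ext g
      simp only [coeff_add, map_add, AddMonoidHom.add_apply, mul_add]
      exact finsum_add_distrib (form_support_finite _ _) (form_support_finite _ _)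
  symm f g := finsum_congr fun m => by rw [PosForm.symm]
  nonneg f := finsum_nonneg fun m => mul_nonneg (weight_pos m).le (PosForm.nonneg _)
  eq_zero f hf := by
    change ∑ᶠ m, weight m * ⟪f.coeff m, f.coeff m⟫ = 0 at hf
    rw [finsum_eq_sum_of_support_subset (s := (form_support_finite f f).toFinset) _ (by simp),
      Finset.sum_eq_zero_iff_of_nonneg fun m _ =>
        mul_nonneg (weight_pos m).le (PosForm.nonneg _)] at hf
    refine MvPolynomial.ext _ _ fun m => PosForm.eq_zero _ ?_
    by_contra h
    have h0 : weight m * ⟪f.coeff m, f.coeff m⟫ ≠ 0 := mul_ne_zero (weight_pos m).ne' h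
    exact h0 (hf m (by simpa using h0))

theorem form_monomial [DecidableEq (σ →₀ ℕ)] (m n : σ →₀ ℕ) (a b : k) :
    ⟪monomial m a, monomial n b⟫ = if m = n then weight m * ⟪a, b⟫ else 0 := by
  classical
  change ∑ᶠ t, weight t * ⟪(monomial m a).coeff t, (monomial n b).coeff t⟫ = _
  rw [finsum_eq_single _ m]
  · rw [coeff_monomial, coeff_monomial, if_pos rfl]
    by_cases h : m = n
    · simp [h]
    · rw [if_neg h, if_neg (Ne.symm h)]; simp
  · intro t ht
    rw [coeff_monomial, if_neg ht.symm]; simp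

theorem form_X_mul (i : σ) (f g : MvPolynomial σ k) : ⟪X i * f, g⟫ = ⟪f, pderiv i g⟫ := by
  classical
  induction f using MvPolynomial.induction_on' with
  | add p q hp hq => rw [mul_add, map_add, map_add, AddMonoidHom.add_apply, hp, hq]; rfl
  | monomial m a =>
    induction g using MvPolynomial.induction_on' with
    | add p q hp hq => rw [map_add, map_add, map_add, hp, hq]
    | monomial n b =>
      rw [X, monomial_mul, one_mul, pderiv_monomial, form_monomial, form_monomial, add_comm]
      by_cases h : m + Finsupp.single i 1 = n
      · subst h
        have : m + Finsupp.single i 1 - Finsupp.single i 1 = m := by ext; simp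
        rw [if_pos rfl, this, if_pos rfl, weight_add_single, mul_comm b, ← nsmul_eq_mul, map_nsmul,
          nsmul_eq_mul]
        simp; ring
      · rw [if_neg h]
        split_ifs with h'
        · have : n i = 0 := by
            by_contra hn
            refine h (h' ▸ tsub_add_cancel_of_le ?_)
            exact Finsupp.single_le_iff.2 (Nat.one_le_iff_ne_zero.2 hn)
          simp [this]
        · rfl

/-- The polarization operator `X i * ∂ j`. -/
def xd (i j : σ) : Derivation k (MvPolynomial σ k) (MvPolynomial σ k) := (X i : MvPolynomial σ k) • pderiv j

omit [CharZero k] in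
theorem xd_apply (i j : σ) (f : MvPolynomial σ k) : xd i j f = X i * pderiv j f := rfl

theorem xd_adj (i j : σ) (f g : MvPolynomial σ k) : ⟪xd i j f, g⟫ = ⟪f, xd j i g⟫ := by
  rw [xd_apply, form_X_mul, PosForm.symm, xd_apply, PosForm.symm f, form_X_mul]

omit [CharZero k] in
theorem xd_monomial (i j : σ) (m : σ →₀ ℕ) (a : k) :
    xd i j (monomial m a) = monomial (m - Finsupp.single j 1 + Finsupp.single i 1) (a * m j) := by
  rw [xd_apply, pderiv_monomial, X, monomial_mul, one_mul, add_comm]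

omit [CharZero k] in
theorem xd_mem (i j : σ) {N : ℕ} {f : MvPolynomial σ k} (hf : f ∈ restrictTotalDegree σ k N) :
    xd i j f ∈ restrictTotalDegree σ k N := by
  rw [f.as_sum, map_sum]
  refine Submodule.sum_mem _ fun m hm => ?_
  rw [xd_monomial]
  by_cases h : m j = 0
  · simp [h]
  have hd := (le_totalDegree hm).trans ((mem_restrictTotalDegree _ _ _).1 hf)
  obtain ⟨m', rfl⟩ : ∃ m', m = m' + Finsupp.single j 1 := ⟨m - Finsupp.single j 1,
    (tsub_add_cancel_of_le (Finsupp.single_le_iff.2 (Nat.one_le_iff_ne_zero.2 h))).symm⟩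
  rw [mem_restrictTotalDegree]
  refine (totalDegree_monomial_le _ _).trans ?_
  rw [add_tsub_cancel_right]
  rw [Finsupp.sum_add_index' (by simp) (by simp), Finsupp.sum_single_index (by simp)] at hd ⊢
  exact hd

end polyform

section matrixring
variable {C : Type} [Fintype C] [DecidableEq C] {k : Type} [Field k]

/-- The column polarization operators on functions on square matrices. -/
def E0 (c d : C) : Derivation k (MvPolynomial (C × C) k) (MvPolynomial (C × C) k) :=
  ∑ l, xd (l, c) (l, d)

omit [DecidableEq C] in
theorem E0_apply (c d : C) (f : MvPolynomial (C × C) k) :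
    E0 c d f = ∑ l, X (l, c) * pderiv (l, d) f := by
  rw [E0, ← Derivation.coeFnAddMonoidHom_apply, map_sum, Finset.sum_apply]; rfl

theorem E0_X (c d l e : C) :
    E0 c d (X (l, e) : MvPolynomial (C × C) k) = if e = d then X (l, c) else 0 := by
  rw [E0_apply, Finset.sum_eq_single l]
  · rw [pderiv_X, Pi.single_apply]; simp [Prod.ext_iff, eq_comm]
  · intro b _ hb
    rw [pderiv_X, Pi.single_apply]; simp [Prod.ext_iff, hb.symm]
  · simp

/-- `E0` as an endomorphism. -/
def e0 (c d : C) : Module.End k (MvPolynomial (C × C) k) := (E0 c d).toLinearMap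

theorem E0_comm (p q s t : C) : ⁅(e0 p q : Module.End k (MvPolynomial (C × C) k)), (e0 s t : Module.End k _)⁆ =
    (if q = s then e0 p t else 0) - (if t = p then (e0 s q : Module.End k _) else 0) := by
  have h : ⁅E0 (k := k) p q, E0 (k := k) s t⁆ = (if q = s then E0 p t else 0) -
      (if t = p then E0 s q else 0) := by
    refine derivation_ext fun ⟨l, e⟩ => ?_
    rw [Derivation.commutator_apply, Derivation.sub_apply, E0_X, E0_X]
    by_cases h1 : q = s
    · by_cases h2 : t = p
      · by_cases h3 : e = q <;> by_cases h4 : e = t <;> subst_vars <;> simp_all [E0_X]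
      · by_cases h3 : e = q <;> by_cases h4 : e = t <;> subst_vars <;>
          simp_all [E0_X, Ne.symm h2]
    · by_cases h2 : t = p
      · by_cases h3 : e = q <;> by_cases h4 : e = t <;> subst_vars <;>
          simp_all [E0_X, Ne.symm h1]
      · by_cases h3 : e = q <;> by_cases h4 : e = t <;> subst_vars <;>
          simp_all [E0_X, Ne.symm h1, Ne.symm h2]
  have h' := congrArg (fun D : Derivation k _ _ => D.toLinearMap) h
  refine h'.trans ?_
  split_ifs <;> rfl

/-- The row polarization operators on functions on square matrices. -/
def Rw (i l : C) : Derivation k (MvPolynomial (C × C) k) (MvPolynomial (C × C) k) :=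
  ∑ c, xd (i, c) (l, c)

omit [DecidableEq C] in
theorem Rw_apply (i l : C) (f : MvPolynomial (C × C) k) :
    Rw i l f = ∑ c, X (i, c) * pderiv (l, c) f := by
  rw [Rw, ← Derivation.coeFnAddMonoidHom_apply, map_sum, Finset.sum_apply]; rfl

theorem Rw_X (i l m e : C) :
    Rw i l (X (m, e) : MvPolynomial (C × C) k) = if m = l then X (i, e) else 0 := by
  rw [Rw_apply, Finset.sum_eq_single e]
  · rw [pderiv_X, Pi.single_apply]; simp [Prod.ext_iff, eq_comm]
  · intro b _ hb
    rw [pderiv_X, Pi.single_apply]; simp [Prod.ext_iff, hb.symm]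
  · simp

theorem E0_Rw (c d i l : C) (f : MvPolynomial (C × C) k) : E0 c d (Rw i l f) = Rw i l (E0 c d f) := by
  have h : ⁅E0 (k := k) c d, Rw (k := k) i l⁆ = 0 := by
    refine derivation_ext fun ⟨m, e⟩ => ?_
    rw [Derivation.commutator_apply, E0_X, Rw_X]
    split_ifs <;> simp_all [E0_X, Rw_X]
  have := DFunLike.congr_fun h f
  rwa [Derivation.commutator_apply, Derivation.zero_apply, sub_eq_zero] at this

omit [DecidableEq C] in
theorem E0_adj [CharZero k] (c d : C) (f g : MvPolynomial (C × C) k) :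
    ⟪E0 c d f, g⟫ = ⟪f, E0 d c g⟫ := by
  have h : ∀ c d (f : MvPolynomial (C × C) k), E0 c d f = ∑ l, xd (l, c) (l, d) f := fun c d f =>
    E0_apply c d f
  rw [h, h, form_sum_left, form_sum_right]
  exact Finset.sum_congr rfl fun l _ => xd_adj _ _ _ _

omit [DecidableEq C] in
theorem Rw_adj [CharZero k] (i l : C) (f g : MvPolynomial (C × C) k) :
    ⟪Rw i l f, g⟫ = ⟪f, Rw l i g⟫ := by
  have h : ∀ c d (f : MvPolynomial (C × C) k), Rw c d f = ∑ l, xd (c, l) (d, l) f := fun c d f =>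
    Rw_apply c d f
  rw [h, h, form_sum_left, form_sum_right]
  exact Finset.sum_congr rfl fun l _ => xd_adj _ _ _ _

omit [DecidableEq C] in
theorem E0_mem (c d : C) {N : ℕ} {f : MvPolynomial (C × C) k} (hf : f ∈ restrictTotalDegree _ k N) :
    E0 c d f ∈ restrictTotalDegree _ k N := by
  rw [E0_apply]
  exact Submodule.sum_mem _ fun l _ => xd_mem _ _ hf

omit [DecidableEq C] in
theorem Rw_mem (c d : C) {N : ℕ} {f : MvPolynomial (C × C) k} (hf : f ∈ restrictTotalDegree _ k N) :
    Rw c d f ∈ restrictTotalDegree _ k N := by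
  rw [Rw_apply]
  exact Submodule.sum_mem _ fun l _ => xd_mem _ _ hf

omit [DecidableEq C] in
theorem E0_monomial (c : C) (m : C × C →₀ ℕ) (a : k) :
    E0 c c (monomial m a) = ((∑ l, m (l, c) : ℕ) : ℤ) • monomial m a := by
  rw [E0_apply, natCast_zsmul, Finset.sum_smul]
  refine Finset.sum_congr rfl fun l _ => ?_
  change xd (l, c) (l, c) (monomial m a) = _
  rw [xd_monomial]
  by_cases h : m (l, c) = 0
  · simp [h]
  rw [tsub_add_cancel_of_le (Finsupp.single_le_iff.2 (Nat.one_le_iff_ne_zero.2 h)), ← map_nsmul,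
    nsmul_eq_mul, mul_comm]

end matrixring

section abstract
variable {ι κ : Type} [Fintype ι] [Fintype κ] [DecidableEq ι] [DecidableEq κ]
variable {k : Type} [Field k] {V : Type} [AddCommGroup V] [Module k V] [PosForm V]

theorem unit_adj (p q : Option (ι × κ)) (x y : H ι κ V) : ⟪unit k V p q x, y⟫ = ⟪x, unit k V q p y⟫ := by
  rw [form_pi, form_pi, Finset.sum_eq_single p, Finset.sum_eq_single q]
  · rw [unit_apply, unit_apply, if_pos rfl, if_pos rfl]
  · intro b _ hb
    rw [unit_apply, if_neg hb, map_zero]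
  · simp
  · intro b _ hb
    rw [unit_apply, if_neg hb, map_zero, AddMonoidHom.zero_apply]
  · simp

omit [PosForm V] in
theorem unit_one : unit k V none none + ∑ x : ι × κ, unit k V (some x) (some x) = 1 := by
  refine LinearMap.ext fun h => funext fun p => ?_
  rw [LinearMap.add_apply, LinearMap.sum_apply, Pi.add_apply, Finset.sum_apply]
  cases p with
  | none => simp [unit_apply]
  | some p => simp [unit_apply]

theorem sys_adj (e : ι ⊕ κ → ι ⊕ κ → Module.End k V) (he) (hadj : ∀ p q x y, ⟪e p q x, y⟫ = ⟪x, e q p y⟫) :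
    Adj (sys e he) where
  E p q x y := by
    rw [form_pi, form_pi]
    refine Finset.sum_congr rfl fun t _ => ?_
    rw [form_pi, form_pi]
    exact Finset.sum_congr rfl fun S _ => hadj _ _ _ _
  c t x y := by
    rw [form_pi, form_pi]
    exact Finset.sum_congr rfl fun p _ => cr_adj k t (x p) (y p)
  U p q x y := unit_adj p q x y
  one := unit_one

omit [PosForm V] in
theorem sys_box_mem (e : ι ⊕ κ → ι ⊕ κ → Module.End k V) (he) (M : Submodule k V)
    (hM : ∀ p q, ∀ x ∈ M, e p q x ∈ M) {h : H ι κ V} (hh : ∀ p S, h p S ∈ M) (p S) :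
    (sys e he).box h p S ∈ M := by
  let M' : Submodule k (H ι κ V) :=
    { carrier := {h | ∀ p S, h p S ∈ M}
      add_mem' := fun hx hy p S => M.add_mem (hx p S) (hy p S)
      zero_mem' := fun p S => M.zero_mem
      smul_mem' := fun r x hx p S => M.smul_mem r (hx p S) }
  have hE : ∀ p q, ∀ x ∈ M', (sys e he).E p q x ∈ M' := fun p q x hx r S => hM _ _ _ (hx r S)
  have hc : ∀ t, ∀ x ∈ M', (sys e he).c t x ∈ M' := fun t x hx r S => by
    change cr k t (x r) S ∈ M
    rw [cr_apply]
    split_ifs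
    exacts [zsmul_mem (hx _ _) _, M.zero_mem]
  have ha : ∀ t, ∀ x ∈ M', (sys e he).a t x ∈ M' := fun t x hx r S => by
    change an k t (x r) S ∈ M
    rw [an_apply]
    split_ifs
    exacts [M.zero_mem, zsmul_mem (hx _ _) _]
  have hd : ∀ x ∈ M', (sys e he).d x ∈ M' := fun x hx => by
    rw [Sys.d, LinearMap.sum_apply]
    exact Submodule.sum_mem _ fun t _ => hc _ _ (hE _ _ _ hx)
  have hdel : ∀ x ∈ M', (sys e he).del x ∈ M' := fun x hx => by
    rw [Sys.del, LinearMap.sum_apply]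
    exact Submodule.sum_mem _ fun t _ => ha _ _ (hE _ _ _ hx)
  exact M'.add_mem (hd _ (hdel _ hh)) (hdel _ (hd _ hh)) p S

omit [PosForm V] in
theorem c_a_apply (t : ι × κ) (h : Finset (ι × κ) → V) (S) :
    cr k t (an k t h) S = if t ∈ S then h S else 0 := by
  rw [cr_apply, an_apply]
  by_cases ht : t ∈ S
  · rw [if_pos ht, if_pos ht, if_neg (Finset.notMem_erase _ _), Finset.insert_erase ht, smul_smul,
      sgn_erase _ ht, rs_self, one_mul, sgn_sq, one_smul]
  · rw [if_neg ht, if_neg ht]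

omit [PosForm V] in
theorem sys_num_apply (e : ι ⊕ κ → ι ⊕ κ → Module.End k V) (he) (h : H ι κ V) (p S) :
    (sys e he).num h p S = (S.card : ℤ) • h p S := by
  rw [Sys.num, LinearMap.sum_apply, Finset.sum_apply, Finset.sum_apply]
  have : ∀ t, (((sys e he).c t * (sys e he).a t) h) p S = if t ∈ S then h p S else 0 := fun t =>
    c_a_apply (k := k) t (h p) S
  simp [this]

omit [PosForm V] in
theorem sys_span (e : ι ⊕ κ → ι ⊕ κ → Module.End k V) (he) (i₀ : ι)
    (hs : ∀ x : V, x ∈ Submodule.span k {y | ∃ c : ℤ, e (.inl i₀) (.inl i₀) y = c • y}) (x : H ι κ V) :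
    x ∈ Submodule.span k {y | ∃ c : ℤ, (sys e he).F i₀ i₀ y = c • y} := by
  have key : ∀ p S (v : V), (Pi.single p (Pi.single S v) : H ι κ V) ∈
      Submodule.span k {y | ∃ c : ℤ, (sys e he).F i₀ i₀ y = c • y} := fun p S v => by
    induction hs v using Submodule.span_induction with
    | zero => simp
    | add x y _ _ hx hy => rw [Pi.single_add, Pi.single_add]; exact Submodule.add_mem _ hx hy
    | smul r x _ hx => rw [Pi.single_smul, Pi.single_smul]; exact Submodule.smul_mem _ _ hx
    | mem y hy =>
      obtain ⟨c, hc⟩ := hy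
      refine Submodule.subset_span ⟨c - ∑ a, ((if (i₀, a) ∈ S then 1 else 0) +
        if p = some (i₀, a) then 1 else 0), ?_⟩
      have hE : (sys e he).E (.inl i₀) (.inl i₀) (Pi.single p (Pi.single S y)) =
          c • Pi.single p (Pi.single S y) := by
        funext q T
        change e _ _ ((Pi.single p (Pi.single S y) : H ι κ V) q T) = _
        rw [Pi.smul_apply, Pi.smul_apply]
        by_cases hq : q = p
        · subst hq
          by_cases hT : T = S
          · subst hT; simp [hc]
          · simp [hT]
        · simp [hq]
      have hca : ∀ t, ((sys e he).c t * (sys e he).a t) (Pi.single p (Pi.single S y)) =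
          (if t ∈ S then 1 else 0 : ℤ) • Pi.single p (Pi.single S y) := fun t => by
        funext q T
        change cr k t (an k t ((Pi.single p (Pi.single S y) : H ι κ V) q)) T = _
        rw [c_a_apply, Pi.smul_apply, Pi.smul_apply]
        by_cases hq : q = p
        · subst hq
          by_cases hT : T = S
          · subst hT; split_ifs <;> simp
          · simp [hT]
        · simp [hq]
      have hU : ∀ t, (sys e he).U (some t) (some t) (Pi.single p (Pi.single S y)) =
          (if p = some t then 1 else 0 : ℤ) • Pi.single p (Pi.single S y) := fun t => by
        funext q
        change (if q = some t then (Pi.single p (Pi.single S y) : H ι κ V) (some t) else 0) = _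
        rw [Pi.smul_apply]
        by_cases hp : p = some t
        · subst hp
          by_cases hq : q = some t
          · subst hq; simp
          · simp [hq]
        · by_cases hq : q = some t
          · subst hq; simp [hp, Ne.symm hp]
          · simp [hp, hq]
      rw [Sys.F, LinearMap.sub_apply, LinearMap.sum_apply, hE, sub_smul, Finset.sum_smul]
      refine congrArg₂ _ rfl (Finset.sum_congr rfl fun a _ => ?_)
      rw [Sys.Om, LinearMap.add_apply, hca, hU, add_smul]
  have : x = ∑ p, ∑ S, Pi.single p (Pi.single S (x p S)) := by
    funext q T
    simp only [Finset.sum_apply]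
    rw [Finset.sum_eq_single q, Finset.sum_eq_single T]
    · simp
    · intro b _ hb; simp [hb.symm]
    · simp
    · intro b _ hb; simp [hb.symm]
    · simp
  rw [this]
  exact Submodule.sum_mem _ fun p _ => Submodule.sum_mem _ fun S _ => key _ _ _

end abstract

section system
variable {ι κ : Type} [Fintype ι] [Fintype κ] [DecidableEq ι] [DecidableEq κ]
variable (ι κ) (k : Type) [Field k]

/-- The ring of functions on square matrices indexed by `ι ⊕ κ`. -/
abbrev R0 := MvPolynomial ((ι ⊕ κ) × (ι ⊕ κ)) k

/-- The system of operators on Fock space over functions on square matrices. -/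
def S0 : Sys ι κ (Module.End k (H ι κ (R0 ι κ k))) :=
  sys e0 E0_comm

variable {ι κ k}

theorem S0_fd (x : H ι κ (R0 ι κ k)) : ∃ M : Submodule k (H ι κ (R0 ι κ k)),
    FiniteDimensional k M ∧ x ∈ M ∧ ∀ y ∈ M, (S0 ι κ k).box y ∈ M := by
  let N := ∑ p, ∑ S, (x p S).totalDegree
  let V := restrictTotalDegree ((ι ⊕ κ) × (ι ⊕ κ)) k N
  let φ : (Option (ι × κ) → Finset (ι × κ) → V) →ₗ[k] H ι κ (R0 ι κ k) :=
    LinearMap.compLeft (LinearMap.compLeft V.subtype _) _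
  have hφ : ∀ y, y ∈ LinearMap.range φ ↔ ∀ p S, y p S ∈ V := fun y =>
    ⟨fun ⟨z, hz⟩ p S => hz ▸ (z p S).2, fun h => ⟨fun p S => ⟨y p S, h p S⟩, rfl⟩⟩
  refine ⟨LinearMap.range φ, inferInstance, (hφ _).2 fun p S => ?_, fun y hy => (hφ _).2 ?_⟩
  · rw [mem_restrictTotalDegree]
    exact (Finset.single_le_sum (f := fun S => (x p S).totalDegree) (fun _ _ => Nat.zero_le _)
      (Finset.mem_univ S)).trans (Finset.single_le_sum
        (f := fun p => ∑ S, (x p S).totalDegree) (fun _ _ => Nat.zero_le _) (Finset.mem_univ p))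
  · exact sys_box_mem e0 E0_comm V (fun p q z hz => E0_mem p q hz) ((hφ y).1 hy)

theorem S0_span (i₀ : ι) (x : H ι κ (R0 ι κ k)) :
    x ∈ Submodule.span k {y | ∃ c : ℤ, (S0 ι κ k).F i₀ i₀ y = c • y} := by
  refine sys_span e0 E0_comm i₀ (fun f => ?_) x
  rw [f.as_sum]
  exact Submodule.sum_mem _ fun m _ => Submodule.subset_span ⟨_, E0_monomial _ _ _⟩

theorem S0_exact [CharZero k] [Nonempty κ] (i₀ : ι)
    (h22 : ¬(Fintype.card ι = 2 ∧ Fintype.card κ = 2))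
    {s j : ℤ} (hj : 1 ≤ j) (hj' : j + 1 ≤ Fintype.card ι * Fintype.card κ) {x : H ι κ (R0 ι κ k)}
    (hx : x ∈ (S0 ι κ k).Q i₀ s j) (hD : (S0 ι κ k).D x = 0) :
    ∃ y ∈ (S0 ι κ k).Q i₀ s (j - 1), (S0 ι κ k).D y = x :=
  (sys_adj e0 E0_comm fun _ _ => E0_adj _ _).exact i₀ h22 S0_fd (S0_span i₀) hj hj' hx hD

end system

section wronskian
variable {σ : Type} {k : Type} [Field k] [CharZero k]

theorem eq_C_of_pderiv_eq_zero {f : MvPolynomial σ k} (h : ∀ i, pderiv i f = 0) : f = C (f.coeff 0) := by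
  classical
  refine MvPolynomial.ext _ _ fun m => ?_
  rw [coeff_C]
  split_ifs with hm
  · rw [hm]
  · obtain ⟨i, hi⟩ : ∃ i, m i ≠ 0 := by
      by_contra! h0
      exact hm (Finsupp.ext fun i => (h0 i).symm)
    have hs : m - Finsupp.single i 1 + Finsupp.single i 1 = m :=
      tsub_add_cancel_of_le (Finsupp.single_le_iff.2 (Nat.one_le_iff_ne_zero.2 hi))
    have := coeff_pderiv (i := i) f (m - Finsupp.single i 1)
    rw [h, coeff_zero, hs] at this
    refine (mul_eq_zero.1 this.symm).resolve_right ?_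
    exact Nat.cast_add_one_ne_zero _

omit [CharZero k] in
theorem pderiv_eq_zero_of_dvd {f : MvPolynomial σ k} {i : σ} (h : f ∣ pderiv i f) : pderiv i f = 0 := by
  by_contra h0
  obtain ⟨q, hq⟩ := h
  have hf : f ≠ 0 := by rintro rfl; simp at h0
  have hq0 : q ≠ 0 := by rintro rfl; simp [hq] at h0
  have h1 := congrArg totalDegree hq
  rw [totalDegree_mul_of_isDomain hf hq0] at h1
  obtain ⟨m, hm, hd⟩ := Finset.exists_mem_eq_sup (pderiv i f).support
    (by rwa [Finset.nonempty_iff_ne_empty, Ne, MvPolynomial.support_eq_empty]) fun s => s.sum fun _ e => e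
  change (pderiv i f).totalDegree = _ at hd
  rw [MvPolynomial.mem_support_iff, coeff_pderiv] at hm
  have h2 := le_totalDegree (MvPolynomial.mem_support_iff.2 (left_ne_zero_of_mul hm))
  rw [Finsupp.sum_add_index' (by simp) (by simp), Finsupp.sum_single_index (by simp)] at h2
  omega

theorem eq_C_mul_of_wronskian {u h : MvPolynomial σ k} (hu : u ≠ 0)
    (H : ∀ i, u * pderiv i h = h * pderiv i u) : ∃ c, h = C c * u := by
  obtain ⟨h', u', g, hr, rfl, rfl⟩ := UniqueFactorizationMonoid.exists_reduced_factors' h u hu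
  have hg : g ≠ 0 := left_ne_zero_of_mul hu
  have hu' : u' ≠ 0 := right_ne_zero_of_mul hu
  have H' : ∀ i, u' * pderiv i h' = h' * pderiv i u' := fun i => by
    refine mul_left_cancel₀ (mul_ne_zero hg hg) ?_
    have := H i
    rw [Derivation.leibniz, Derivation.leibniz, smul_eq_mul, smul_eq_mul, smul_eq_mul,
      smul_eq_mul] at this
    linear_combination this
  have h1 : ∀ i, pderiv i u' = 0 := fun i =>
    pderiv_eq_zero_of_dvd (hr.symm.dvd_of_dvd_mul_left ⟨_, (H' i).symm⟩)
  have h2 : ∀ i, pderiv i h' = 0 := fun i => by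
    have := H' i
    rw [h1, mul_zero] at this
    exact (mul_eq_zero.1 this).resolve_left hu'
  obtain ⟨a, rfl⟩ : ∃ a, u' = C a := ⟨_, eq_C_of_pderiv_eq_zero h1⟩
  obtain ⟨b, rfl⟩ : ∃ b, h' = C b := ⟨_, eq_C_of_pderiv_eq_zero h2⟩
  have ha : a ≠ 0 := by rintro rfl; simp at hu'
  exact ⟨b / a, by rw [mul_comm g (C a), ← mul_assoc, ← map_mul, div_mul_cancel₀ _ ha, mul_comm]⟩

end wronskian

section minors
variable {k B : Type} [CommRing k] [CommRing B] [Algebra k B]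

theorem der_prod {ν : Type} [DecidableEq ν] (D : Derivation k B B) (s : Finset ν) (f : ν → B) :
    D (∏ i ∈ s, f i) = ∑ j ∈ s, ∏ i ∈ s, if i = j then D (f i) else f i := by
  induction s using Finset.induction_on with
  | empty => simp
  | insert a s ha ih =>
    rw [Finset.prod_insert ha, Derivation.leibniz, ih, Finset.sum_insert ha, Finset.prod_insert ha,
      if_pos rfl, add_comm, smul_eq_mul, smul_eq_mul, mul_comm, Finset.mul_sum]
    refine congrArg₂ _ (congrArg₂ _ rfl (Finset.prod_congr rfl fun i hi => ?_))
      (Finset.sum_congr rfl fun j hj => ?_)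
    · rw [if_neg]; rintro rfl; exact ha hi
    · rw [Finset.prod_insert ha, if_neg]
      rintro rfl; exact ha hj

theorem der_det {ν : Type} [Fintype ν] [DecidableEq ν] (D : Derivation k B B) (M : Matrix ν ν B) :
    D M.det = ∑ j, (Matrix.of fun i l => if l = j then D (M i l) else M i l).det := by
  simp only [Matrix.det_apply, map_sum, Matrix.of_apply]
  rw [Finset.sum_comm]
  refine Finset.sum_congr rfl fun σ _ => ?_
  rw [Units.smul_def, map_zsmul, der_prod, Finset.smul_sum]
  rfl

variable {C : Type} [DecidableEq C] {ν : Type} [Fintype ν] [DecidableEq ν]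

/-- The minor of `x` on rows `f` and columns `g`. -/
def mnr (x : Matrix C C B) (f g : ν → C) : B := (Matrix.of fun i j => x (f i) (g j)).det

theorem der_mnr_col (D : Derivation k B B) {x : Matrix C C B} {c d : C}
    (hD : ∀ l e, D (x l e) = if e = d then x l c else 0) (f g : ν → C) :
    D (mnr x f g) = ∑ j, if g j = d then mnr x f (Function.update g j c) else 0 := by
  rw [mnr, der_det]
  refine Finset.sum_congr rfl fun j _ => ?_
  split_ifs with h
  · refine congrArg Matrix.det (Matrix.ext fun i l => ?_)
    simp only [Matrix.of_apply, Function.update_apply]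
    split_ifs with hl
    · subst hl; rw [hD, if_pos h]
    · rfl
  · refine Matrix.det_eq_zero_of_column_eq_zero j fun i => ?_
    simp [hD, h]

omit [DecidableEq C] in
theorem mnr_transpose (x : Matrix C C B) (f g : ν → C) : mnr x f g = mnr x.transpose g f :=
  (Matrix.det_transpose _).symm

theorem der_mnr_row (D : Derivation k B B) {x : Matrix C C B} {c d : C}
    (hD : ∀ l e, D (x l e) = if l = d then x c e else 0) (f g : ν → C) :
    D (mnr x f g) = ∑ j, if f j = d then mnr x (Function.update f j c) g else 0 := by
  rw [mnr_transpose, der_mnr_col (x := x.transpose) (c := c) (d := d) D fun l e => hD e l]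
  simp only [← mnr_transpose]

omit [DecidableEq C] in
theorem mnr_eq_zero_of_col (x : Matrix C C B) {f g : ν → C} {i j : ν} (hij : i ≠ j) (h : g i = g j) :
    mnr x f g = 0 :=
  Matrix.det_zero_of_column_eq hij fun l => by simp [h]

/-- Replacing one index of an injective family by another index of it kills a minor. -/
theorem der_mnr_col_inj (D : Derivation k B B) {x : Matrix C C B} {g : ν → C} (hg : g.Injective)
    {c d : C} (hD : ∀ l e, D (x l e) = if e = d then x l c else 0) (hc : c ∈ Set.range g) (f : ν → C) :
    D (mnr x f g) = if c = d then mnr x f g else 0 := by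
  obtain ⟨i, rfl⟩ := hc
  rw [der_mnr_col D hD]
  by_cases hd : g i = d
  · rw [if_pos hd, Finset.sum_eq_single i]
    · rw [if_pos hd, Function.update_eq_self]
    · intro j _ hj
      rw [if_neg fun h => hj (hg (h.trans hd.symm))]
    · simp
  · rw [if_neg hd]
    refine Finset.sum_eq_zero fun j _ => ?_
    split_ifs with h
    · have hij : i ≠ j := by rintro rfl; exact hd h
      exact mnr_eq_zero_of_col x hij (by simp [hij])
    · rfl

theorem der_mnr_col_notMem (D : Derivation k B B) {x : Matrix C C B} {g : ν → C} 
    {c d : C} (hD : ∀ l e, D (x l e) = if e = d then x l c else 0) (hd : d ∉ Set.range g) (f : ν → C) :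
    D (mnr x f g) = 0 := by
  rw [der_mnr_col D hD]
  exact Finset.sum_eq_zero fun j _ => if_neg fun h => hd ⟨j, h⟩

end minors

section hw
variable {ι κ : Type} [Fintype ι] [Fintype κ] [DecidableEq ι] [DecidableEq κ]
variable (ι κ) (k : Type) [Field k]

/-- The generic square matrix. -/
def x0 : Matrix (ι ⊕ κ) (ι ⊕ κ) (R0 ι κ k) := Matrix.of fun l e => X (l, e)

variable {ι κ k}

theorem E0_x (c d l e : ι ⊕ κ) : E0 c d (x0 ι κ k l e) = if e = d then x0 ι κ k l c else 0 := E0_X _ _ _ _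

theorem Rw_x (c d l e : ι ⊕ κ) : Rw c d (x0 ι κ k l e) = if l = d then x0 ι κ k c e else 0 := Rw_X _ _ _ _

variable (ι κ k) in
/-- The determinant of the generic matrix. -/
def det0 : R0 ι κ k := mnr (x0 ι κ k) id id

/-- The Plücker coordinate on the rows `f`. -/
def pl (f : ι → ι ⊕ κ) : R0 ι κ k := mnr (x0 ι κ k) f Sum.inl

theorem E0_det (c d : ι ⊕ κ) : E0 c d (det0 ι κ k) = if c = d then det0 ι κ k else 0 :=
  der_mnr_col_inj _ Function.injective_id (E0_x c d) ⟨c, rfl⟩ id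

theorem Rw_det (c d : ι ⊕ κ) : Rw c d (det0 ι κ k) = if c = d then det0 ι κ k else 0 := by
  rw [det0, mnr_transpose]
  exact der_mnr_col_inj _ Function.injective_id (fun l e => Rw_x c d e l) ⟨c, rfl⟩ id

theorem E0_pl_inr (c : ι ⊕ κ) (a : κ) (f : ι → ι ⊕ κ) : E0 c (.inr a) (pl (k := k) f) = 0 :=
  der_mnr_col_notMem _ (E0_x c _) (by simp) _

theorem E0_pl_inl (i j : ι) (f : ι → ι ⊕ κ) :
    E0 (.inl i) (.inl j) (pl (k := k) f) = if i = j then pl f else 0 := by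
  rw [pl, der_mnr_col_inj _ Sum.inl_injective (E0_x _ _) ⟨i, rfl⟩]
  simp

theorem Rw_pl (c d : ι ⊕ κ) (f : ι → ι ⊕ κ) :
    Rw c d (pl (k := k) f) = ∑ j, if f j = d then pl (Function.update f j c) else 0 :=
  der_mnr_row _ (Rw_x c d) _ _

theorem map_mnr {B B' C ν : Type} [CommRing B] [CommRing B'] [Fintype ν] [DecidableEq ν] (φ : B →+* B')
    (x : Matrix C C B) (f g : ν → C) : φ (mnr x f g) = mnr (x.map φ) f g := by
  rw [mnr, RingHom.map_det]; rfl

omit [Fintype ι] [Fintype κ] [DecidableEq ι] [DecidableEq κ] in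
theorem eval_mnr {ν : Type} [Fintype ν] [DecidableEq ν] (v : Matrix (ι ⊕ κ) (ι ⊕ κ) k) (f g : ν → ι ⊕ κ) :
    eval (fun p => v p.1 p.2) (mnr (x0 ι κ k) f g) = mnr v f g := by
  rw [map_mnr]
  refine congrArg (mnr · f g) (Matrix.ext fun i j => ?_)
  simp [x0]

theorem det0_ne_zero : det0 ι κ k ≠ 0 := fun h => by
  have := eval_mnr (k := k) (1 : Matrix (ι ⊕ κ) (ι ⊕ κ) k) id id
  rw [← det0, h, map_zero, mnr] at this
  exact zero_ne_one (this.trans Matrix.det_one)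

omit [Fintype κ] in
theorem pl_inl_ne_zero : pl (κ := κ) (k := k) (Sum.inl : ι → ι ⊕ κ) ≠ 0 := fun h => by
  have := eval_mnr (k := k) (1 : Matrix (ι ⊕ κ) (ι ⊕ κ) k) (Sum.inl : ι → ι ⊕ κ) Sum.inl
  rw [← pl, h, map_zero, mnr] at this
  have h1 : (Matrix.of fun i j : ι => (1 : Matrix (ι ⊕ κ) (ι ⊕ κ) k) (.inl i) (.inl j)) = 1 := by
    ext i j; simp [Matrix.one_apply]
  rw [h1, Matrix.det_one] at this
  exact zero_ne_one this

/-- Highest weight functions of weight `t` on the `ι`-columns and `s` on the `κ`-columns. -/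
structure IsHW (t s : ℤ) (h : R0 ι κ k) : Prop where
  col : ∀ c a, E0 c (.inr a) h = if c = .inr a then s • h else 0
  inl : ∀ i j, E0 (.inl i) (.inl j) h = if i = j then t • h else 0
  row : ∀ i a, Rw (.inl i) (.inr a) h = 0

theorem der_mul_ite {B : Type} [CommRing B] [Algebra k B] (D : Derivation k B B) {P : Prop} [Decidable P]
    {s s' : ℤ} {f g : B} (hf : D f = if P then s • f else 0) (hg : D g = if P then s' • g else 0) :
    D (f * g) = if P then (s + s') • (f * g) else 0 := by
  rw [Derivation.leibniz, hf, hg]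
  split_ifs
  · simp only [smul_eq_mul, zsmul_eq_mul]; push_cast; ring
  · simp

theorem IsHW.mul {t s t' s' : ℤ} {f g : R0 ι κ k} (hf : IsHW t s f) (hg : IsHW t' s' g) :
    IsHW (t + t') (s + s') (f * g) where
  col c a := der_mul_ite _ (hf.col c a) (hg.col c a)
  inl i j := der_mul_ite _ (hf.inl i j) (hg.inl i j)
  row i a := by rw [Derivation.leibniz, hf.row, hg.row]; simp

theorem IsHW.pow {t s : ℤ} {f : R0 ι κ k} (hf : IsHW t s f) (n : ℕ) : IsHW (n * t) (n * s) (f ^ n) := by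
  induction n with
  | zero =>
    exact { col := fun c a => by simp, inl := fun c a => by simp, row := fun c a => by simp }
  | succ n ih =>
    rw [pow_succ]
    convert ih.mul hf using 1 <;> push_cast <;> ring

theorem isHW_det0 : IsHW 1 1 (det0 ι κ k) where
  col c a := by rw [E0_det, one_smul]
  inl i j := by rw [E0_det, one_smul]; simp
  row i a := by rw [Rw_det]; simp

theorem isHW_pl : IsHW 1 0 (pl (k := k) (Sum.inl : ι → ι ⊕ κ)) where
  col c a := by rw [E0_pl_inr]; simp
  inl i j := by rw [E0_pl_inl, one_smul]
  row i a := by rw [Rw_pl]; simp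

theorem IsHW.eq_C_mul [CharZero k] {t s : ℤ} {h u : R0 ι κ k} (hh : IsHW t s h) (hu : IsHW t s u)
    (hu0 : u ≠ 0) : ∃ c, h = C c * u := by
  refine eq_C_mul_of_wronskian hu0 ?_
  let z : Matrix (ι ⊕ κ) (ι ⊕ κ) (R0 ι κ k) := Matrix.of fun l d => u * pderiv (l, d) h - h * pderiv (l, d) u
  have hE : ∀ c d, u * E0 c d h = h * E0 c d u → ∑ l, x0 ι κ k l c * z l d = 0 := fun c d H => by
    rw [E0_apply, E0_apply, ← sub_eq_zero, Finset.mul_sum, Finset.mul_sum,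
      ← Finset.sum_sub_distrib] at H
    rw [← H]
    refine Finset.sum_congr rfl fun l _ => ?_
    change X (l, c) * (u * pderiv (l, d) h - h * pderiv (l, d) u) = _
    ring
  have hdet : (x0 ι κ k).det ≠ 0 := det0_ne_zero
  have hdet' : (Matrix.of fun i j : ι => x0 ι κ k (.inl i) (.inl j)).det ≠ 0 := pl_inl_ne_zero
  have h1 : ∀ a l, z l (.inr a) = 0 := fun a => by
    refine congrFun (Matrix.eq_zero_of_vecMul_eq_zero hdet (v := fun l => z l (.inr a)) (funext fun c => ?_))
    refine (Finset.sum_congr rfl fun l _ => mul_comm _ _).trans (hE c (.inr a) ?_)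
    rw [hh.col, hu.col]
    split_ifs
    · simp only [zsmul_eq_mul]; ring
    · rw [mul_zero, mul_zero]
  have h2 : ∀ a j, z (.inr a) (.inl j) = 0 := fun a => by
    refine congrFun (Matrix.eq_zero_of_mulVec_eq_zero hdet' (v := fun j => z (.inr a) (.inl j))
      (funext fun i => ?_))
    have e1 := hh.row i a
    have e2 := hu.row i a
    rw [Rw_apply] at e1 e2
    have e3 : ∑ c, x0 ι κ k (.inl i) c * z (.inr a) c = 0 := by
      have e4 := congrArg₂ (fun p q => u * p - h * q) e1 e2
      simp only [mul_zero, sub_zero] at e4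
      rw [← e4, Finset.mul_sum, Finset.mul_sum, ← Finset.sum_sub_distrib]
      refine Finset.sum_congr rfl fun c _ => ?_
      change X (.inl i, c) * (u * pderiv (.inr a, c) h - h * pderiv (.inr a, c) u) = _
      ring
    rw [Fintype.sum_sum_type] at e3
    simp only [h1, mul_zero, Finset.sum_const_zero, add_zero] at e3
    exact e3
  have h3 : ∀ j i, z (.inl i) (.inl j) = 0 := fun j => by
    refine congrFun (Matrix.eq_zero_of_vecMul_eq_zero hdet' (v := fun i => z (.inl i) (.inl j))
      (funext fun i => ?_))
    have e3 := hE (.inl i) (.inl j) (by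
      rw [hh.inl, hu.inl]
      split_ifs
      · simp only [zsmul_eq_mul]; ring
      · rw [mul_zero, mul_zero])
    rw [Fintype.sum_sum_type] at e3
    simp only [h2, mul_zero, Finset.sum_const_zero, add_zero] at e3
    exact (Finset.sum_congr rfl fun l _ => mul_comm _ _).trans e3
  rintro ⟨l, d⟩
  rw [← sub_eq_zero]
  change z l d = 0
  rcases d with d | d
  · rcases l with l | l
    exacts [h3 _ _, h2 _ _]
  · exact h1 _ _

end hw

section wt
variable {σ k : Type} [Field k]

theorem xd_mem_weight (w : σ → ℕ) {i j : σ} {g g' : ℕ} (h : g + w i ≤ g' + w j) {f : MvPolynomial σ k}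
    (hf : f ∈ restrictSupport k {m | Finsupp.weight w m < g}) :
    xd i j f ∈ restrictSupport k {m | Finsupp.weight w m < g'} := by
  rw [f.as_sum, map_sum]
  refine Submodule.sum_mem _ fun m hm => ?_
  rw [xd_monomial]
  by_cases h0 : m j = 0
  · simp [h0]
  have hd : Finsupp.weight w m < g := hf hm
  obtain ⟨m', rfl⟩ : ∃ m', m = m' + Finsupp.single j 1 := ⟨m - Finsupp.single j 1,
    (tsub_add_cancel_of_le (Finsupp.single_le_iff.2 (Nat.one_le_iff_ne_zero.2 h0))).symm⟩
  refine (monomial_mem_restrictSupport k).2 (.inl ?_)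
  rw [add_tsub_cancel_right, Set.mem_ofPred_eq, map_add, Finsupp.weight_single, one_smul]
  rw [map_add, Finsupp.weight_single, one_smul] at hd
  omega

end wt

section fft
variable {ι κ : Type} [Fintype ι] [Fintype κ] [DecidableEq ι] [DecidableEq κ]
variable (ι κ) (k : Type) [Field k]

/-- The algebra generated by the Plücker coordinates. -/
def plAlg : Subalgebra k (R0 ι κ k) := Algebra.adjoin k (Set.range pl)

variable {ι} in
/-- The functions with the weights of `det0 ^ s` times an invariant. -/
def semi (i₀ : ι) (s : ℤ) : Submodule k (R0 ι κ k) where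
  carrier := {f | (∀ c a, E0 c (.inr a) f = if c = .inr a then s • f else 0) ∧
    ∀ i j, E0 (.inl i) (.inl j) f = if i = j then E0 (.inl i₀) (.inl i₀) f else 0}
  zero_mem' := ⟨fun c a => by simp, fun c a => by simp⟩
  add_mem' := fun ⟨h1, h2⟩ ⟨h3, h4⟩ => ⟨fun c a => by
    rw [map_add, h1, h3]; split_ifs <;> simp, fun i j => by
    rw [map_add, h2, h4]; split_ifs <;> simp⟩
  smul_mem' := fun r x ⟨h1, h2⟩ => ⟨fun c a => by
    rw [Derivation.map_smul, h1]; split_ifs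
    · rw [smul_comm]
    · simp, fun i j => by
    rw [Derivation.map_smul, h2]; split_ifs <;> simp⟩

/-- The multiples of `det0 ^ s` by elements of `plAlg`. -/
def detMul (s : ℕ) : Submodule k (R0 ι κ k) :=
  (plAlg ι κ k).toSubmodule.map (LinearMap.mulLeft k (det0 ι κ k ^ s))

variable {ι κ k}

theorem Rw_mem_plAlg (c d : ι ⊕ κ) {f : R0 ι κ k} (hf : f ∈ plAlg ι κ k) : Rw c d f ∈ plAlg ι κ k := by
  induction hf using Algebra.adjoin_induction with
  | mem x hx =>
    obtain ⟨f, rfl⟩ := hx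
    rw [Rw_pl]
    refine Subalgebra.sum_mem _ fun j _ => ?_
    split_ifs
    exacts [Algebra.subset_adjoin ⟨_, rfl⟩, Subalgebra.zero_mem _]
  | algebraMap r => rw [Derivation.map_algebraMap]; exact Subalgebra.zero_mem _
  | add x y _ _ hx hy => rw [map_add]; exact Subalgebra.add_mem _ hx hy
  | mul x y hx' hy' hx hy =>
    rw [Derivation.leibniz]
    exact Subalgebra.add_mem _ (Subalgebra.mul_mem _ hx' hy) (Subalgebra.mul_mem _ hy' hx)

theorem Rw_mem_detMul (c d : ι ⊕ κ) {s : ℕ} {f : R0 ι κ k} (hf : f ∈ detMul ι κ k s) :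
    Rw c d f ∈ detMul ι κ k s := by
  obtain ⟨p, hp, rfl⟩ := hf
  have h : ∃ b : k, Rw c d (det0 ι κ k ^ s) = b • det0 ι κ k ^ s := by
    by_cases hcd : c = d
    · refine ⟨s, ?_⟩
      induction s with
      | zero => simp
      | succ s ih =>
        rw [pow_succ, Derivation.leibniz, ih, Rw_det, if_pos hcd]
        simp only [smul_eq_mul, Algebra.smul_def, map_natCast]; push_cast; ring
    · refine ⟨0, ?_⟩
      rw [Derivation.leibniz_pow, Rw_det, if_neg hcd]; simp
  obtain ⟨b, hb⟩ := h
  refine ⟨Rw c d p + b • p, Subalgebra.add_mem _ (Rw_mem_plAlg c d hp) (Subalgebra.smul_mem _ hp b), ?_⟩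
  rw [LinearMap.mulLeft_apply, LinearMap.mulLeft_apply, Derivation.leibniz, hb]
  simp only [smul_eq_mul, Algebra.smul_def]; ring

theorem Rw_mem_semi (c d : ι ⊕ κ) {i₀ : ι} {s : ℤ} {f : R0 ι κ k} (hf : f ∈ semi κ k i₀ s) :
    Rw c d f ∈ semi κ k i₀ s := by
  refine ⟨fun e a => ?_, fun i j => ?_⟩
  · rw [E0_Rw, hf.1]; split_ifs
    · rw [map_zsmul]
    · rw [map_zero]
  · rw [E0_Rw, hf.2, E0_Rw]; split_ifs
    · rfl
    · rw [map_zero]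

theorem E0_E0 (p q s t : ι ⊕ κ) (f : R0 ι κ k) : E0 p q (E0 s t f) = E0 s t (E0 p q f) +
    ((if q = s then E0 p t f else 0) - (if t = p then E0 s q f else 0)) := by
  have := LinearMap.congr_fun (E0_comm (k := k) p q s t) f
  rw [Ring.lie_def, LinearMap.sub_apply, LinearMap.sub_apply, sub_eq_iff_eq_add'] at this
  refine this.trans (congrArg₂ _ rfl ?_)
  split_ifs <;> rfl

theorem E0_mem_semi {i₀ : ι} {s : ℤ} {f : R0 ι κ k} (hf : f ∈ semi κ k i₀ s) :
    E0 (.inl i₀) (.inl i₀) f ∈ semi κ k i₀ s := by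
  refine ⟨fun e a => ?_, fun i j => ?_⟩
  · rw [E0_E0, hf.1, if_neg (c := Sum.inr a = Sum.inl i₀) (by simp), zero_sub]
    have : E0 (.inl i₀) (.inr a) f = 0 := by rw [hf.1, if_neg (by simp)]
    rw [this]
    split_ifs <;> simp
  · rw [E0_E0, hf.2 i j, hf.2 i i₀, hf.2 i₀ j]
    by_cases h : i = j
    · subst h; simp [eq_comm]
    · rw [if_neg h, if_neg h, map_zero, zero_add]
      by_cases h1 : i = i₀
      · subst h1; simp [h, Ne.symm h]
      · simp [h1, Ne.symm h1]

theorem mem_detMul_of_isHW [CharZero k] [Nonempty ι] [Nonempty κ] {t : ℤ} {s : ℕ} {h : R0 ι κ k}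
    (hh : IsHW t s h) : h ∈ detMul ι κ k s := by
  rcases le_or_gt (s : ℤ) t with hts | hts
  · obtain ⟨e, rfl⟩ : ∃ e : ℕ, t = s + e := ⟨(t - s).toNat, by omega⟩
    have hu := (isHW_det0 (ι := ι) (κ := κ) (k := k).pow s).mul (isHW_pl.pow e)
    rw [mul_one, mul_one, mul_zero, add_zero] at hu
    obtain ⟨c, rfl⟩ := hh.eq_C_mul hu (mul_ne_zero (pow_ne_zero _ det0_ne_zero)
      (pow_ne_zero _ pl_inl_ne_zero))
    refine ⟨C c * pl (Sum.inl : ι → ι ⊕ κ) ^ e, Subalgebra.mul_mem _ (Subalgebra.algebraMap_mem _ c)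
      (Subalgebra.pow_mem (plAlg ι κ k) (Algebra.subset_adjoin (Set.mem_range_self _)) e), ?_⟩
    rw [LinearMap.mulLeft_apply]; ring
  · obtain ⟨e, he⟩ : ∃ e : ℕ, (s : ℤ) = (e + 1 : ℕ) + t := ⟨(s - t - 1).toNat, by push_cast; omega⟩
    have hu := isHW_det0 (ι := ι) (κ := κ) (k := k).pow s
    have hv := (isHW_pl.pow (e + 1)).mul hh
    rw [mul_one, ← he, mul_zero, zero_add] at hv
    rw [mul_one] at hu
    obtain ⟨c, hc⟩ := hv.eq_C_mul hu (pow_ne_zero _ det0_ne_zero)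
    obtain ⟨i⟩ := ‹Nonempty ι›
    obtain ⟨a⟩ := ‹Nonempty κ›
    let v : Matrix (ι ⊕ κ) (ι ⊕ κ) k := (Equiv.swap (Sum.inl i) (Sum.inr a)).permMatrix k
    have hp := eval_mnr v (Sum.inl : ι → ι ⊕ κ) Sum.inl
    have hd := eval_mnr v id id
    have hp0 : mnr v (Sum.inl : ι → ι ⊕ κ) Sum.inl = 0 := by
      refine Matrix.det_eq_zero_of_row_eq_zero i fun j => ?_
      simp [v, Equiv.Perm.permMatrix, PEquiv.toMatrix_apply, Equiv.swap_apply_left]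
    have hd0 : mnr v id id ≠ 0 := by
      have : mnr v id id = v.det := rfl
      rw [this, Matrix.det_permutation]
      simp
    rw [hp0] at hp
    have := congrArg (eval fun p : (ι ⊕ κ) × (ι ⊕ κ) => v p.1 p.2) hc
    rw [map_mul, map_pow, pl, hp, map_mul, map_pow, det0, hd, zero_pow (Nat.succ_ne_zero _), zero_mul,
      eval_C] at this
    have hc0 : c = 0 := (mul_eq_zero.1 this.symm).resolve_right (pow_ne_zero _ hd0)
    rw [hc0, map_zero, zero_mul] at hc
    rw [(mul_eq_zero.1 hc).resolve_left (pow_ne_zero _ pl_inl_ne_zero)]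
    exact Submodule.zero_mem _

/-- First fundamental theorem of invariant theory. -/
theorem semi_le_detMul [CharZero k] [Nonempty κ] (i₀ : ι) (s : ℕ) : semi κ k i₀ s ≤ detMul ι κ k s := by
  have : Nonempty ι := ⟨i₀⟩
  let w : (ι ⊕ κ) × (ι ⊕ κ) → ℕ := fun p => Sum.elim (fun _ => 0) (fun _ => 1) p.1
  have key : ∀ g, ∀ f ∈ semi κ k i₀ s, f ∈ restrictSupport k {m | Finsupp.weight w m < g} →
      f ∈ detMul ι κ k s := by
    intro g
    induction g with
    | zero =>
      intro f _ hf
      have : f = 0 := by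
        rw [← MvPolynomial.support_eq_empty, Finset.eq_empty_iff_forall_notMem]
        exact fun m hm => Nat.not_lt_zero _ (hf hm)
      rw [this]; exact Submodule.zero_mem _
    | succ g ih =>
      intro f hf hfg
      let N : Submodule k (R0 ι κ k) := (semi κ k i₀ s ⊓ restrictSupport k {m | Finsupp.weight w m < g + 1}) ⊓
        restrictTotalDegree _ k f.totalDegree
      have : FiniteDimensional k N := Submodule.finiteDimensional_inf_right _ _
      let T : Module.End k (R0 ι κ k) := ∑ i : ι, ∑ a : κ,
        (Rw (.inr a) (.inl i)).toLinearMap ∘ₗ (Rw (.inl i) (.inr a)).toLinearMap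
      have hT : ∀ x, T x = ∑ i : ι, ∑ a : κ, Rw (.inr a) (.inl i) (Rw (.inl i) (.inr a) x) := fun x => by
        simp only [T, LinearMap.sum_apply]; rfl
      have hlow : ∀ i a, ∀ x ∈ restrictSupport k {m | Finsupp.weight w m < g + 1},
          Rw (.inl i) (.inr a) x ∈ restrictSupport k {m | Finsupp.weight w m < g} := fun i a x hx => by
        rw [Rw_apply]
        exact Submodule.sum_mem _ fun c _ => xd_mem_weight w (by simp [w]) hx
      have hup : ∀ i a, ∀ x ∈ restrictSupport k {m | Finsupp.weight w m < g},
          Rw (.inr a) (.inl i) x ∈ restrictSupport k {m | Finsupp.weight w m < g + 1} := fun i a x hx => by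
        rw [Rw_apply]
        exact Submodule.sum_mem _ fun c _ => xd_mem_weight w (by simp [w]) hx
      obtain ⟨h, hh, y, hy, hTh, rfl⟩ := fitting (N := N) T (fun x hx => by
          rw [hT]
          refine Submodule.sum_mem _ fun i _ => Submodule.sum_mem _ fun a _ => ⟨⟨?_, ?_⟩, ?_⟩
          · exact Rw_mem_semi _ _ (Rw_mem_semi _ _ hx.1.1)
          · exact hup _ _ _ (hlow _ _ _ hx.1.2)
          · exact Rw_mem _ _ (Rw_mem _ _ hx.2)) (fun x y => by
          rw [hT, hT, form_sum_left, form_sum_right]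
          refine Finset.sum_congr rfl fun i _ => ?_
          rw [form_sum_left, form_sum_right]
          exact Finset.sum_congr rfl fun a _ => by rw [Rw_adj, Rw_adj])
          (x := f) ⟨⟨hf, hfg⟩, (mem_restrictTotalDegree _ _ _).2 le_rfl⟩
      refine Submodule.add_mem _ ?_ ?_
      · have hrow : ∀ i a, Rw (.inl i) (.inr a) h = 0 := by
          have h0 : ⟪T h, h⟫ = 0 := by rw [hTh, map_zero]; rfl
          rw [hT, form_sum_left] at h0
          simp only [form_sum_left, Rw_adj (Sum.inr _)] at h0
          intro i a
          have h1 := (Finset.sum_eq_zero_iff_of_nonneg fun i _ =>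
            Finset.sum_nonneg fun a _ => PosForm.nonneg _).1 h0 i (Finset.mem_univ i)
          exact PosForm.eq_zero _ ((Finset.sum_eq_zero_iff_of_nonneg fun a _ => PosForm.nonneg _).1 h1 a
            (Finset.mem_univ a))
        let N' : Submodule k (R0 ι κ k) := semi κ k i₀ s ⊓
          ⨅ i : ι, ⨅ a : κ, LinearMap.ker (Rw (.inl i) (.inr a)).toLinearMap
        have hN' : ∀ x, x ∈ N' ↔ x ∈ semi κ k i₀ s ∧ ∀ i a, Rw (.inl i) (.inr a) x = 0 := fun x => by
          simp [N', Submodule.mem_iInf]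
        refine mem_of_eigenvectors (e0 (.inl i₀) (.inl i₀)) N' _ (fun x hx => ?_) (fun t x hx ht => ?_)
          ((hN' h).2 ⟨hh.1.1, hrow⟩) ?_
        · rw [hN'] at hx ⊢
          refine ⟨E0_mem_semi hx.1, fun i a => ?_⟩
          change Rw _ _ (E0 _ _ x) = 0
          rw [← E0_Rw, hx.2, map_zero]
        · rw [hN'] at hx
          refine mem_detMul_of_isHW (t := t) ⟨hx.1.1, fun i j => ?_, hx.2⟩
          rw [hx.1.2]
          exact if_congr Iff.rfl ht rfl
        · rw [h.as_sum]
          exact Submodule.sum_mem _ fun m _ => Submodule.subset_span ⟨_, E0_monomial _ _ _⟩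
      · rw [hT]
        exact Submodule.sum_mem _ fun i _ => Submodule.sum_mem _ fun a _ => Rw_mem_detMul _ _
          (ih _ (Rw_mem_semi _ _ hy.1.1) (hlow _ _ _ hy.1.2))
  intro f hf
  exact key (f.support.sup (fun m => Finsupp.weight w m) + 1) f hf fun m hm =>
    Nat.lt_succ_of_le (Finset.le_sup (f := fun m => Finsupp.weight w m) hm)

end fft

section con
variable {B C ν : Type} [CommRing B] [Fintype C] [DecidableEq C] [Fintype ν] [DecidableEq ν]

/-- The action of a matrix on tensors. -/
def con (y : Matrix C C B) (Φ : (ν → C) → B) (J : ν → C) : B := ∑ f : ν → C, (∏ i, y (J i) (f i)) * Φ f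

omit [DecidableEq C] in
theorem con_add (y : Matrix C C B) (Φ Ψ : (ν → C) → B) (J) :
    con y (fun f => Φ f + Ψ f) J = con y Φ J + con y Ψ J := by
  simp only [con, mul_add, Finset.sum_add_distrib]

omit [DecidableEq C] in
theorem con_mul (y : Matrix C C B) (b : B) (Φ : (ν → C) → B) (J) :
    con y (fun f => b * Φ f) J = b * con y Φ J := by
  simp only [con, Finset.mul_sum]
  exact Finset.sum_congr rfl fun _ _ => by ring

omit [DecidableEq C] in
theorem con_sum (y : Matrix C C B) {T : Type} (s : Finset T) (Φ : T → (ν → C) → B) (J) :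
    con y (fun f => ∑ t ∈ s, Φ t f) J = ∑ t ∈ s, con y (Φ t) J := by
  simp only [con, Finset.mul_sum]
  exact Finset.sum_comm

omit [DecidableEq C] in
theorem con_mnr (y x : Matrix C C B) (g : ν → C) (J) :
    con y (fun f => mnr x f g) J = mnr (y * x) J g := by
  let M : MultilinearMap B (fun _ : ν => ν → B) B := (Matrix.detRowAlternating (R := B) (n := ν)).toMultilinearMap
  have h : M (fun i => ∑ c, y (J i) c • fun j => x c (g j)) =
      ∑ f : ν → C, M fun i => y (J i) (f i) • fun j => x (f i) (g j) :=
    M.map_sum (α := fun _ => C) fun i c => y (J i) c • fun j => x c (g j)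
  have h' : con y (fun f => mnr x f g) J = M fun i => ∑ c, y (J i) c • fun j => x c (g j) := by
    rw [h, con]
    refine Finset.sum_congr rfl fun f _ => ?_
    exact (M.map_smul_univ (fun i => y (J i) (f i)) fun i j => x (f i) (g j)).symm
  rw [h']
  refine congrArg Matrix.det (Matrix.ext fun i j => ?_)
  rw [Finset.sum_apply]
  rfl

omit [DecidableEq C] in
theorem con_con (y x : Matrix C C B) (Φ : (ν → C) → B) (J) : con y (con x Φ) J = con (y * x) Φ J := by
  simp only [con, Finset.mul_sum]
  rw [Finset.sum_comm]
  refine Finset.sum_congr rfl fun f _ => ?_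
  have : ∏ i, (y * x) (J i) (f i) = ∑ g : ν → C, ∏ i, y (J i) (g i) * x (g i) (f i) :=
    Fintype.prod_sum (fun i c => y (J i) c * x c (f i))
  rw [this, Finset.sum_mul]
  refine Finset.sum_congr rfl fun g _ => ?_
  rw [Finset.prod_mul_distrib, mul_assoc]

theorem con_one (Φ : (ν → C) → B) (J) : con (1 : Matrix C C B) Φ J = Φ J := by
  rw [con, Finset.sum_eq_single J]
  · simp
  · intro f _ hf
    obtain ⟨i, hi⟩ := Function.ne_iff.1 hf
    have h0 : ∏ i, (1 : Matrix C C B) (J i) (f i) = 0 :=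
      Finset.prod_eq_zero (Finset.mem_univ i) (Matrix.one_apply_ne hi.symm)
    rw [h0, zero_mul]
  · simp

omit [DecidableEq C] in
theorem con_perm (y : Matrix C C B) (σ : Equiv.Perm ν) (Φ : (ν → C) → B) (J) :
    con y (fun f => Φ (f ∘ σ)) J = con y Φ (J ∘ σ) := by
  refine Fintype.sum_equiv (Equiv.arrowCongr σ.symm (Equiv.refl C)) _ _ fun f => ?_
  refine congrArg₂ _ ?_ rfl
  exact (Fintype.prod_equiv σ _ _ fun i => rfl).symm

omit [DecidableEq C] in
theorem con_prod (y : Matrix C C B) (Φ Ψ : (ν → C) → B) (J : ν ⊕ ν → C) :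
    con y (fun f => Φ (f ∘ Sum.inl) * Ψ (f ∘ Sum.inr)) J =
      con y Φ (J ∘ Sum.inl) * con y Ψ (J ∘ Sum.inr) := by
  simp only [con]
  rw [Finset.sum_mul_sum, ← Finset.sum_product', Finset.univ_product_univ]
  refine Fintype.sum_equiv (Equiv.sumArrowEquivProdArrow ν ν C) _ _ fun f => ?_
  rw [Fintype.prod_sum_type]
  change _ = (∏ i, y (J (Sum.inl i)) (f (Sum.inl i))) * Φ (f ∘ Sum.inl) *
    ((∏ i, y (J (Sum.inr i)) (f (Sum.inr i))) * Ψ (f ∘ Sum.inr))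
  ring

omit [Fintype C] [DecidableEq C] in
theorem mnr_perm (x : Matrix C C B) (f g : ν → C) (σ : Equiv.Perm ν) :
    mnr x (f ∘ σ) g = (Equiv.Perm.sign σ : ℤ) * mnr x f g :=
  Matrix.det_permute σ (Matrix.of fun i j => x (f i) (g j))

omit [Fintype C] [DecidableEq C] in
/-- The exchange relation between minors. -/
theorem mnr_exchange (x : Matrix C C B) (g : ν → C) (H : ν ⊕ ν → C) (s : ν) :
    mnr x (H ∘ Sum.inl) g * mnr x (H ∘ Sum.inr) g =
      ∑ t, mnr x ((H ∘ Equiv.swap (Sum.inl t) (Sum.inr s)) ∘ Sum.inl) g *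
        mnr x ((H ∘ Equiv.swap (Sum.inl t) (Sum.inr s)) ∘ Sum.inr) g := by
  let M : Matrix ν ν B := Matrix.of fun i j => x (H (.inl i)) (g j)
  let N : Matrix ν ν B := Matrix.of fun i j => x (H (.inr i)) (g j)
  have h1 : ∀ t, mnr x ((H ∘ Equiv.swap (Sum.inl t) (Sum.inr s)) ∘ Sum.inl) g =
      Matrix.cramer M.transpose (N s) t := fun t => by
    rw [Matrix.cramer_transpose_apply]
    refine congrArg Matrix.det (Matrix.ext fun i j => ?_)
    rw [Matrix.updateRow_apply]
    by_cases hi : i = t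
    · subst hi; simp [N]
    · simp [M, hi, Equiv.swap_apply_of_ne_of_ne]
  have h2 : ∀ t, mnr x ((H ∘ Equiv.swap (Sum.inl t) (Sum.inr s)) ∘ Sum.inr) g =
      (N.updateRow s (M t)).det := fun t => by
    refine congrArg Matrix.det (Matrix.ext fun i j => ?_)
    rw [Matrix.updateRow_apply]
    by_cases hi : i = s
    · subst hi; simp [M]
    · simp [N, hi, Equiv.swap_apply_of_ne_of_ne]
  have h3 : M.det • N s = ∑ t, Matrix.cramer M.transpose (N s) t • M t := by
    have := Matrix.mulVec_cramer M.transpose (N s)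
    rw [Matrix.det_transpose] at this
    rw [← this]
    funext j
    rw [Finset.sum_apply]
    exact Finset.sum_congr rfl fun t _ => mul_comm _ _
  have h4 : (N.updateRow s (M.det • N s)).det = M.det * N.det := by
    rw [Matrix.det_updateRow_smul, Matrix.updateRow_eq_self]
  have h5 : (N.updateRow s (∑ t, Matrix.cramer M.transpose (N s) t • M t)).det =
      ∑ t, Matrix.cramer M.transpose (N s) t * (N.updateRow s (M t)).det := by
    refine ((Matrix.detRowAlternating (R := B) (n := ν)).toMultilinearMap.map_update_sum
      Finset.univ s _ N).trans (Finset.sum_congr rfl fun t _ => ?_)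
    exact Matrix.det_updateRow_smul _ _ _ _
  simp only [h1, h2]
  rw [← h5, ← h3, h4]
  rfl

end con

section relations
variable {ι κ B : Type} [CommRing B] [Fintype ι] [Fintype κ] [DecidableEq ι] [DecidableEq κ]

/-- The index family `inl` with `inl i` replaced by `inr a`. -/
def tw (t : ι × κ) : ι → ι ⊕ κ := Function.update Sum.inl t.1 (Sum.inr t.2)

omit [Fintype κ] in
theorem mnr_one_inl : mnr (1 : Matrix (ι ⊕ κ) (ι ⊕ κ) B) Sum.inl (Sum.inl : ι → ι ⊕ κ) = 1 := by
  rw [mnr, ← Matrix.det_one (n := ι)]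
  exact congrArg Matrix.det (Matrix.ext fun i j => by simp [Matrix.one_apply])

omit [Fintype κ] in
theorem mnr_one_of_inr {J : ι → ι ⊕ κ} {s : ι} {a : κ} (h : J s = Sum.inr a) :
    mnr (1 : Matrix (ι ⊕ κ) (ι ⊕ κ) B) J (Sum.inl : ι → ι ⊕ κ) = 0 :=
  Matrix.det_eq_zero_of_row_eq_zero s fun j => by simp [Matrix.one_apply, h]

omit [Fintype κ] in
theorem mnr_one_inl_tw (t : ι × κ) : mnr (1 : Matrix (ι ⊕ κ) (ι ⊕ κ) B) Sum.inl (tw t) = 0 :=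
  Matrix.det_eq_zero_of_column_eq_zero t.1 fun j => by simp [Matrix.one_apply, tw]

omit [Fintype κ] in
theorem mnr_one_tw_tw (t u : ι × κ) : mnr (1 : Matrix (ι ⊕ κ) (ι ⊕ κ) B) (tw t) (tw u) = if t = u then 1 else 0 := by
  obtain ⟨i, a⟩ := t
  obtain ⟨j, b⟩ := u
  by_cases hi : i = j
  · subst hi
    by_cases ha : a = b
    · subst ha
      rw [if_pos rfl, mnr, ← Matrix.det_one (n := ι)]
      refine congrArg Matrix.det (Matrix.ext fun l m => ?_)
      by_cases hl : l = i <;> by_cases hm : m = i <;> simp_all [Matrix.one_apply, tw, eq_comm]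
    · rw [if_neg (by simp [ha])]
      refine Matrix.det_eq_zero_of_row_eq_zero i fun m => ?_
      by_cases hm : m = i <;> simp [Matrix.one_apply, tw, hm, ha]
  · rw [if_neg (by simp [hi])]
    refine Matrix.det_eq_zero_of_row_eq_zero j fun m => ?_
    by_cases hm : m = j <;> simp_all [Matrix.one_apply, tw, eq_comm]

/-- A solution of the linearized Plücker relations is determined by its affine coordinates. -/
theorem eq_zero_of_linearized (h2 : ∀ z : B, z + z = 0 → z = 0) {x y : Matrix (ι ⊕ κ) (ι ⊕ κ) B}
    (hxy : x * y = 1) (hyx : y * x = 1) {v : (ι → ι ⊕ κ) → B}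
    (hv : ∀ (H : ι ⊕ ι → ι ⊕ κ) (s : ι),
      v (H ∘ Sum.inl) * mnr x (H ∘ Sum.inr) Sum.inl + mnr x (H ∘ Sum.inl) Sum.inl * v (H ∘ Sum.inr) =
      ∑ t, (v ((H ∘ Equiv.swap (Sum.inl t) (Sum.inr s)) ∘ Sum.inl) *
        mnr x ((H ∘ Equiv.swap (Sum.inl t) (Sum.inr s)) ∘ Sum.inr) Sum.inl +
        mnr x ((H ∘ Equiv.swap (Sum.inl t) (Sum.inr s)) ∘ Sum.inl) Sum.inl *
        v ((H ∘ Equiv.swap (Sum.inl t) (Sum.inr s)) ∘ Sum.inr)))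
    (hperm : ∀ f (σ : Equiv.Perm ι), v (f ∘ σ) = (Equiv.Perm.sign σ : ℤ) * v f)
    (h0 : con y v Sum.inl = 0) (h1 : ∀ t, con y v (tw t) = 0) (f : ι → ι ⊕ κ) : v f = 0 := by
  let w := con y v
  have hw : ∀ (H : ι ⊕ ι → ι ⊕ κ) (s : ι),
      w (H ∘ Sum.inl) * mnr 1 (H ∘ Sum.inr) Sum.inl + mnr 1 (H ∘ Sum.inl) Sum.inl * w (H ∘ Sum.inr) =
      ∑ t, (w ((H ∘ Equiv.swap (Sum.inl t) (Sum.inr s)) ∘ Sum.inl) *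
        mnr 1 ((H ∘ Equiv.swap (Sum.inl t) (Sum.inr s)) ∘ Sum.inr) Sum.inl +
        mnr 1 ((H ∘ Equiv.swap (Sum.inl t) (Sum.inr s)) ∘ Sum.inl) Sum.inl *
        w ((H ∘ Equiv.swap (Sum.inl t) (Sum.inr s)) ∘ Sum.inr)) := fun H s => by
    have key : ∀ H : ι ⊕ ι → ι ⊕ κ, con y (fun H => v (H ∘ Sum.inl) * mnr x (H ∘ Sum.inr) Sum.inl +
        mnr x (H ∘ Sum.inl) Sum.inl * v (H ∘ Sum.inr)) H = w (H ∘ Sum.inl) * mnr 1 (H ∘ Sum.inr) Sum.inl +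
        mnr 1 (H ∘ Sum.inl) Sum.inl * w (H ∘ Sum.inr) := fun H => by
      rw [con_add, con_prod y v fun f => mnr x f Sum.inl, con_prod y (fun f => mnr x f Sum.inl) v,
        con_mnr, con_mnr, hyx]
    rw [← key, funext fun H => hv H s, con_sum]
    refine Finset.sum_congr rfl fun t _ => ?_
    rw [con_perm y (Equiv.swap (Sum.inl t) (Sum.inr s)) (fun H => v (H ∘ Sum.inl) * mnr x (H ∘ Sum.inr) Sum.inl +
        mnr x (H ∘ Sum.inl) Sum.inl * v (H ∘ Sum.inr)), key]
  have hwp : ∀ f (σ : Equiv.Perm ι), w (f ∘ σ) = (Equiv.Perm.sign σ : ℤ) * w f := fun f σ => by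
    change con y v (f ∘ σ) = _ * con y v f
    rw [← con_perm y σ v, funext fun f => hperm f σ, con_mul]
  have hw0 : ∀ J, w J = 0 := fun J => by
    by_cases hJ : ∃ s a, J s = Sum.inr a
    · obtain ⟨s, a, hs⟩ := hJ
      have := hw (Sum.elim Sum.inl J) s
      rw [Sum.elim_comp_inl, Sum.elim_comp_inr, mnr_one_of_inr hs, mnr_one_inl, mul_zero, zero_add,
        one_mul] at this
      rw [this]
      refine Finset.sum_eq_zero fun t _ => ?_
      have e : (Sum.elim Sum.inl J ∘ Equiv.swap (Sum.inl t) (Sum.inr s)) ∘ Sum.inl = tw (t, a) := by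
        funext i
        by_cases hi : i = t
        · subst hi; simp [tw, hs]
        · simp [tw, hi, Equiv.swap_apply_of_ne_of_ne]
      rw [e, mnr_one_of_inr (J := tw (t, a)) (s := t) (a := a) (by simp [tw])]
      change con y v _ * _ + _ = 0
      rw [h1]; ring
    · push Not at hJ
      have : ∃ φ : ι → ι, J = Sum.inl ∘ φ := by
        choose φ hφ using fun s => show ∃ i, J s = Sum.inl i from by
          rcases h : J s with i | a
          · exact ⟨i, rfl⟩
          · exact (hJ s a h).elim
        exact ⟨φ, funext hφ⟩
      obtain ⟨φ, rfl⟩ := this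
      by_cases hφ : φ.Injective
      · have := hwp Sum.inl (Equiv.ofBijective φ (Finite.injective_iff_bijective.1 hφ))
        change w (Sum.inl ∘ φ) = _ at this
        rw [this]
        change _ * con y v _ = 0
        rw [h0, mul_zero]
      · simp only [Function.Injective, not_forall] at hφ
        obtain ⟨i, j, hij, hne⟩ := hφ
        have := hwp (Sum.inl ∘ φ) (Equiv.swap i j)
        have e : (Sum.inl ∘ φ : ι → ι ⊕ κ) ∘ Equiv.swap i j = Sum.inl ∘ φ := by
          funext l
          simp only [Function.comp_apply, Sum.inl.injEq]
          by_cases hl : l = i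
          · subst hl; simp [hij]
          · by_cases hl' : l = j
            · subst hl'; simp [hij]
            · rw [Equiv.swap_apply_of_ne_of_ne hl hl']
        rw [e, Equiv.Perm.sign_swap hne] at this
        refine h2 _ ?_
        linear_combination this + (by push_cast; ring : ((-1 : ℤˣ) : ℤ) * w (Sum.inl ∘ φ) = - w (Sum.inl ∘ φ))
  rw [← con_one v f, ← hxy, ← con_con]
  exact Finset.sum_eq_zero fun J _ => by rw [← mul_zero (∏ i, x (f i) (J i)), ← hw0 J]

end relations

section ext
variable {k R B : Type} [CommRing k] [CommRing R] [CommRing B] [Algebra k R] [Algebra R B] [Algebra k B]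
  [IsScalarTower k R B]

open KaehlerDifferential in
/-- The extension of a derivation along a formally étale algebra. -/
def extDer [Algebra.FormallyEtale R B] (D : Derivation k R R) : Derivation k B B :=
  (LinearMap.liftBaseChange B ((Algebra.linearMap R B) ∘ₗ D.liftKaehlerDifferential) ∘ₗ
    (tensorKaehlerEquivOfFormallyEtale k R B).symm.toLinearMap).compDer (KaehlerDifferential.D k B)

theorem extDer_algebraMap [Algebra.FormallyEtale R B] (D : Derivation k R R) (x : R) :
    extDer D (algebraMap R B x) = algebraMap R B (D x) := by
  simp [extDer, KaehlerDifferential.tensorKaehlerEquivOfFormallyEtale_symm_D_algebraMap]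

omit [Algebra k R] [IsScalarTower k R B] in
theorem der_ext_of_isLocalization (M : Submonoid R) [IsLocalization M B] {D D' : Derivation k B B}
    (h : ∀ x : R, D (algebraMap R B x) = D' (algebraMap R B x)) : D = D' := by
  ext b
  obtain ⟨⟨r, s⟩, hs⟩ := IsLocalization.surj M b
  have hu := IsLocalization.map_units B s
  have h1 := congrArg D hs
  have h2 := congrArg D' hs
  simp only [Derivation.leibniz, smul_eq_mul] at h1 h2
  rw [← hu.mul_right_inj]
  rw [h, h] at h1
  linear_combination h1 - h2
end ext

section local_ring
variable {ι κ k : Type} [Field k] [Fintype ι] [Fintype κ] [DecidableEq ι] [DecidableEq κ]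

variable (ι κ k) in
/-- The coordinate ring of the general linear group. -/
abbrev B0 := Localization.Away (det0 ι κ k)

instance : Algebra.FormallyEtale (R0 ι κ k) (B0 ι κ k) :=
  Algebra.FormallyEtale.of_isLocalization (Submonoid.powers (det0 ι κ k))

/-- The extension of the derivation `E0` to the localization. -/
def EB (c d : ι ⊕ κ) : Derivation k (B0 ι κ k) (B0 ι κ k) := extDer (E0 c d)

theorem EB_algebraMap (c d : ι ⊕ κ) (f : R0 ι κ k) :
    EB c d (algebraMap _ (B0 ι κ k) f) = algebraMap _ _ (E0 c d f) := extDer_algebraMap _ _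

def eB (c d : ι ⊕ κ) : Module.End k (B0 ι κ k) := (EB c d).toLinearMap

theorem EB_comm (p q s t : ι ⊕ κ) (b : B0 ι κ k) : EB p q (EB s t b) - EB s t (EB p q b) =
    (if q = s then EB p t b else 0) - (if t = p then EB s q b else 0) := by
  have key : ⁅EB (k := k) p q, EB s t⁆ = (if q = s then EB p t else 0) - (if t = p then EB s q else (0 : Derivation k (B0 ι κ k) _)) := by
    refine der_ext_of_isLocalization (Submonoid.powers (det0 ι κ k)) fun x => ?_
    have := congrArg (algebraMap _ (B0 ι κ k)) (E0_E0 p q s t x)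
    rw [Derivation.commutator_apply, Derivation.sub_apply, sub_eq_iff_eq_add']
    simp only [map_add, map_sub, apply_ite (algebraMap (R0 ι κ k) (B0 ι κ k)), ← EB_algebraMap, map_zero] at this
    split_ifs at this ⊢ <;> simpa using this
  have := congrArg (fun D => D b) key
  simp only [Derivation.commutator_apply, Derivation.sub_apply] at this
  split_ifs at this ⊢ <;> simpa using this

theorem eB_comm (p q s t : ι ⊕ κ) : ⁅eB (k := k) p q, eB s t⁆ =
    (if q = s then eB (k := k) p t else 0) - (if t = p then eB s q else 0) := by
  ext1 b
  have := EB_comm p q s t b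
  rw [LieRing.of_associative_ring_bracket]
  change EB p q (EB s t b) - EB s t (EB p q b) = _
  rw [this]
  split_ifs <;> rfl

variable (ι κ k) in
/-- The generic invertible matrix. -/
def xB : Matrix (ι ⊕ κ) (ι ⊕ κ) (B0 ι κ k) := (x0 ι κ k).map (algebraMap _ _)

theorem det_xB : (xB ι κ k).det = algebraMap _ _ (det0 ι κ k) :=
  (RingHom.map_det _ _).symm

theorem isUnit_det_xB : IsUnit (xB ι κ k).det := by
  rw [det_xB]; exact IsLocalization.Away.algebraMap_isUnit _

variable (ι κ k) in
/-- The inverse of the generic invertible matrix. -/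
def yB : Matrix (ι ⊕ κ) (ι ⊕ κ) (B0 ι κ k) := (xB ι κ k)⁻¹

theorem xB_mul_yB : xB ι κ k * yB ι κ k = 1 := Matrix.mul_nonsing_inv _ isUnit_det_xB
theorem yB_mul_xB : yB ι κ k * xB ι κ k = 1 := Matrix.nonsing_inv_mul _ isUnit_det_xB

theorem EB_x (c d l e : ι ⊕ κ) : EB c d (xB ι κ k l e) = if e = d then xB ι κ k l c else 0 := by
  change EB c d (algebraMap _ _ (x0 ι κ k l e)) = if e = d then algebraMap _ _ (x0 ι κ k l c) else 0
  rw [EB_algebraMap, E0_x, apply_ite (algebraMap (R0 ι κ k) (B0 ι κ k)), map_zero]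

theorem EB_y (c d c' l : ι ⊕ κ) : EB c d (yB ι κ k c' l) = if c = c' then - yB ι κ k d l else 0 := by
  have h1 : ∀ c' m, ∑ l, EB c d (yB ι κ k c' l) * xB ι κ k l m =
      if m = d then -(if c = c' then 1 else 0) else 0 := fun c' m => by
    have h := congrArg (EB c d) (congrFun (congrFun (yB_mul_xB (ι := ι) (κ := κ) (k := k)) c') m)
    rw [Matrix.mul_apply, map_sum] at h
    simp only [Derivation.leibniz, EB_x, smul_eq_mul, Finset.sum_add_distrib] at h
    have h0 : EB c d ((1 : Matrix (ι ⊕ κ) (ι ⊕ κ) (B0 ι κ k)) c' m) = 0 := by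
      rw [Matrix.one_apply]; split_ifs <;> simp
    rw [h0] at h
    have h2 : (∑ l, yB ι κ k c' l * if m = d then xB ι κ k l c else 0) = if m = d then (if c = c' then 1 else 0) else 0 := by
      split_ifs with hm hc
      · subst hc
        have := congrFun (congrFun (yB_mul_xB (ι := ι) (κ := κ) (k := k)) c) c
        rw [Matrix.one_apply_eq] at this
        exact this
      · have := congrFun (congrFun (yB_mul_xB (ι := ι) (κ := κ) (k := k)) c') c
        rw [Matrix.one_apply_ne (Ne.symm hc)] at this
        exact this
      · simp
    rw [h2] at h
    have h3 : ∑ l, EB c d (yB ι κ k c' l) * xB ι κ k l m = ∑ l, xB ι κ k l m * EB c d (yB ι κ k c' l) :=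
      Finset.sum_congr rfl fun _ _ => mul_comm _ _
    rw [h3]
    split_ifs at h ⊢ <;> linear_combination h
  let N : Matrix (ι ⊕ κ) (ι ⊕ κ) (B0 ι κ k) := Matrix.of fun c' l => EB c d (yB ι κ k c' l)
  have h2 : N = N * xB ι κ k * yB ι κ k := by rw [mul_assoc, xB_mul_yB, mul_one]
  have h3 : N c' l = ∑ m, (N * xB ι κ k) c' m * yB ι κ k m l := by
    conv_lhs => rw [h2]
    rfl
  have h4 : ∀ m, (N * xB ι κ k) c' m = if m = d then -(if c = c' then 1 else 0) else 0 := h1 c'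
  simp only [h4, ite_mul, zero_mul, Finset.sum_ite_eq', Finset.mem_univ, if_true] at h3
  change N c' l = _
  rw [h3]
  split_ifs <;> simp

variable (ι κ k) in
abbrev SB := sys (ι := ι) (κ := κ) (eB (k := k)) eB_comm

theorem algebraMap_B0_injective : Function.Injective (algebraMap (R0 ι κ k) (B0 ι κ k)) :=
  IsLocalization.injective _ (powers_le_nonZeroDivisors_of_noZeroDivisors det0_ne_zero)

end local_ring

section twist
variable {ι κ k V V₂ : Type} [Fintype ι] [Fintype κ] [DecidableEq ι] [DecidableEq κ] [Field k]
  [AddCommGroup V] [Module k V] [AddCommGroup V₂] [Module k V₂]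

/-- Apply a linear map to all components. -/
def mapH (φ : V →ₗ[k] V₂) : H ι κ V →ₗ[k] H ι κ V₂ := LinearMap.compLeft (LinearMap.compLeft φ _) _

omit [Fintype ι] [Fintype κ] [DecidableEq ι] [DecidableEq κ] in
theorem mapH_apply (φ : V →ₗ[k] V₂) (h : H ι κ V) (p S) : mapH φ h p S = φ (h p S) := rfl

omit [Fintype ι] [Fintype κ] [DecidableEq ι] [DecidableEq κ] in
theorem mapH_injective {φ : V →ₗ[k] V₂} (hφ : Function.Injective φ) :
    Function.Injective (mapH (ι := ι) (κ := κ) φ) := fun h h' e => by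
  funext p S
  exact hφ (congrFun (congrFun e p) S)

variable {e : ι ⊕ κ → ι ⊕ κ → Module.End k V}
  {he : ∀ p q s t, ⁅e p q, e s t⁆ = (if q = s then e p t else 0) - (if t = p then e s q else 0)}
  {e' : ι ⊕ κ → ι ⊕ κ → Module.End k V₂}
  {he' : ∀ p q s t, ⁅e' p q, e' s t⁆ = (if q = s then e' p t else 0) - (if t = p then e' s q else 0)}

theorem c_mapH (φ : V →ₗ[k] V₂) (x) (h : H ι κ V) : (sys e' he').c x (mapH φ h) = mapH φ ((sys e he).c x h) := by
  funext p S
  change cr k x (mapH φ h p) S = φ (cr k x (h p) S)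
  rw [cr_apply, cr_apply]
  split_ifs <;> simp [mapH_apply]

theorem a_mapH (φ : V →ₗ[k] V₂) (x) (h : H ι κ V) : (sys e' he').a x (mapH φ h) = mapH φ ((sys e he).a x h) := by
  funext p S
  change an k x (mapH φ h p) S = φ (an k x (h p) S)
  rw [an_apply, an_apply]
  split_ifs <;> simp [mapH_apply]

theorem U_mapH (φ : V →ₗ[k] V₂) (p q) (h : H ι κ V) : (sys e' he').U p q (mapH φ h) = mapH φ ((sys e he).U p q h) := by
  funext r S
  change unit k V₂ p q (mapH φ h) r S = φ (unit k V p q h r S)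
  rw [unit_apply, unit_apply]
  split_ifs <;> simp [mapH_apply]

theorem Om_mapH (φ : V →ₗ[k] V₂) (x y) (h : H ι κ V) : (sys e' he').Om x y (mapH φ h) = mapH φ ((sys e he).Om x y h) := by
  simp only [Sys.Om, LinearMap.add_apply, Module.End.mul_apply, map_add]
  rw [a_mapH (he := he), c_mapH (he := he), U_mapH (he := he)]

theorem num_mapH (φ : V →ₗ[k] V₂) (h : H ι κ V) : (sys e' he').num (mapH φ h) = mapH φ ((sys e he).num h) := by
  simp only [Sys.num, LinearMap.sum_apply, Module.End.mul_apply, map_sum]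
  exact Finset.sum_congr rfl fun x _ => by rw [a_mapH (he := he), c_mapH (he := he)]

theorem D_mapH {φ : V →ₗ[k] V₂} (hφ : ∀ i a v, e' (.inl i) (.inr a) (φ v) = φ (e (.inl i) (.inr a) v)) (h : H ι κ V) :
    (sys e' he').D (mapH φ h) = mapH φ ((sys e he).D h) := by
  have hX : ∀ x, (sys e' he').X x (mapH φ h) = mapH φ ((sys e he).X x h) := fun x => by
    funext p S
    exact hφ _ _ _
  simp only [Sys.D, Sys.d, Sys.tau, LinearMap.add_apply, LinearMap.sum_apply, Module.End.mul_apply, map_sum, map_add]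
  refine congrArg₂ _ (Finset.sum_congr rfl fun x _ => ?_) (Finset.sum_congr rfl fun x _ => ?_)
  · rw [hX, c_mapH (he := he)]
  · rw [Sys.C, U_mapH (he := he), c_mapH (he := he)]
    rfl

theorem F_mapH {φ : V →ₗ[k] V₂} {ψ : V →ₗ[k] V₂} (hF : ∀ i j v, e' (.inl i) (.inl j) (φ v) =
      φ (e (.inl i) (.inl j) v) + if i = j then ψ v else 0) (h : H ι κ V) (i j) :
    (sys e' he').F i j (mapH φ h) = mapH φ ((sys e he).F i j h) + if i = j then mapH ψ h else 0 := by
  have hE : (sys e' he').E (.inl i) (.inl j) (mapH φ h) = mapH φ ((sys e he).E (.inl i) (.inl j) h) +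
      if i = j then mapH ψ h else 0 := by
    funext p S
    refine (hF i j _).trans ?_
    split_ifs <;> rfl
  simp only [Sys.F, LinearMap.sub_apply, LinearMap.sum_apply, map_sub, map_sum]
  rw [hE, Finset.sum_congr rfl fun a _ => Om_mapH (he := he) φ (j, a) (i, a) h]
  abel

theorem G_mapH {φ : V →ₗ[k] V₂} {s s' : ℤ} (hG : ∀ b a v, e' (.inr b) (.inr a) (φ v) =
      φ (e (.inr b) (.inr a) v) + if b = a then (s' - s) • φ v else 0) (h : H ι κ V) (b a) :
    (sys e' he').G b a (mapH φ h) = mapH φ ((sys e he).G b a h) + if b = a then (s' - s) • mapH φ h else 0 := by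
  have hE : (sys e' he').E (.inr b) (.inr a) (mapH φ h) = mapH φ ((sys e he).E (.inr b) (.inr a) h) +
      if b = a then (s' - s) • mapH φ h else 0 := by
    funext p S
    refine (hG b a _).trans ?_
    split_ifs <;> rfl
  simp only [Sys.G, LinearMap.add_apply, LinearMap.sum_apply, map_add, map_sum]
  rw [hE, Finset.sum_congr rfl fun l _ => Om_mapH (he := he) φ (l, b) (l, a) h]
  abel

theorem mapH_mem_Q {φ ψ : V →ₗ[k] V₂} {s s' : ℤ} (hF : ∀ i j v, e' (.inl i) (.inl j) (φ v) =
      φ (e (.inl i) (.inl j) v) + if i = j then ψ v else 0)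
    (hG : ∀ b a v, e' (.inr b) (.inr a) (φ v) =
      φ (e (.inr b) (.inr a) v) + if b = a then (s' - s) • φ v else 0) {h : H ι κ V} {i₀ : ι} {j : ℤ}
    (hh : h ∈ (sys e he).Q i₀ s j) : mapH φ h ∈ (sys e' he').Q i₀ s' j := by
  obtain ⟨h1, h2, h3⟩ := hh
  refine ⟨fun i l => ?_, fun b a => ?_, ?_⟩
  · rw [F_mapH (he := he) hF, F_mapH (he := he) hF, h1, if_pos rfl]
    split_ifs <;> simp
  · rw [G_mapH (he := he) hG, h2]
    split_ifs
    · rw [map_zsmul, ← add_smul]; congr 1; ring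
    · simp
  · rw [num_mapH (he := he), h3, map_zsmul]

theorem mem_Q_of_mapH {φ ψ : V →ₗ[k] V₂} (hφ : Function.Injective φ) {s s' : ℤ}
    (hF : ∀ i j v, e' (.inl i) (.inl j) (φ v) = φ (e (.inl i) (.inl j) v) + if i = j then ψ v else 0)
    (hG : ∀ b a v, e' (.inr b) (.inr a) (φ v) =
      φ (e (.inr b) (.inr a) v) + if b = a then (s' - s) • φ v else 0) {h : H ι κ V} {i₀ : ι} {j : ℤ}
    (hh : mapH φ h ∈ (sys e' he').Q i₀ s' j) : h ∈ (sys e he).Q i₀ s j := by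
  obtain ⟨h1, h2, h3⟩ := hh
  refine ⟨fun i l => mapH_injective hφ ?_, fun b a => mapH_injective hφ ?_, mapH_injective hφ ?_⟩
  · have := h1 i l
    rw [F_mapH (he := he) hF, F_mapH (he := he) hF, if_pos rfl] at this
    split_ifs at this ⊢
    · simpa using this
    · simpa using this
  · have := h2 b a
    rw [G_mapH (he := he) hG] at this
    split_ifs at this ⊢
    · rw [map_zsmul]
      rw [← eq_sub_iff_add_eq, ← sub_smul] at this
      rw [this]; congr 1; ring
    · simpa using this
  · rw [← num_mapH (he := he) (he' := he'), h3, map_zsmul]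

end twist

section exactness
variable {ι κ k : Type} [Field k] [Fintype ι] [Fintype κ] [DecidableEq ι] [DecidableEq κ]

variable (ι κ k) in
/-- The inverse determinant. -/
def uB : B0 ι κ k := IsLocalization.Away.invSelf (det0 ι κ k)

theorem det_mul_uB : algebraMap _ (B0 ι κ k) (det0 ι κ k) * uB ι κ k = 1 :=
  IsLocalization.Away.mul_invSelf _

theorem EB_uB_pow (c d : ι ⊕ κ) (N : ℕ) : EB c d (uB ι κ k ^ N) = if c = d then -((N : ℤ) • uB ι κ k ^ N) else 0 := by
  have h1 : EB c d (uB ι κ k) = if c = d then - uB ι κ k else 0 := by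
    have h := congrArg (EB c d) (det_mul_uB (ι := ι) (κ := κ) (k := k))
    rw [Derivation.leibniz, EB_algebraMap, E0_det, Derivation.map_one_eq_zero, smul_eq_mul, smul_eq_mul] at h
    have h' := congrArg (uB ι κ k * ·) h
    have h0 := det_mul_uB (ι := ι) (κ := κ) (k := k)
    split_ifs at h' ⊢
    · linear_combination h' - (uB ι κ k + EB c d (uB ι κ k)) * h0
    · simp only [map_zero] at h'
      linear_combination h' - (EB c d (uB ι κ k)) * h0
  induction N with
  | zero => simp
  | succ N ih =>
    rw [pow_succ, Derivation.leibniz, ih, h1]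
    split_ifs
    · simp only [smul_eq_mul, zsmul_eq_mul]; push_cast; ring
    · simp

/-- Multiplication by a power of the inverse determinant. -/
def scaleB (N : ℕ) : R0 ι κ k →ₗ[k] B0 ι κ k :=
  LinearMap.mulLeft k (uB ι κ k ^ N) ∘ₗ (IsScalarTower.toAlgHom k (R0 ι κ k) (B0 ι κ k)).toLinearMap

theorem scaleB_apply (N : ℕ) (f : R0 ι κ k) : scaleB N f = uB ι κ k ^ N * algebraMap _ _ f := rfl

theorem scaleB_injective (N : ℕ) : Function.Injective (scaleB (ι := ι) (κ := κ) (k := k) N) := fun f g h => by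
  rw [scaleB_apply, scaleB_apply] at h
  have h' := congrArg (algebraMap _ (B0 ι κ k) (det0 ι κ k) ^ N * ·) h
  simp only [← mul_assoc, ← mul_pow, det_mul_uB, one_pow, one_mul] at h'
  exact algebraMap_B0_injective h'

theorem EB_scaleB (c d : ι ⊕ κ) (N : ℕ) (f : R0 ι κ k) :
    EB c d (scaleB N f) = scaleB N (E0 c d f) + if c = d then -((N : ℤ) • scaleB N f) else 0 := by
  rw [scaleB_apply, Derivation.leibniz, EB_uB_pow, EB_algebraMap]
  split_ifs
  · simp only [scaleB_apply, smul_eq_mul, zsmul_eq_mul]; ring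
  · simp [scaleB_apply]

theorem exists_scaleB {T : Type} [Finite T] (b : T → B0 ι κ k) : ∃ (N : ℕ) (f : T → R0 ι κ k), ∀ t, b t = scaleB N (f t) := by
  obtain ⟨⟨_, N, rfl⟩, h⟩ := IsLocalization.exist_integer_multiples_of_finite (Submonoid.powers (det0 ι κ k)) b
  choose f hf using h
  refine ⟨N, f, fun t => ?_⟩
  rw [scaleB_apply, hf, Algebra.smul_def]
  simp only [map_pow]
  rw [← mul_assoc, ← mul_pow, mul_comm (uB ι κ k), det_mul_uB, one_pow, one_mul]

theorem SB_exact [CharZero k] [Nonempty κ] (i₀ : ι)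
    (h22 : ¬(Fintype.card ι = 2 ∧ Fintype.card κ = 2))
    {j : ℤ} (hj : 1 ≤ j) (hj' : j + 1 ≤ Fintype.card ι * Fintype.card κ) {x : H ι κ (B0 ι κ k)}
    (hx : x ∈ (SB ι κ k).Q i₀ 0 j) (hD : (SB ι κ k).D x = 0) :
    ∃ y ∈ (SB ι κ k).Q i₀ 0 (j - 1), (SB ι κ k).D y = x := by
  obtain ⟨N, f, hf⟩ := exists_scaleB fun t : Option (ι × κ) × Finset (ι × κ) => x t.1 t.2
  let φ := scaleB (ι := ι) (κ := κ) (k := k) N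
  obtain rfl : x = mapH φ fun p S => f (p, S) := funext fun p => funext fun S => hf (p, S)
  have hF : ∀ i l v, eB (k := k) (.inl i) (.inl l) (φ v) = φ (e0 (k := k) (.inl i : ι ⊕ κ) (.inl l) v) +
      if i = l then (-((N : ℤ) • φ)) v else 0 := fun i l v => by
    refine (EB_scaleB _ _ N v).trans ?_
    simp only [Sum.inl.injEq]
    rfl
  have hG : ∀ b a v, eB (k := k) (.inr b) (.inr a) (φ v) = φ (e0 (k := k) (.inr b : ι ⊕ κ) (.inr a) v) +
      if b = a then ((0 : ℤ) - N) • φ v else 0 := fun i l v => by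
    refine (EB_scaleB _ _ N v).trans ?_
    simp only [Sum.inr.injEq, zero_sub, neg_smul]
    rfl
  have hX : ∀ i a v, eB (k := k) (.inl i) (.inr a) (φ v) = φ (e0 (k := k) (.inl i : ι ⊕ κ) (.inr a) v) := fun i a v => by
    refine (EB_scaleB _ _ N v).trans ?_
    rw [if_neg Sum.inl_ne_inr, add_zero]
    rfl
  have hφ : Function.Injective φ := scaleB_injective N
  have hx' := mem_Q_of_mapH (he := E0_comm) hφ hF hG hx
  rw [D_mapH (he := E0_comm) hX] at hD
  obtain ⟨y, hy, hyD⟩ := S0_exact i₀ h22 hj hj' hx' (mapH_injective hφ (hD.trans (map_zero _).symm))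
  refine ⟨mapH φ y, mapH_mem_Q (he := E0_comm) hF hG hy, ?_⟩
  rw [D_mapH (he := E0_comm) hX]
  exact congrArg _ hyD

theorem mem_plAlg_of_invariant [CharZero k] [Nonempty κ] (i₀ : ι) {b : B0 ι κ k}
    (h1 : ∀ c a, EB c (.inr a) b = 0)
    (h2 : ∀ i j, EB (.inl i) (.inl j) b = if i = j then EB (.inl i₀) (.inl i₀) b else 0) :
    ∃ p ∈ plAlg ι κ k, algebraMap _ _ p = b := by
  obtain ⟨N, f, hf⟩ := exists_scaleB fun _ : Unit => b
  obtain rfl : b = scaleB N (f ()) := hf ()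
  generalize f () = f at h1 h2
  have hf : f ∈ semi κ k i₀ N := by
    refine ⟨fun c a => scaleB_injective N ?_, fun i j => scaleB_injective N ?_⟩
    · have := h1 c a
      rw [EB_scaleB] at this
      split_ifs at this ⊢
      · rw [map_zsmul]; exact add_neg_eq_zero.1 this
      · rwa [map_zero, ← add_zero (scaleB N _)]
    · have := h2 i j
      rw [EB_scaleB, EB_scaleB, if_pos rfl] at this
      by_cases hij : i = j
      · subst hij; simpa using this
      · simpa [hij] using this
  obtain ⟨p, hp, rfl⟩ := semi_le_detMul i₀ N hf
  refine ⟨p, hp, ?_⟩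
  rw [LinearMap.mulLeft_apply, scaleB_apply, map_mul, map_pow, ← mul_assoc, ← mul_pow,
    mul_comm (uB ι κ k), det_mul_uB, one_pow, one_mul]

end exactness

namespace Sys
variable {ι κ : Type} {L : Type} [Ring L] [Fintype ι] [Fintype κ] [DecidableEq ι] [DecidableEq κ]
  (S : Sys ι κ L)

theorem num_Om (x y) : ⁅S.num, S.Om x y⁆ = 0 := by
  rw [Om, br_add, lie_mul_right, num_c, num_a, num_U]; noncomm_ring

theorem num_F (i j) : ⁅S.num, S.F i j⁆ = 0 := by
  simp [F, br_sub, br_sum, num_E, num_Om]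

theorem num_G (b a) : ⁅S.num, S.G b a⁆ = 0 := by
  simp [G, br_add, br_sum, num_E, num_Om]

end Sys

section vacuum
variable {ι κ k V : Type} [Field k] [Fintype ι] [Fintype κ] [DecidableEq ι] [DecidableEq κ]
  [AddCommGroup V] [Module k V]
  (e : ι ⊕ κ → ι ⊕ κ → Module.End k V)
  (he : ∀ p q s t, ⁅e p q, e s t⁆ = (if q = s then e p t else 0) - (if t = p then e s q else 0))

theorem Om_none (h : H ι κ V) (x y) : (sys e he).Om x y h none ∅ = 0 := by
  have h1 : ((sys e he).c x ((sys e he).a y h)) none ∅ = 0 := by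
    change cr k x ((sys e he).a y h none) ∅ = 0
    rw [cr_apply, if_neg (Finset.notMem_empty _)]
  have h2 : ((sys e he).U (some x) (some y) h) none ∅ = 0 := rfl
  change ((sys e he).c x ((sys e he).a y h)) none ∅ + ((sys e he).U (some x) (some y) h) none ∅ = 0
  rw [h1, h2, add_zero]

theorem Om_some (h : H ι κ V) (x y t) : (sys e he).Om x y h (some t) ∅ = if t = x then h (some y) ∅ else 0 := by
  have h1 : ((sys e he).c x ((sys e he).a y h)) (some t) ∅ = 0 := by
    change cr k x ((sys e he).a y h (some t)) ∅ = 0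
    rw [cr_apply, if_neg (Finset.notMem_empty _)]
  have h2 : ((sys e he).U (some x) (some y) h) (some t) ∅ = if t = x then h (some y) ∅ else 0 := by
    change (if some t = some x then h (some y) else 0) ∅ = _
    simp only [Option.some.injEq]
    split_ifs <;> rfl
  change ((sys e he).c x ((sys e he).a y h)) (some t) ∅ + ((sys e he).U (some x) (some y) h) (some t) ∅ = _
  rw [h1, h2, zero_add]

theorem F_none (h : H ι κ V) (i j) : (sys e he).F i j h none ∅ = e (.inl i) (.inl j) (h none ∅) := by
  rw [Sys.F, LinearMap.sub_apply, LinearMap.sum_apply, Pi.sub_apply, Pi.sub_apply, Finset.sum_apply,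
    Finset.sum_apply, Finset.sum_eq_zero fun a _ => Om_none e he h _ _, sub_zero]
  rfl

theorem F_some (h : H ι κ V) (i j t) : (sys e he).F i j h (some t) ∅ =
    e (.inl i) (.inl j) (h (some t) ∅) - ∑ a, if t = (j, a) then h (some (i, a)) ∅ else 0 := by
  rw [Sys.F, LinearMap.sub_apply, LinearMap.sum_apply, Pi.sub_apply, Pi.sub_apply, Finset.sum_apply,
    Finset.sum_apply, Finset.sum_congr rfl fun a _ => Om_some e he h _ _ t]
  rfl

theorem G_none (h : H ι κ V) (b a) : (sys e he).G b a h none ∅ = e (.inr b) (.inr a) (h none ∅) := by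
  rw [Sys.G, LinearMap.add_apply, LinearMap.sum_apply, Pi.add_apply, Pi.add_apply, Finset.sum_apply,
    Finset.sum_apply, Finset.sum_eq_zero fun a _ => Om_none e he h _ _, add_zero]
  rfl

theorem G_some (h : H ι κ V) (b a t) : (sys e he).G b a h (some t) ∅ =
    e (.inr b) (.inr a) (h (some t) ∅) + ∑ l, if t = (l, b) then h (some (l, a)) ∅ else 0 := by
  rw [Sys.G, LinearMap.add_apply, LinearMap.sum_apply, Pi.add_apply, Pi.add_apply, Finset.sum_apply,
    Finset.sum_apply, Finset.sum_congr rfl fun a _ => Om_some e he h _ _ t]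
  rfl

theorem D_singleton (h : H ι κ V) (t p) : (sys e he).D h p {t} =
    sgn t {t} • (e (.inl t.1) (.inr t.2) (h p ∅) + if p = none then h (some t) ∅ else 0) := by
  have h1 : ∀ g : H ι κ V, ∀ u p, ((sys e he).c u g) p {t} = if u = t then sgn t {t} • g p ∅ else 0 := fun g u p => by
    refine (cr_apply k u (g p) {t}).trans ?_
    by_cases hu : u = t
    · subst hu; simp
    · simp [hu]
  have h2 : ∀ u, (sys e he).C u h p ∅ = if p = none then h (some u) ∅ else 0 := fun u => by
    change (if p = none then h (some u) else 0) ∅ = _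
    split_ifs <;> rfl
  rw [Sys.D, Sys.d, Sys.tau, LinearMap.add_apply, LinearMap.sum_apply, LinearMap.sum_apply,
    Pi.add_apply, Pi.add_apply, Finset.sum_apply, Finset.sum_apply, Finset.sum_apply, Finset.sum_apply]
  simp only [Module.End.mul_apply, h1, Finset.sum_ite_eq', Finset.mem_univ, if_true, h2]
  rw [smul_add]
  rfl

end vacuum

section num
variable {ι κ k V : Type} [Field k] [CharZero k] [Fintype ι] [Fintype κ] [DecidableEq ι] [DecidableEq κ]
  [AddCommGroup V] [Module k V]
  {e : ι ⊕ κ → ι ⊕ κ → Module.End k V}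
  {he : ∀ p q s t, ⁅e p q, e s t⁆ = (if q = s then e p t else 0) - (if t = p then e s q else 0)}

theorem apply_eq_zero_of_num {h : H ι κ V} {j : ℕ} (hh : (sys e he).num h = (j : ℤ) • h) (p) {S : Finset (ι × κ)}
    (hS : S.card ≠ j) : h p S = 0 := by
  have h1 := congrFun (congrFun hh p) S
  rw [sys_num_apply] at h1
  have h2 : ((S.card : ℤ) - j) • h p S = 0 := by
    rw [sub_smul, h1]; exact sub_self _
  rw [← Int.cast_smul_eq_zsmul k, smul_eq_zero] at h2
  refine h2.resolve_left ?_
  have h3 : (S.card : ℤ) - j ≠ 0 := sub_ne_zero.2 (by exact_mod_cast hS)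
  exact Int.cast_ne_zero.2 h3

omit [CharZero k] in
theorem num_eq_of_apply {h : H ι κ V} {j : ℕ} (hh : ∀ p (S : Finset (ι × κ)), S.card ≠ j → h p S = 0) :
    (sys e he).num h = (j : ℤ) • h := by
  funext p S
  rw [sys_num_apply]
  change _ = (j : ℤ) • h p S
  by_cases hS : S.card = j
  · rw [hS]
  · rw [hh p S hS]; simp

end num

section ev
variable {ι κ k : Type} [Field k] [Fintype ι] [Fintype κ] [DecidableEq ι] [DecidableEq κ]

/-- The derivation with given components along the Euler field and the lowering operators. -/
def ev (i₀ : ι) (g : Option (ι × κ) → B0 ι κ k) : Derivation k (B0 ι κ k) (B0 ι κ k) :=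
  g none • EB (.inl i₀) (.inl i₀) + ∑ t, g (some t) • EB (.inr t.2) (.inl t.1)

theorem ev_apply (i₀ : ι) (g : Option (ι × κ) → B0 ι κ k) (x) : ev i₀ g x =
    g none * EB (.inl i₀) (.inl i₀) x + ∑ t, g (some t) * EB (.inr t.2) (.inl t.1) x := by
  have hs : ∀ s : Finset (ι × κ), (∑ t ∈ s, g (some t) • EB (Sum.inr t.2) (Sum.inl t.1)) x =
      ∑ t ∈ s, g (some t) * EB (.inr t.2) (.inl t.1) x := fun s => by
    induction s using Finset.induction_on with
    | empty => rfl
    | insert t s ht ih =>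
      rw [Finset.sum_insert ht, Finset.sum_insert ht, Derivation.add_apply, ih]
      rfl
  rw [ev, Derivation.add_apply, hs]
  rfl

theorem ev_sub (i₀ : ι) (g g' : Option (ι × κ) → B0 ι κ k) (x) : ev i₀ (fun p => g p - g' p) x = ev i₀ g x - ev i₀ g' x := by
  simp only [ev_apply, sub_mul, Finset.sum_sub_distrib]; ring

/-- The invariance defining the homogeneous coordinate ring. -/
structure Invar (i₀ : ι) (x : B0 ι κ k) : Prop where
  inr : ∀ c a, EB c (.inr a) x = 0
  inl : ∀ i j, EB (.inl i) (.inl j) x = if i = j then EB (.inl i₀) (.inl i₀) x else 0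

variable {i₀ : ι} {x : B0 ι κ k} (hx : Invar i₀ x)
include hx

theorem ev_inl (h : H ι κ (B0 ι κ k)) (i j) : EB (.inl i) (.inl j) (ev i₀ (fun p => h p ∅) x) =
    ev i₀ (fun p => (SB ι κ k).F i j h p ∅) x +
    if i = j then ev i₀ (fun p => h p ∅) (EB (.inl i₀) (.inl i₀) x) else 0 := by
  have hE : EB (.inl i) (.inl j) (EB (.inl i₀) (.inl i₀) x) =
      if i = j then EB (.inl i₀) (.inl i₀) (EB (.inl i₀) (.inl i₀) x) else 0 := by
    have := EB_comm (.inl i) (.inl j) (.inl i₀) (.inl i₀) x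
    rw [hx.inl i j, hx.inl i i₀, hx.inl i₀ j, sub_eq_iff_eq_add] at this
    rw [this, apply_ite (EB (Sum.inl i₀) (Sum.inl i₀) : B0 ι κ k → B0 ι κ k), map_zero]
    simp only [Sum.inl.injEq]
    by_cases h1 : i = i₀ <;> by_cases h2 : j = i₀ <;> simp_all [eq_comm]
  have hY : ∀ t : ι × κ, EB (.inl i) (.inl j) (EB (.inr t.2) (.inl t.1) x) =
      (if i = j then EB (.inr t.2) (.inl t.1) (EB (.inl i₀) (.inl i₀) x) else 0) -
      if t.1 = i then EB (.inr t.2) (.inl j) x else 0 := fun t => by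
    have := EB_comm (.inl i) (.inl j) (.inr t.2) (.inl t.1) x
    rw [hx.inl i j, sub_eq_iff_eq_add] at this
    rw [this, apply_ite (EB (Sum.inr t.2) (Sum.inl t.1) : B0 ι κ k → B0 ι κ k), map_zero]
    simp only [reduceCtorEq, if_false, Sum.inl.injEq]
    ring
  have hF0 : (SB ι κ k).F i j h none ∅ = EB (.inl i) (.inl j) (h none ∅) := F_none _ _ _ _ _
  have hF1 : ∀ t, (SB ι κ k).F i j h (some t) ∅ = EB (.inl i) (.inl j) (h (some t) ∅) -
      ∑ a, if t = (j, a) then h (some (i, a)) ∅ else 0 := fun t => F_some _ _ _ _ _ _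
  have hs : ∑ t : ι × κ, (∑ a, if t = (j, a) then h (some (i, a)) ∅ else 0) * EB (.inr t.2) (.inl t.1) x =
      ∑ t : ι × κ, h (some t) ∅ * if t.1 = i then EB (.inr t.2) (.inl j) x else 0 := by
    simp only [Finset.sum_mul]
    rw [Finset.sum_comm, Fintype.sum_prod_type_right]
    refine Finset.sum_congr rfl fun a _ => ?_
    simp
  simp only [ev_apply, map_add, map_sum, Derivation.leibniz, smul_eq_mul, hE, hY, hF0, hF1]
  simp only [sub_mul, mul_sub, Finset.sum_sub_distrib, Finset.sum_add_distrib]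
  rw [hs]
  have hc : ∀ t : ι × κ, EB (.inr t.2) (.inl t.1) x * EB (.inl i) (.inl j) (h (some t) ∅) =
    EB (.inl i) (.inl j) (h (some t) ∅) * EB (.inr t.2) (.inl t.1) x := fun t => mul_comm _ _
  simp only [hc]
  split_ifs
  · ring
  · simp only [mul_zero, Finset.sum_const_zero]; ring

theorem ev_inr (h : H ι κ (B0 ι κ k)) (b a) : EB (.inr b) (.inr a) (ev i₀ (fun p => h p ∅) x) =
    ev i₀ (fun p => (SB ι κ k).G b a h p ∅) x := by
  have hE : EB (.inr b) (.inr a) (EB (.inl i₀) (.inl i₀) x) = 0 := by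
    have := EB_comm (.inr b) (.inr a) (.inl i₀) (.inl i₀) x
    rw [hx.inr, map_zero] at this
    simpa using this
  have hY : ∀ t : ι × κ, EB (.inr b) (.inr a) (EB (.inr t.2) (.inl t.1) x) =
      if t.2 = a then EB (.inr b) (.inl t.1) x else 0 := fun t => by
    have := EB_comm (.inr b) (.inr a) (.inr t.2) (.inl t.1) x
    rw [hx.inr, map_zero, sub_zero] at this
    rw [this]
    simp [eq_comm]
  have hG0 : (SB ι κ k).G b a h none ∅ = EB (.inr b) (.inr a) (h none ∅) := G_none _ _ _ _ _
  have hG1 : ∀ t, (SB ι κ k).G b a h (some t) ∅ = EB (.inr b) (.inr a) (h (some t) ∅) +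
      ∑ l, if t = (l, b) then h (some (l, a)) ∅ else 0 := fun t => G_some _ _ _ _ _ _
  have hs : ∑ t : ι × κ, (∑ l, if t = (l, b) then h (some (l, a)) ∅ else 0) * EB (.inr t.2) (.inl t.1) x =
      ∑ t : ι × κ, h (some t) ∅ * if t.2 = a then EB (.inr b) (.inl t.1) x else 0 := by
    simp only [Finset.sum_mul]
    rw [Finset.sum_comm, Fintype.sum_prod_type]
    refine Finset.sum_congr rfl fun a _ => ?_
    simp
  simp only [ev_apply, map_add, map_sum, Derivation.leibniz, smul_eq_mul, hE, hY, hG0, hG1]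
  simp only [add_mul, Finset.sum_add_distrib]
  rw [hs]
  have hc : ∀ t : ι × κ, EB (.inr t.2) (.inl t.1) x * EB (.inr b) (.inr a) (h (some t) ∅) =
    EB (.inr b) (.inr a) (h (some t) ∅) * EB (.inr t.2) (.inl t.1) x := fun t => mul_comm _ _
  simp only [hc]
  ring

theorem ev_raise (h : H ι κ (B0 ι κ k)) (t : ι × κ) :
    ev i₀ (fun p => (SB ι κ k).D h p {t}) x =
      sgn t {t} • EB (.inl t.1) (.inr t.2) (ev i₀ (fun p => h p ∅) x) := by
  have hE : EB (.inl t.1) (.inr t.2) (EB (.inl i₀) (.inl i₀) x) = 0 := by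
    have := EB_comm (.inl t.1) (.inr t.2) (.inl i₀) (.inl i₀) x
    rw [hx.inr, map_zero, sub_zero, hx.inr] at this
    simpa using this
  have hY : ∀ u : ι × κ, EB (.inl t.1) (.inr t.2) (EB (.inr u.2) (.inl u.1) x) =
      if u = t then EB (.inl i₀) (.inl i₀) x else 0 := fun u => by
    have := EB_comm (.inl t.1) (.inr t.2) (.inr u.2) (.inl u.1) x
    rw [hx.inr, map_zero, sub_zero, hx.inr, hx.inl] at this
    rw [this]
    obtain ⟨i, a⟩ := t
    obtain ⟨j, b⟩ := u
    clear hE this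
    by_cases h1 : i = j <;> by_cases h2 : a = b <;> simp [h1, h2, eq_comm]
  have hD0 : (SB ι κ k).D h none {t} = sgn t {t} • (EB (.inl t.1) (.inr t.2) (h none ∅) + h (some t) ∅) :=
    (D_singleton _ _ _ _ _).trans (by rw [if_pos rfl]; rfl)
  have hD1 : ∀ u, (SB ι κ k).D h (some u) {t} = sgn t {t} • EB (.inl t.1) (.inr t.2) (h (some u) ∅) := fun u =>
    (D_singleton _ _ _ _ _).trans (by rw [if_neg (by simp), add_zero]; rfl)
  simp only [ev_apply, map_add, map_sum, Derivation.leibniz, smul_eq_mul, hE, hY, hD0, hD1]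
  simp only [mul_ite, mul_zero, Finset.sum_add_distrib, Finset.sum_ite_eq', Finset.mem_univ, if_true,
    smul_mul_assoc, ← Finset.smul_sum, ← smul_add]
  have hc : ∀ u : ι × κ, EB (.inr u.2) (.inl u.1) x * EB (.inl t.1) (.inr t.2) (h (some u) ∅) =
    EB (.inl t.1) (.inr t.2) (h (some u) ∅) * EB (.inr u.2) (.inl u.1) x := fun u => mul_comm _ _
  simp only [hc]
  congr 1
  ring

end ev

section uniqueness
variable {ι κ k : Type} [Field k] [Fintype ι] [Fintype κ] [DecidableEq ι] [DecidableEq κ]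

theorem algebraMap_pl (f : ι → ι ⊕ κ) : algebraMap (R0 ι κ k) (B0 ι κ k) (pl f) = mnr (xB ι κ k) f Sum.inl :=
  map_mnr _ _ _ _

theorem invar_pl (i₀ : ι) (f : ι → ι ⊕ κ) : Invar i₀ (algebraMap (R0 ι κ k) (B0 ι κ k) (pl f)) where
  inr c a := by rw [EB_algebraMap, E0_pl_inr, map_zero]
  inl i j := by
    rw [EB_algebraMap, EB_algebraMap, E0_pl_inl, E0_pl_inl, if_pos rfl]
    split_ifs
    · rfl
    · exact map_zero _

theorem ev_pl (i₀ : ι) (g : Option (ι × κ) → B0 ι κ k) (f : ι → ι ⊕ κ) : ev i₀ g (algebraMap (R0 ι κ k) _ (pl f)) =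
    g none * mnr (xB ι κ k) f Sum.inl + ∑ t, g (some t) * mnr (xB ι κ k) f (tw t) := by
  have h : ∀ t : ι × κ, EB (.inr t.2) (.inl t.1) (mnr (xB ι κ k) f Sum.inl) = mnr (xB ι κ k) f (tw t) := fun t => by
    rw [der_mnr_col _ (EB_x _ _), Finset.sum_eq_single t.1]
    · rw [if_pos rfl]; rfl
    · intro b _ hb
      rw [if_neg fun h => hb (Sum.inl_injective h)]
    · simp
  rw [ev_apply, EB_algebraMap, E0_pl_inl, if_pos rfl, algebraMap_pl]
  simp only [h]

theorem con_ev (i₀ : ι) (g : Option (ι × κ) → B0 ι κ k) (J) :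
    con (yB ι κ k) (fun f => ev i₀ g (algebraMap (R0 ι κ k) _ (pl f))) J =
      g none * mnr 1 J Sum.inl + ∑ t, g (some t) * mnr 1 J (tw t) := by
  simp only [ev_pl]
  rw [con_add, con_sum]
  simp only [con_mul, con_mnr, yB_mul_xB]

theorem con_ev_inl (i₀ : ι) (g : Option (ι × κ) → B0 ι κ k) :
    con (yB ι κ k) (fun f => ev i₀ g (algebraMap (R0 ι κ k) _ (pl f))) Sum.inl = g none := by
  rw [con_ev, mnr_one_inl]
  simp [mnr_one_inl_tw]

theorem con_ev_tw (i₀ : ι) (g : Option (ι × κ) → B0 ι κ k) (t) :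
    con (yB ι κ k) (fun f => ev i₀ g (algebraMap (R0 ι κ k) _ (pl f))) (tw t) = g (some t) := by
  rw [con_ev, mnr_one_of_inr (s := t.1) (a := t.2) (by simp [tw])]
  simp [mnr_one_tw_tw]

theorem ev_unique (i₀ : ι) {g : Option (ι × κ) → B0 ι κ k} (h : ∀ f, ev i₀ g (algebraMap (R0 ι κ k) _ (pl f)) = 0) (p) :
    g p = 0 := by
  have h0 : ∀ J, con (yB ι κ k) (fun f => ev i₀ g (algebraMap (R0 ι κ k) _ (pl f))) J = 0 := fun J => by
    simp [con, h]
  cases p with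
  | none => rw [← con_ev_inl i₀ g, h0]
  | some t => rw [← con_ev_tw i₀ g, h0]

theorem eB_mul_left (c d : ι ⊕ κ) (q v : B0 ι κ k) : eB (k := k) c d (LinearMap.mulLeft k q v) =
    LinearMap.mulLeft k q (eB (k := k) c d v) + EB c d q * v := by
  refine (Derivation.leibniz (EB c d) q v).trans ?_
  rw [smul_eq_mul, smul_eq_mul, mul_comm v]
  rfl

theorem mulLeft_mem_Q (i₀ : ι) {j : ℤ} {q ψ : B0 ι κ k} (h1 : ∀ i l, EB (.inl i) (.inl l) q = if i = l then ψ else 0)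
    (h2 : ∀ b a, EB (.inr b) (.inr a) q = 0) {h : H ι κ (B0 ι κ k)} (hh : h ∈ (SB ι κ k).Q i₀ 0 j) :
    mapH (LinearMap.mulLeft k q) h ∈ (SB ι κ k).Q i₀ 0 j := by
  refine mapH_mem_Q (he := eB_comm) (ψ := LinearMap.mulLeft k ψ) (fun i l v => ?_) (fun b a v => ?_) hh
  · rw [eB_mul_left, h1]
    split_ifs <;> simp
  · rw [eB_mul_left, h2]
    simp

theorem D_mulLeft {q : B0 ι κ k} (h1 : ∀ i a, EB (.inl i) (.inr a) q = 0) (h : H ι κ (B0 ι κ k)) :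
    (SB ι κ k).D (mapH (LinearMap.mulLeft k q) h) = mapH (LinearMap.mulLeft k q) ((SB ι κ k).D h) := by
  refine D_mapH (he := eB_comm) (fun i a v => ?_) h
  rw [eB_mul_left, h1, zero_mul, add_zero]

theorem smul_eq_mapH {A : Type} [CommRing A] [Algebra A (B0 ι κ k)] (x : A) (h : H ι κ (B0 ι κ k)) : x • h = mapH (LinearMap.mulLeft k (algebraMap A (B0 ι κ k) x)) h := by
  funext p S
  exact Algebra.smul_def _ _

end uniqueness

section model
variable {ι κ k : Type} [Field k] [Fintype ι] [Fintype κ] [DecidableEq ι] [DecidableEq κ]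

/-- An algebra embedded in `B0` and generated by the Plücker coordinates. -/
structure PlModel (A : Type) [CommRing A] [Algebra k A] [Algebra A (B0 ι κ k)]
    (pA : (ι → ι ⊕ κ) → A) : Prop where
  inj : Function.Injective (algebraMap A (B0 ι κ k))
  map_p : ∀ f, algebraMap A (B0 ι κ k) (pA f) = algebraMap (R0 ι κ k) _ (pl f)
  top : Algebra.adjoin k (Set.range pA) = ⊤

variable {A : Type} [CommRing A] [Algebra k A] [Algebra A (B0 ι κ k)] [IsScalarTower k A (B0 ι κ k)]
  {pA : (ι → ι ⊕ κ) → A} (P : PlModel (k := k) A pA)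
include P

theorem PlModel.invar (i₀ : ι) (x : A) : Invar i₀ (algebraMap A (B0 ι κ k) x) := by
  have hx : x ∈ Algebra.adjoin k (Set.range pA) := by rw [P.top]; trivial
  induction hx using Algebra.adjoin_induction with
  | mem x hx =>
    obtain ⟨f, rfl⟩ := hx
    rw [P.map_p]; exact invar_pl i₀ f
  | algebraMap r =>
    rw [← IsScalarTower.algebraMap_apply]
    exact ⟨fun _ _ => Derivation.map_algebraMap _ _, fun _ _ => by simp⟩
  | add x y _ _ hx hy =>
    rw [map_add]
    refine ⟨fun c a => by rw [map_add, hx.inr, hy.inr, add_zero], fun i j => ?_⟩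
    rw [map_add, map_add, hx.inl, hy.inl]
    split_ifs <;> simp
  | mul x y _ _ hx hy =>
    rw [map_mul]
    refine ⟨fun c a => by rw [Derivation.leibniz, hx.inr, hy.inr, smul_zero, smul_zero, add_zero], fun i j => ?_⟩
    rw [Derivation.leibniz, Derivation.leibniz, hx.inl, hy.inl]
    split_ifs <;> simp

theorem PlModel.exists_of_mem {p : R0 ι κ k} (hp : p ∈ plAlg ι κ k) : ∃ a : A, algebraMap A (B0 ι κ k) a = algebraMap _ _ p := by
  induction hp using Algebra.adjoin_induction with
  | mem x hx =>
    obtain ⟨f, rfl⟩ := hx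
    exact ⟨pA f, P.map_p f⟩
  | algebraMap r =>
    exact ⟨algebraMap k A r, by rw [← IsScalarTower.algebraMap_apply, ← IsScalarTower.algebraMap_apply]⟩
  | add x y _ _ hx hy =>
    obtain ⟨a, ha⟩ := hx
    obtain ⟨b, hb⟩ := hy
    exact ⟨a + b, by rw [map_add, map_add, ha, hb]⟩
  | mul x y _ _ hx hy =>
    obtain ⟨a, ha⟩ := hx
    obtain ⟨b, hb⟩ := hy
    exact ⟨a * b, by rw [map_mul, map_mul, ha, hb]⟩

/-- The terms of the complex computing local cohomology of derivations. -/
def PlModel.N (i₀ : ι) (j : ℤ) : Submodule A (H ι κ (B0 ι κ k)) where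
  carrier := (SB ι κ k).Q i₀ 0 j
  add_mem' := ((SB ι κ k).Q i₀ 0 j).add_mem
  zero_mem' := ((SB ι κ k).Q i₀ 0 j).zero_mem
  smul_mem' x h hh := by
    have := P.invar i₀ x
    rw [smul_eq_mapH]
    exact mulLeft_mem_Q i₀ this.inl (fun b a => this.inr _ _) hh

/-- The differential, linear over the coordinate ring. -/
def PlModel.D [Nonempty ι] : H ι κ (B0 ι κ k) →ₗ[A] H ι κ (B0 ι κ k) where
  toFun := (SB ι κ k).D
  map_add' := map_add _
  map_smul' x h := by
    rw [smul_eq_mapH, D_mulLeft fun i a => (P.invar (Classical.arbitrary ι) x).inr _ _, RingHom.id_apply, smul_eq_mapH]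

end model

section contraction
variable {ι κ k : Type} [Field k] [Fintype ι] [Fintype κ] [DecidableEq ι] [DecidableEq κ]

theorem EB_mnr_yB_inl (i j : ι) (f : ι → ι ⊕ κ) : EB (.inl i) (.inl j) (mnr (yB ι κ k) Sum.inl f) =
    if i = j then - mnr (yB ι κ k) Sum.inl f else 0 := by
  have h := der_mnr_col_inj (-EB (k := k) (.inl i : ι ⊕ κ) (.inl j)) (x := (yB ι κ k).transpose)
    Sum.inl_injective (c := .inl j) (d := .inl i) (fun l e => by
      rw [Derivation.neg_apply, Matrix.transpose_apply, EB_y, apply_ite Neg.neg, neg_neg, neg_zero]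
      simp only [eq_comm]; rfl) ⟨j, rfl⟩ f
  rw [← mnr_transpose, Derivation.neg_apply, neg_eq_iff_eq_neg] at h
  rw [h]
  simp only [Sum.inl.injEq, eq_comm (a := j)]
  split_ifs <;> simp

theorem EB_mnr_yB_inr (b : κ) (d : ι ⊕ κ) (f : ι → ι ⊕ κ) : EB (.inr b) d (mnr (yB ι κ k) Sum.inl f) = 0 := by
  have h := der_mnr_col_notMem (-EB (k := k) (.inr b : ι ⊕ κ) d) (x := (yB ι κ k).transpose)
    (g := Sum.inl) (c := d) (d := .inr b) (fun l e => by
      rw [Derivation.neg_apply, Matrix.transpose_apply, EB_y, apply_ite Neg.neg, neg_neg, neg_zero]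
      simp only [eq_comm]; rfl) (by simp) f
  rwa [← mnr_transpose, Derivation.neg_apply, neg_eq_zero] at h

theorem sum_pl_mul_mnr_yB : ∑ f : ι → ι ⊕ κ, algebraMap (R0 ι κ k) (B0 ι κ k) (pl f) * mnr (yB ι κ k) Sum.inl f =
    ((Fintype.card ι).factorial : B0 ι κ k) := by
  have h : ∀ σ : Equiv.Perm ι, ∑ f : ι → ι ⊕ κ, (∏ i, yB ι κ k (.inl (σ i)) (f i)) * mnr (xB ι κ k) f Sum.inl =
      ((Equiv.Perm.sign σ : ℤ) : B0 ι κ k) := fun σ => by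
    refine (con_mnr (yB ι κ k) (xB ι κ k) Sum.inl (Sum.inl ∘ σ)).trans ?_
    rw [yB_mul_xB, mnr_perm, mnr_one_inl, mul_one]
  have h' : ∀ f : ι → ι ⊕ κ, mnr (yB ι κ k) Sum.inl f = ∑ σ : Equiv.Perm ι, ((Equiv.Perm.sign σ : ℤ) : B0 ι κ k) *
      ∏ i, yB ι κ k (.inl (σ i)) (f i) := fun f => Matrix.det_apply' _
  simp only [algebraMap_pl, h', Finset.mul_sum]
  rw [Finset.sum_comm, ← Fintype.card_perm, ← Finset.card_univ, ← nsmul_one, ← Finset.sum_const]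
  refine Finset.sum_congr rfl fun σ _ => ?_
  have h1 : ((Equiv.Perm.sign σ : ℤ) : B0 ι κ k) * ((Equiv.Perm.sign σ : ℤ) : B0 ι κ k) = 1 := by
    rw [← Int.cast_mul, ← Units.val_mul, Int.units_mul_self]; simp
  refine Eq.trans ?_ h1
  nth_rw 2 [← h σ]
  rw [Finset.sum_mul]
  exact Finset.sum_congr rfl fun f _ => by ring

variable {A : Type} [CommRing A] [Algebra k A] [Algebra A (B0 ι κ k)] [IsScalarTower k A (B0 ι κ k)]
  {pA : (ι → ι ⊕ κ) → A}

theorem PlModel.contracts [CharZero k] (P : PlModel (k := k) A pA) {J : Ideal A} (hJ : ∀ f, pA f ∈ J) (i₀ : ι) (j : ℤ) :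
    ExtVan.Contracts J (P.N i₀ j) := by
  let c : k := ((Fintype.card ι).factorial : k)⁻¹
  let q : (ι → ι ⊕ κ) → H ι κ (B0 ι κ k) →ₗ[A] H ι κ (B0 ι κ k) := fun f =>
    LinearMap.compLeft (LinearMap.compLeft (LinearMap.mulLeft A (c • mnr (yB ι κ k) Sum.inl f)) _) _
  refine ⟨ι → ι ⊕ κ, inferInstance, pA, q, hJ, fun f x hx => ?_, fun x _ => ?_⟩
  · refine mulLeft_mem_Q (q := c • mnr (yB ι κ k) Sum.inl f) (ψ := c • - mnr (yB ι κ k) Sum.inl f) i₀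
      (fun i l => ?_) (fun b a => ?_) hx
    · rw [Derivation.map_smul, EB_mnr_yB_inl]
      split_ifs
      · rfl
      · exact smul_zero _
    · rw [Derivation.map_smul, EB_mnr_yB_inr, smul_zero]
  · funext p S
    rw [Finset.sum_apply, Finset.sum_apply]
    have h : ∀ f, (pA f • q f x) p S = c • ((algebraMap (R0 ι κ k) (B0 ι κ k) (pl f) * mnr (yB ι κ k) Sum.inl f) * x p S) := fun f => by
      change pA f • ((c • mnr (yB ι κ k) Sum.inl f) * x p S) = _
      rw [Algebra.smul_def, P.map_p, smul_mul_assoc, mul_smul_comm, mul_assoc]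
    simp only [h]
    rw [← Finset.smul_sum, ← Finset.sum_mul, sum_pl_mul_mnr_yB, ← smul_mul_assoc]
    have h1 : c • ((Fintype.card ι).factorial : B0 ι κ k) = 1 := by
      rw [← map_natCast (algebraMap k (B0 ι κ k)), Algebra.smul_def, ← map_mul,
        inv_mul_cancel₀ (Nat.cast_ne_zero.2 (Nat.factorial_ne_zero _)), map_one]
    rw [h1, one_mul]

end contraction

section derivations
variable {ι κ k : Type} [Field k] [Fintype ι] [Fintype κ] [DecidableEq ι] [DecidableEq κ]

theorem Invar.ev_invar {i₀ : ι} {h : H ι κ (B0 ι κ k)} (hh : h ∈ (SB ι κ k).Q i₀ 0 0) (hD : (SB ι κ k).D h = 0)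
    {x : B0 ι κ k} (hx : Invar i₀ x) : Invar i₀ (ev i₀ (fun p => h p ∅) x) := by
  obtain ⟨h1, h2, -⟩ := hh
  have ev0 : ev i₀ (fun _ => (0 : B0 ι κ k)) x = 0 := by simp [ev_apply]
  refine ⟨fun c a => ?_, fun i j => ?_⟩
  · cases c with
    | inl i =>
      have h := ev_raise hx h (i, a)
      simp only [hD, Pi.zero_apply] at h
      rw [ev0] at h
      simpa [sgn, rs_self] using h.symm
    | inr b =>
      have h0 : (SB ι κ k).G b a h = 0 := by rw [h2]; simp
      rw [ev_inr hx]
      simp only [h0, Pi.zero_apply]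
      exact ev0
  · rw [ev_inl hx, ev_inl hx, if_pos rfl, h1]
    split_ifs
    · rfl
    · simp only [Pi.zero_apply]
      rw [ev0, add_zero]

variable {A : Type} [CommRing A] [Algebra k A] [Algebra A (B0 ι κ k)] [IsScalarTower k A (B0 ι κ k)]
  {pA : (ι → ι ⊕ κ) → A}

theorem PlModel.exists_of_invar [CharZero k] [Nonempty κ] (P : PlModel (k := k) A pA) {i₀ : ι} {b : B0 ι κ k}
    (hb : Invar i₀ b) : ∃ a : A, algebraMap A (B0 ι κ k) a = b := by
  obtain ⟨p, hp, rfl⟩ := mem_plAlg_of_invariant i₀ hb.inr hb.inl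
  exact P.exists_of_mem hp

theorem PlModel.exists_der [CharZero k] [Nonempty κ] (P : PlModel (k := k) A pA) {i₀ : ι}
    {h : H ι κ (B0 ι κ k)} (hh : h ∈ (SB ι κ k).Q i₀ 0 0) (hD : (SB ι κ k).D h = 0) :
    ∃ δ : Derivation k A A, ∀ a, algebraMap A (B0 ι κ k) (δ a) = ev i₀ (fun p => h p ∅) (algebraMap A _ a) := by
  choose δ hδ using fun a : A => P.exists_of_invar ((P.invar i₀ a).ev_invar hh hD)
  refine ⟨Derivation.mk' { toFun := δ, map_add' := fun a b => P.inj ?_, map_smul' := fun c a => P.inj ?_ }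
    fun a b => P.inj ?_, hδ⟩
  · rw [hδ, map_add, map_add, map_add, hδ, hδ]
  · have hs : ∀ b : A, algebraMap A (B0 ι κ k) (c • b) = c • algebraMap A _ b := fun b => by
      rw [Algebra.algebraMap_eq_smul_one, Algebra.algebraMap_eq_smul_one, smul_assoc]
    rw [hδ, hs, Derivation.map_smul, ← hδ, RingHom.id_apply, hs]
  · simp only [LinearMap.coe_mk, AddHom.coe_mk, smul_eq_mul, map_add, map_mul]
    rw [hδ, map_mul, Derivation.leibniz, hδ, hδ, smul_eq_mul, smul_eq_mul]

theorem PlModel.algebraMap_eq_ev [CharZero k] (P : PlModel (k := k) A pA) {i₀ : ι} (δ : Derivation k A A)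
    (g : Option (ι × κ) → B0 ι κ k)
    (h0 : con (yB ι κ k) (fun f => algebraMap A (B0 ι κ k) (δ (pA f))) Sum.inl = g none)
    (h1 : ∀ t, con (yB ι κ k) (fun f => algebraMap A (B0 ι κ k) (δ (pA f))) (tw t) = g (some t)) (a : A) :
    algebraMap A (B0 ι κ k) (δ a) = ev i₀ g (algebraMap A _ a) := by
  let δ' : Derivation k A (B0 ι κ k) := (Algebra.linearMap A (B0 ι κ k)).compDer δ - (ev i₀ g).compAlgebraMap A
  have hδ' : ∀ a, δ' a = algebraMap A (B0 ι κ k) (δ a) - ev i₀ g (algebraMap A _ a) := fun a => rfl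
  clear_value δ'
  have hpB : ∀ f, algebraMap A (B0 ι κ k) (pA f) = mnr (xB ι κ k) f Sum.inl := fun f => by
    rw [P.map_p, algebraMap_pl]
  have hcon : ∀ J, con (yB ι κ k) (fun f => δ' (pA f)) J =
      con (yB ι κ k) (fun f => algebraMap A (B0 ι κ k) (δ (pA f))) J -
      con (yB ι κ k) (fun f => ev i₀ g (algebraMap (R0 ι κ k) _ (pl f))) J := fun J => by
    simp only [con, ← Finset.sum_sub_distrib, ← mul_sub, hδ', P.map_p]
  have hz : ∀ f, δ' (pA f) = 0 := by
    refine eq_zero_of_linearized (v := fun f => δ' (pA f)) (fun z hz => ?_) xB_mul_yB yB_mul_xB (fun H s => ?_)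
      (fun f σ => ?_) ?_ fun t => ?_
    · rw [← two_smul k] at hz
      exact (smul_eq_zero.1 hz).resolve_left two_ne_zero
    · have h : pA (H ∘ Sum.inl) * pA (H ∘ Sum.inr) =
          ∑ t, pA ((H ∘ Equiv.swap (Sum.inl t) (Sum.inr s)) ∘ Sum.inl) *
            pA ((H ∘ Equiv.swap (Sum.inl t) (Sum.inr s)) ∘ Sum.inr) := P.inj <| by
        simp only [map_mul, map_sum, hpB]
        exact mnr_exchange _ _ _ _
      have h' := congrArg δ' h
      simp only [map_sum, Derivation.leibniz, Algebra.smul_def, hpB] at h'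
      rw [add_comm, mul_comm (δ' _), h']
      exact Finset.sum_congr rfl fun t _ => by ring
    · have h : pA (f ∘ σ) = ((Equiv.Perm.sign σ : ℤ) : A) * pA f := P.inj <| by
        rw [map_mul, hpB, hpB, mnr_perm, map_intCast]
      rw [h, ← zsmul_eq_mul, map_zsmul, zsmul_eq_mul]
    · rw [hcon, h0, con_ev_inl, sub_self]
    · rw [hcon, h1, con_ev_tw, sub_self]
  have : δ' = 0 := Derivation.ext_of_adjoin_eq_top _ P.top fun x hx => by
    obtain ⟨f, rfl⟩ := hx
    exact hz f
  rw [← sub_eq_zero, ← hδ', this]; rfl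

theorem mem_Q_of_ev [CharZero k] {i₀ : ι} {h : H ι κ (B0 ι κ k)} (hS : ∀ p S, S.card ≠ 0 → h p S = 0)
    (hI : ∀ f, Invar i₀ (ev i₀ (fun p => h p ∅) (algebraMap (R0 ι κ k) _ (pl f)))) :
    h ∈ (SB ι κ k).Q i₀ 0 0 ∧ (SB ι κ k).D h = 0 := by
  have hn : (SB ι κ k).num h = ((0 : ℕ) : ℤ) • h := num_eq_of_apply hS
  have hn0 : (SB ι κ k).num h = 0 := by rw [hn]; exact zero_smul _ _
  have hext : ∀ g : H ι κ (B0 ι κ k), (SB ι κ k).num g = 0 → (∀ p, g p ∅ = 0) → g = 0 := fun g hg hg' => by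
    funext p S
    by_cases hS : S = ∅
    · subst hS; exact hg' p
    · refine apply_eq_zero_of_num (j := 0) (hg.trans ?_) p (Finset.card_ne_zero.2 (Finset.nonempty_iff_ne_empty.2 hS))
      exact (zero_smul ℤ g).symm
  have hcomm : ∀ z : Module.End k (H ι κ (B0 ι κ k)), ⁅(SB ι κ k).num, z⁆ = 0 → (SB ι κ k).num (z h) = 0 := fun z hz => by
    rw [Sys.comm_apply hz, hn0, map_zero]
  refine ⟨⟨fun i l => ?_, fun b a => ?_, ?_⟩, ?_⟩
  · rw [← sub_eq_zero]
    refine hext _ ?_ ?_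
    · rw [map_sub, hcomm _ ((SB ι κ k).num_F i l)]
      split_ifs
      · rw [hcomm _ ((SB ι κ k).num_F _ _), sub_zero]
      · rw [map_zero, sub_zero]
    · refine ev_unique i₀ fun f => ?_
      have h1 := ev_inl (invar_pl i₀ f) h i l
      have h2 := ev_inl (invar_pl i₀ f) h i₀ i₀
      rw [(hI f).inl, h2, if_pos rfl] at h1
      have h3 : ev i₀ (fun p => (if i = l then (SB ι κ k).F i₀ i₀ h else 0) p ∅) (algebraMap (R0 ι κ k) _ (pl f)) =
          if i = l then ev i₀ (fun p => (SB ι κ k).F i₀ i₀ h p ∅) (algebraMap (R0 ι κ k) _ (pl f)) else 0 := by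
        split_ifs
        · rfl
        · simp [ev_apply]
      refine (ev_sub i₀ _ _ _).trans ?_
      rw [h3]
      split_ifs at h1 ⊢
      · rw [sub_eq_zero]; exact (add_right_cancel h1).symm
      · rw [sub_zero, h1, add_zero]
  · have : (SB ι κ k).G b a h = 0 := hext _ (hcomm _ ((SB ι κ k).num_G b a)) <|
      ev_unique i₀ fun f => by rw [← ev_inr (invar_pl i₀ f), (hI f).inr]
    rw [this]; simp
  · rw [hn]; simp
  · have hnD : (SB ι κ k).num ((SB ι κ k).D h) = ((1 : ℕ) : ℤ) • (SB ι κ k).D h := by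
      have h1 : ⁅(SB ι κ k).num, (SB ι κ k).D⁆ = (SB ι κ k).D := by
        rw [Sys.D, br_add, Sys.num_d, Sys.num_tau]
      have h2 := LinearMap.congr_fun h1 h
      rw [Ring.lie_def, LinearMap.sub_apply, Module.End.mul_apply, Module.End.mul_apply, hn0, map_zero, sub_zero] at h2
      rw [h2, Nat.cast_one, one_smul]
    funext p S
    by_cases hS : S.card = 1
    · obtain ⟨t, rfl⟩ := Finset.card_eq_one.1 hS
      refine ev_unique i₀ (g := fun p => (SB ι κ k).D h p {t}) (fun f => ?_) p
      rw [ev_raise (invar_pl i₀ f), (hI f).inr, zsmul_zero]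
    · exact apply_eq_zero_of_num hnD p hS

end derivations

section vanishing
variable {ι κ k : Type} [Field k] [Fintype ι] [Fintype κ] [DecidableEq ι] [DecidableEq κ]
variable {A : Type} [CommRing A] [Algebra k A] [Algebra A (B0 ι κ k)] [IsScalarTower k A (B0 ι κ k)]
  {pA : (ι → ι ⊕ κ) → A}

theorem PlModel.der_equiv [CharZero k] [Nonempty ι] [Nonempty κ] (P : PlModel (k := k) A pA) (i₀ : ι) :
    Nonempty (Derivation k A A ≃ₗ[A] (P.N i₀ ((0 : ℕ) : ℤ) ⊓ LinearMap.ker P.D : Submodule A (H ι κ (B0 ι κ k)))) := by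
  have hQ : ∀ h : (P.N i₀ ((0 : ℕ) : ℤ) ⊓ LinearMap.ker P.D : Submodule A (H ι κ (B0 ι κ k))),
      h.1 ∈ (SB ι κ k).Q i₀ 0 0 ∧ (SB ι κ k).D h.1 = 0 := fun h => ⟨h.2.1, LinearMap.mem_ker.1 h.2.2⟩
  choose δ hδ using fun h : (P.N i₀ ((0 : ℕ) : ℤ) ⊓ LinearMap.ker P.D : Submodule A (H ι κ (B0 ι κ k))) =>
    P.exists_der (hQ h).1 (hQ h).2
  let Θ : (P.N i₀ ((0 : ℕ) : ℤ) ⊓ LinearMap.ker P.D : Submodule A (H ι κ (B0 ι κ k))) →ₗ[A] Derivation k A A :=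
    { toFun := δ
      map_add' := fun h h' => Derivation.ext fun a => P.inj <| by
        rw [Derivation.add_apply, map_add, hδ, hδ, hδ, ev_apply, ev_apply, ev_apply]
        simp only [Submodule.coe_add, Pi.add_apply, add_mul, Finset.sum_add_distrib]
        ring
      map_smul' := fun x h => Derivation.ext fun a => P.inj <| by
        rw [RingHom.id_apply, Derivation.smul_apply, smul_eq_mul, map_mul, hδ, hδ, ev_apply, ev_apply]
        simp only [Submodule.coe_smul, Pi.smul_apply, Algebra.smul_def, mul_add, Finset.mul_sum, mul_assoc] }
  have hΘ : ∀ h, Θ h = δ h := fun _ => rfl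
  clear_value Θ
  refine ⟨(LinearEquiv.ofBijective Θ ⟨(injective_iff_map_eq_zero Θ).2 fun h hh => ?_, fun D => ?_⟩).symm⟩
  · refine Subtype.ext (funext fun p => funext fun S => ?_)
    by_cases hS : S = ∅
    · subst hS
      refine ev_unique i₀ (g := fun p => h.1 p ∅) (fun f => ?_) p
      rw [← P.map_p, ← hδ, ← hΘ, hh]
      exact map_zero _
    · exact apply_eq_zero_of_num (j := 0) (hQ h).1.2.2 p (Finset.card_ne_zero.2 (Finset.nonempty_iff_ne_empty.2 hS))
  · let Φ := con (yB ι κ k) fun f => algebraMap A (B0 ι κ k) (D (pA f))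
    let h : H ι κ (B0 ι κ k) := fun p S => if S = ∅ then p.elim (Φ Sum.inl) fun t => Φ (tw t) else 0
    have hev : ∀ a, algebraMap A (B0 ι κ k) (D a) = ev i₀ (fun p => h p ∅) (algebraMap A _ a) :=
      P.algebraMap_eq_ev D _ (if_pos rfl).symm fun t => (if_pos rfl).symm
    have hh := mem_Q_of_ev (i₀ := i₀) (h := h) (fun p S hS => if_neg fun e => hS (by rw [e]; rfl)) fun f => by
      rw [← P.map_p, ← hev]
      exact P.invar i₀ _
    refine ⟨⟨h, hh.1, LinearMap.mem_ker.2 hh.2⟩, Derivation.ext fun a => P.inj ?_⟩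
    rw [hΘ, hδ, hev]

theorem PlModel.vanishing [CharZero k] [Nonempty ι] [Nonempty κ] (P : PlModel (k := k) A pA)
    (h22 : ¬(Fintype.card ι = 2 ∧ Fintype.card κ = 2)) {J : Ideal A} (hJ : ∀ f, pA f ∈ J) (i : ℕ)
    (hi : i ≤ Fintype.card ι * Fintype.card κ) :
    Subsingleton ((localCohomology J i).obj (ModuleCat.of A (Derivation k A A))) := by
  obtain ⟨i₀⟩ := ‹Nonempty ι›
  obtain ⟨e⟩ := P.der_equiv i₀
  refine ExtVan.subsingleton_of_complex J P.D (fun j => P.N i₀ (j : ℤ)) (Fintype.card ι * Fintype.card κ)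
    (fun j => P.contracts hJ i₀ j) (fun j x hx => ?_) (fun x => ?_) (fun j hj x hx hD => ?_) e i hi
  · have h1 : (SB ι κ k).d x + (SB ι κ k).tau x ∈ (SB ι κ k).Q i₀ 0 ((j : ℤ) + 1) :=
      Submodule.add_mem _ (Sys.d_mem hx) (Sys.tau_mem hx)
    exact_mod_cast h1
  · have h2 : (SB ι κ k).D * (SB ι κ k).D = 0 := Sys.D_D _ fun z hz => by
      rw [← two_smul k] at hz
      exact (smul_eq_zero.1 hz).resolve_left two_ne_zero
    exact LinearMap.congr_fun h2 x
  · have hx' : x ∈ (SB ι κ k).Q i₀ 0 ((j : ℤ) + 1) := by exact_mod_cast hx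
    obtain ⟨y, hy, hyx⟩ := SB_exact i₀ h22 (by omega) (by exact_mod_cast hj) hx' hD
    exact ⟨y, by rwa [add_sub_cancel_right] at hy, hyx⟩

end vanishing

end Fock

namespace Plucker

open MvPolynomial Fock in
/-- The Plücker algebra is a model of the algebra of maximal minors on the localized matrix space. -/
theorem exists_plModel (k : Type) [Field k] (r n : ℕ) (hrn : r < n) :
    ∃ (_ : Algebra (Plucker.algebra k r n) (B0 (Fin r) (Fin (n - r)) k))
      (_ : IsScalarTower k (Plucker.algebra k r n) (B0 (Fin r) (Fin (n - r)) k))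
      (pA : (Fin r → Fin r ⊕ Fin (n - r)) → Plucker.algebra k r n),
      PlModel (k := k) (Plucker.algebra k r n) pA ∧ ∀ f, pA f ∈ Plucker.irrelevant k r n := by
  let e : Fin r ⊕ Fin (n - r) ≃ Fin n := finSumFinEquiv.trans (finCongr (by omega))
  let φ : S k r n →ₐ[k] R0 (Fin r) (Fin (n - r)) k := rename fun p => (e.symm p.1, Sum.inl p.2)
  have hφ : Function.Injective φ := rename_injective _ fun p q h => by
    rw [Prod.mk.injEq, e.symm.injective.eq_iff, Sum.inl_injective.eq_iff] at h
    exact Prod.ext h.1 h.2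
  have hm : ∀ f : Fin r → Fin r ⊕ Fin (n - r), φ (minor k r n (e ∘ f)) = pl f := fun f => by
    rw [minor, AlgHom.map_det]
    refine congrArg Matrix.det (Matrix.ext fun i j => ?_)
    refine (rename_X _ _).trans ?_
    rw [Function.comp_apply, e.symm_apply_apply]
    rfl
  let ψ : Plucker.algebra k r n →ₐ[k] B0 (Fin r) (Fin (n - r)) k :=
    ((IsScalarTower.toAlgHom k (R0 (Fin r) (Fin (n - r)) k) (B0 (Fin r) (Fin (n - r)) k)).comp φ).comp
      (Plucker.algebra k r n).val
  have hmem : ∀ f, minor k r n f ∈ Plucker.algebra k r n := fun f => Algebra.subset_adjoin ⟨f, rfl⟩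
  refine ⟨ψ.toRingHom.toAlgebra, ?_, fun f => ⟨minor k r n (e ∘ f), hmem _⟩, ?_, fun f => Ideal.subset_span ⟨_, rfl⟩⟩
  · exact IsScalarTower.of_algHom ψ
  · let : Algebra (Plucker.algebra k r n) (B0 (Fin r) (Fin (n - r)) k) := ψ.toRingHom.toAlgebra
    refine ⟨fun x y h => Subtype.ext (hφ (algebraMap_B0_injective h)), fun f => congrArg (algebraMap (R0 (Fin r) (Fin (n - r)) k) (B0 (Fin r) (Fin (n - r)) k)) (hm f), ?_⟩
    refine top_le_iff.mp (Algebra.adjoin_adjoin_coe_preimage.ge.trans (Algebra.adjoin_mono ?_))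
    rintro ⟨x, hx⟩ ⟨f, hf⟩
    refine ⟨e.symm ∘ f, Subtype.ext ?_⟩
    change minor k r n (e ∘ e.symm ∘ f) = x
    rw [← Function.comp_assoc, e.self_comp_symm, Function.id_comp]
    exact hf

end Plucker

/-- **(Christophersen–Ilten, Proposition 3.7.)**  Let `k` be a field of
characteristic zero, `0 < r < n` with `(r,n) ≠ (2,4)`, let `A` be the Plücker
algebra of the Grassmannian `G(r,n)`, `d = r(n-r)+1` its Krull dimension, and
`m` its irrelevant maximal ideal.  Then the local cohomology of the module of
`k`-linear derivations of `A` vanishes: `H^i_m(Der_k(A)) = 0` for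
`0 ≤ i ≤ d-1`. -/
theorem local_cohomology_derivations_plucker_vanishing
    (k : Type) [Field k] [CharZero k] (r n : ℕ)
    (hr : 0 < r) (hrn : r < n) (hG24 : ¬(r = 2 ∧ n = 4))
    (d : ℕ) (hd : d = r * (n - r) + 1) :
    ∀ i : ℕ, i ≤ d - 1 →
      Subsingleton ((localCohomology (Plucker.irrelevant k r n) i).obj
        (ModuleCat.of (Plucker.algebra k r n)
          (Derivation k (Plucker.algebra k r n) (Plucker.algebra k r n)))) := by
  obtain ⟨_, _, pA, P, hp⟩ := Plucker.exists_plModel k r n hrn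
  have : Nonempty (Fin r) := ⟨⟨0, hr⟩⟩
  have : Nonempty (Fin (n - r)) := ⟨⟨0, by omega⟩⟩
  intro i hi
  refine P.vanishing (by simp only [Fintype.card_fin]; omega) hp i ?_
  simp only [Fintype.card_fin]
  omega

end
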